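/- Let n > 2 be an integer, let q be a prime power, and let G be a group with SL_n(q) ≤ G ≤ GL_n(q). Then n/12 < κ(G) ≤ γ(G) ≤ (n+1)/2. -/

import Mathlib

/-- `k` classes of proper subgroups whose conjugates cover `G`. -/
def IsNormalCover (G : Type*) [Group G] (k : ℕ) : Prop :=
  ∃ H : Fin k → Subgroup G, (∀ i, H i ≠ ⊤) ∧
    ∀ g : G, ∃ i : Fin k, ∃ x : G, x * g * x⁻¹ ∈ H i

/-- `γ(G)`: the least number of conjugacy classes of proper subgroups needed to cover `G`. -/
noncomputable def gammaCover (G : Type*) [Group G] : ℕ := sInf {k | IsNormalCover G k}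

/-- A set of conjugacy classes is independent if any pair of elements from two distinct
classes of the set generates `G`. -/
def IsIndependentClasses (G : Type*) [Group G] (S : Finset (ConjClasses G)) : Prop :=
  ∀ c ∈ S, ∀ d ∈ S, c ≠ d → ∀ x ∈ c.carrier, ∀ y ∈ d.carrier,
    Subgroup.closure {x, y} = ⊤

/-- `κ(G)`: the size of the largest independent set of conjugacy classes of `G`. -/
noncomputable def kappaIndep (G : Type*) [Group G] : ℕ :=
  sSup {k | ∃ S : Finset (ConjClasses G), S.card = k ∧ IsIndependentClasses G S}

/-- `ν(n)`: the number of distinct prime divisors of `n`. -/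
def nuPrimes (n : ℕ) : ℕ := n.primeFactors.card

/-- Lehmer's partial totient `φ(k, t, n)`: the number of integers `x` coprime to `n`
with `n t / k < x < n (t+1) / k`. -/
def partialTotient (k t n : ℕ) : ℕ :=
  ((Finset.range (n * (t + 1) + 1)).filter
    (fun x => Nat.Coprime x n ∧ (n * t : ℚ) / k < (x : ℚ) ∧ (x : ℚ) < (n * (t + 1) : ℚ) / k)).card

/-- The copy of `SL_n(F)` inside `GL_n(F)`. -/
def SLinGL (n : ℕ) (F : Type*) [Field F] : Subgroup (GL (Fin n) F) :=
  (Matrix.SpecialLinearGroup.toGL (n := Fin n) (R := F)).range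

/-- A subring of a field, closed under inverses, which does not contain `x`: the elements
`a + b x` are pairwise distinct. -/
theorem ncard_sq_le_of_notMem {E : Type*} [Field E] [Finite E] (L : Subfield E) (X : Set E)
    {x : E} (hx : x ∉ L) (hX : ∀ a ∈ L, ∀ b ∈ L, a + b * x ∈ X) :
    Nat.card L * Nat.card L ≤ Nat.card X := by
  rw [← Nat.card_prod]
  refine Nat.card_le_card_of_injective
    (fun p : L × L => (⟨p.1 + p.2 * x, hX _ p.1.2 _ p.2.2⟩ : X)) ?_
  rintro ⟨⟨a, ha⟩, ⟨b, hb⟩⟩ ⟨⟨a', ha'⟩, ⟨b', hb'⟩⟩ h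
  simp only [Subtype.mk.injEq] at h
  by_cases hbb : b = b'
  · subst hbb
    simpa using h
  · exfalso
    apply hx
    have h1 : b - b' ≠ 0 := sub_ne_zero.2 hbb
    have : x = (a' - a) / (b - b') := by
      rw [eq_div_iff h1]; linear_combination h
    rw [this]
    exact L.div_mem (L.sub_mem ha' ha) (L.sub_mem hb hb')

/-- The multipliers of a finite additive subgroup of a field form a subfield. -/
def multiplierSubfield {E : Type*} [Field E] [Finite E] (X : AddSubgroup E) : Subfield E where
  carrier := {l | ∀ x ∈ X, l * x ∈ X}
  mul_mem' := fun {a b} ha hb x hx => by rw [mul_assoc]; exact ha _ (hb _ hx)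
  one_mem' := fun x hx => by simpa using hx
  add_mem' := fun {a b} ha hb x hx => by rw [add_mul]; exact X.add_mem (ha _ hx) (hb _ hx)
  zero_mem' := fun x _ => by simp
  neg_mem' := fun {a} ha x hx => by rw [neg_mul]; exact X.neg_mem (ha _ hx)
  inv_mem' := fun a ha x hx => by
    by_cases h0 : a = 0
    · simp [h0]
    have hinj : Function.Injective (fun y : X => (⟨a * y, ha _ y.2⟩ : X)) := by
      rintro ⟨y, hy⟩ ⟨z, hz⟩ h
      simpa [h0] using h
    obtain ⟨y, hy⟩ := (Finite.surjective_of_injective hinj) ⟨x, hx⟩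
    have : a * (y : E) = x := congrArg Subtype.val hy
    rw [← this, inv_mul_cancel_left₀ h0]
    exact y.2

/-- A consequence of Hua's identity: an additive subgroup of a finite field that is closed under
inverses and has at least `2 * √|E|` elements is everything. -/
theorem AddSubgroup.eq_top_of_inv_mem {E : Type*} [Field E] [Finite E] (X : AddSubgroup E)
    (hinv : ∀ x ∈ X, x⁻¹ ∈ X) (hcard : 4 * Nat.card E ≤ Nat.card X * Nat.card X) :
    X = ⊤ := by
  classical
  have hsq : ∀ a ∈ X, ∀ b ∈ X, a * a * b ∈ X := by
    intro a ha b hb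
    by_cases ha0 : a = 0
    · simp [ha0]
    by_cases hb0 : b = 0
    · simp [hb0]
    by_cases hab : a * b = 1
    · rw [mul_assoc, hab, mul_one]; exact ha
    have hne : b⁻¹ - a ≠ 0 := by
      intro h
      apply hab
      rw [← sub_eq_zero.1 h, inv_mul_cancel₀ hb0]
    have hba : 1 - a * b ≠ 0 := sub_ne_zero.2 (Ne.symm hab)
    have hne2 : a⁻¹ + (b⁻¹ - a)⁻¹ = (a * (1 - a * b))⁻¹ := by
      have : b⁻¹ - a = (1 - a * b) / b := by field_simp
      rw [this]
      field_simp
      ring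
    have : a * a * b = a - (a⁻¹ + (b⁻¹ - a)⁻¹)⁻¹ := by
      rw [hne2, inv_inv]; ring
    rw [this]
    exact X.sub_mem ha (hinv _ (X.add_mem (hinv _ ha) (hinv _ (X.sub_mem (hinv _ hb) ha))))
  set L := multiplierSubfield X with hL
  let _ : Fintype X := Fintype.ofFinite _
  let _ : Fintype L := Fintype.ofFinite _
  have hsqL : ∀ a ∈ X, a * a ∈ L := fun a ha b hb => hsq a ha b hb
  have hLcard : Nat.card X + 1 ≤ 2 * Nat.card L := by
    have hfib : ∀ l : L, (Finset.univ.filter (fun x : X => (x : E) * x = l)).card ≤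
        if (l : E) = 0 then 1 else 2 := by
      intro l
      split_ifs with h0
      · rw [Finset.card_le_one]
        intro x hx y hy
        simp only [Finset.mem_filter, Finset.mem_univ, true_and, h0, mul_self_eq_zero] at hx hy
        exact Subtype.ext (hx.trans hy.symm)
      · by_contra hlt
        push Not at hlt
        obtain ⟨x, y, z, hx, hy, hz, hxy, hxz, hyz⟩ := Finset.two_lt_card_iff.1 hlt
        simp only [Finset.mem_filter, Finset.mem_univ, true_and] at hx hy hz
        rcases mul_self_eq_mul_self_iff.1 (hx.trans hy.symm) with h | h
        · exact hxy (Subtype.ext h)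
        rcases mul_self_eq_mul_self_iff.1 (hx.trans hz.symm) with h' | h'
        · exact hxz (Subtype.ext h')
        · exact hyz (Subtype.ext (neg_injective (h.symm.trans h')))
    have hmaps : ∀ x ∈ (Finset.univ : Finset X),
        (⟨(x : E) * x, hsqL _ x.2⟩ : L) ∈ (Finset.univ : Finset L) := fun _ _ => Finset.mem_univ _
    have := Finset.card_eq_sum_card_fiberwise hmaps
    rw [Finset.card_univ] at this
    have h2 : Fintype.card X ≤ ∑ l : L, if (l : E) = 0 then 1 else 2 := by
      rw [this]
      refine Finset.sum_le_sum fun l _ => ?_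
      refine le_trans (le_of_eq ?_) (hfib l)
      congr 1
      ext x
      simp [Subtype.ext_iff]
    have h3 : (∑ l : L, if (l : E) = 0 then 1 else 2) + 1 = 2 * Fintype.card L := by
      have h4 : ∀ l : L, (if (l : E) = 0 then 1 else 2) + (if l = 0 then 1 else 0) = 2 := by
        intro l
        by_cases h : l = 0 <;> simp [h]
      have h5 : ∑ l : L, (if l = 0 then 1 else 0) = 1 := by simp
      have h6 : (∑ l : L, if (l : E) = 0 then 1 else 2) + (∑ l : L, if l = 0 then 1 else 0) =
          2 * Fintype.card L := by
        rw [← Finset.sum_add_distrib, Finset.sum_congr rfl (fun l _ => h4 l)]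
        simp [mul_comm]
      rwa [h5] at h6
    rw [Nat.card_eq_fintype_card, Nat.card_eq_fintype_card]
    omega
  have hLtop : ∀ x, x ∈ L := by
    by_contra hcon
    push Not at hcon
    obtain ⟨x, hxL⟩ := hcon
    have := ncard_sq_le_of_notMem L Set.univ hxL (fun _ _ _ _ => trivial)
    rw [Nat.card_congr (Equiv.Set.univ E)] at this
    nlinarith
  have hX : ∃ x ∈ X, x ≠ 0 := by
    by_contra! hcon
    have : X = ⊥ := (AddSubgroup.eq_bot_iff_forall _).2 hcon
    have h1 : 0 < Nat.card E := Nat.card_pos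
    rw [this, AddSubgroup.card_bot] at hcard
    omega
  obtain ⟨x, hx, hx0⟩ := hX
  refine eq_top_iff.2 fun e _ => ?_
  have := hLtop (e / x) x hx
  rwa [div_mul_cancel₀ _ hx0] at this

/-- The Fourier transform of (the indicator function of) a finite set with respect to a pairing. -/
noncomputable def pairingFourier {F P Q : Type*} [Field F] [AddCommGroup P] [Module F P]
    [AddCommGroup Q] [Module F Q] (ψ : AddChar F ℂ) (B : P →ₗ[F] Q →ₗ[F] F) (X : Finset P)
    (y : Q) : ℂ := ∑ x ∈ X, ψ (B x y)

section Fourier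

variable {F P Q : Type*} [Field F] [AddCommGroup P] [Module F P]
  [AddCommGroup Q] [Module F Q]

theorem sum_addChar_pairing (ψ : AddChar F ℂ) (hψ : ψ ≠ 1) (B : P →ₗ[F] Q →ₗ[F] F)
    (Y : Submodule F Q) (Yf : Finset Q) (hY : ∀ y, y ∈ Yf ↔ y ∈ Y) (x : P)
    [Decidable (∀ y ∈ Y, B x y = 0)] :
    ∑ y ∈ Yf, ψ (B x y) = if ∀ y ∈ Y, B x y = 0 then (Yf.card : ℂ) else 0 := by
  split_ifs with h
  · rw [Finset.sum_congr rfl (fun y hy => by rw [h y ((hY y).1 hy), AddChar.map_zero_eq_one])]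
    simp
  · push Not at h
    obtain ⟨y₀, hy₀, hne⟩ := h
    obtain ⟨c, hc⟩ := AddChar.ne_one_iff.1 hψ
    set y₁ : Q := (c / B x y₀) • y₀
    have hy₁ : y₁ ∈ Y := Y.smul_mem _ hy₀
    have hB : B x y₁ = c := by simp [y₁, hne]
    have key : ψ c * ∑ y ∈ Yf, ψ (B x y) = ∑ y ∈ Yf, ψ (B x y) := by
      rw [Finset.mul_sum]
      refine Finset.sum_bij' (fun y _ => y₁ + y) (fun y _ => y - y₁) ?_ ?_ ?_ ?_ ?_
      · intro y hy; exact (hY _).2 (Y.add_mem hy₁ ((hY _).1 hy))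
      · intro y hy; exact (hY _).2 (Y.sub_mem ((hY _).1 hy) hy₁)
      · intro y _; simp
      · intro y _; simp
      · intro y _; rw [map_add, hB, AddChar.map_add_eq_mul]
    have : (ψ c - 1) * ∑ y ∈ Yf, ψ (B x y) = 0 := by rw [sub_mul, key]; ring
    rcases mul_eq_zero.1 this with h' | h'
    · exact absurd (sub_eq_zero.1 h') hc
    · exact h'

theorem norm_pairingFourier_le [Finite F] (ψ : AddChar F ℂ) (B : P →ₗ[F] Q →ₗ[F] F) (X : Finset P)
    (y : Q) :
    ‖pairingFourier ψ B X y‖ ≤ X.card := by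
  unfold pairingFourier
  refine (norm_sum_le _ _).trans ?_
  simp

open Classical in
/-- The Plancherel identity on a subspace. -/
theorem sum_norm_sq_pairingFourier [Finite F] (ψ : AddChar F ℂ) (hψ : ψ ≠ 1) (B : P →ₗ[F] Q →ₗ[F] F)
    (Y : Submodule F Q) (Yf : Finset Q) (hY : ∀ y, y ∈ Yf ↔ y ∈ Y) (X : Finset P) :
    ∑ y ∈ Yf, ‖pairingFourier ψ B X y‖ ^ 2 =
      Yf.card * ((X ×ˢ X).filter (fun p => ∀ y ∈ Y, B (p.1 - p.2) y = 0)).card := by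
  have h1 : ∀ y, ((‖pairingFourier ψ B X y‖ ^ 2 : ℝ) : ℂ) =
      ∑ p ∈ X ×ˢ X, ψ (B (p.1 - p.2) y) := by
    intro y
    push_cast
    rw [← Complex.mul_conj', pairingFourier, map_sum, Finset.sum_mul_sum, Finset.sum_product]
    refine Finset.sum_congr rfl fun x _ => Finset.sum_congr rfl fun x' _ => ?_
    rw [map_sub, LinearMap.sub_apply, AddChar.map_sub_eq_div, div_eq_mul_inv,
      ← AddChar.map_neg_eq_inv, AddChar.map_neg_eq_conj]
  have h2 : ((∑ y ∈ Yf, ‖pairingFourier ψ B X y‖ ^ 2 : ℝ) : ℂ) =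
      ((Yf.card * ((X ×ˢ X).filter (fun p => ∀ y ∈ Y, B (p.1 - p.2) y = 0)).card : ℝ) : ℂ) := by
    rw [Complex.ofReal_sum, Finset.sum_congr rfl (fun y _ => h1 y), Finset.sum_comm,
      Finset.sum_congr rfl (fun p _ => sum_addChar_pairing ψ hψ B Y Yf hY (p.1 - p.2)),
      ← Finset.sum_filter]
    simp [mul_comm]
  exact_mod_cast h2

open Classical in
theorem sum_norm_sq_pairingFourier_univ [Finite F] [Fintype Q] (ψ : AddChar F ℂ) (hψ : ψ ≠ 1)
    (B : P →ₗ[F] Q →ₗ[F] F) (hB : ∀ x, (∀ y, B x y = 0) → x = 0) (X : Finset P) :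
    ∑ y : Q, ‖pairingFourier ψ B X y‖ ^ 2 = Fintype.card Q * X.card := by
  rw [sum_norm_sq_pairingFourier ψ hψ B ⊤ Finset.univ (by simp) X]
  congr 2
  refine Finset.card_nbij' (fun p => p.1) (fun x => (x, x)) ?_ ?_ ?_ ?_
  · intro p; simp; tauto
  · intro p; simp
  · rintro ⟨x, x'⟩ hp
    simp only [Finset.coe_filter, Finset.mem_product, Submodule.mem_top, forall_const,
      Set.mem_ofPred_eq] at hp
    have := sub_eq_zero.1 (hB _ hp.2)
    simp [this]
  · intro x; simp

/-- If the Fourier transform has constant norm on a set of size at least `σ` containing `y`, it is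
small at `y`. -/
theorem norm_sq_pairingFourier_le_div [Finite F] [Fintype Q] (ψ : AddChar F ℂ) (hψ : ψ ≠ 1)
    (B : P →ₗ[F] Q →ₗ[F] F) (hB : ∀ x, (∀ y, B x y = 0) → x = 0) (X : Finset P) {σ : ℝ}
    (hσ : 0 < σ) (y : Q) (O : Finset Q) (hO : σ ≤ O.card)
    (hy : ∀ y' ∈ O, ‖pairingFourier ψ B X y'‖ = ‖pairingFourier ψ B X y‖) :
    ‖pairingFourier ψ B X y‖ ^ 2 ≤ Fintype.card Q * X.card / σ := by
  rw [le_div_iff₀ hσ, ← sum_norm_sq_pairingFourier_univ ψ hψ B hB X]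
  calc ‖pairingFourier ψ B X y‖ ^ 2 * σ ≤ ‖pairingFourier ψ B X y‖ ^ 2 * O.card := by gcongr
    _ = ∑ y' ∈ O, ‖pairingFourier ψ B X y'‖ ^ 2 := by
      rw [Finset.sum_congr rfl (fun y' h => by rw [hy y' h])]; simp [mul_comm]
    _ ≤ _ := Finset.sum_le_sum_of_subset_of_nonneg (Finset.subset_univ _) (by intros; positivity)

open Classical in
theorem card_pairs_le [Finite F] [Fintype Q] (ψ : AddChar F ℂ) (hψ : ψ ≠ 1)
    (B : P →ₗ[F] Q →ₗ[F] F) (hB : ∀ x, (∀ y, B x y = 0) → x = 0)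
    (Y : Submodule F Q) (Yf : Finset Q) (hY : ∀ y, y ∈ Yf ↔ y ∈ Y) (X : Finset P) (D : Finset Q)
    (hD : D ⊆ Yf) {σ : ℝ} (hσ : 0 < σ)
    (hsp : ∀ y ∉ D, ∃ O : Finset Q, σ ≤ O.card ∧
      ∀ y' ∈ O, ‖pairingFourier ψ B X y'‖ = ‖pairingFourier ψ B X y‖) :
    (Yf.card : ℝ) * ((X ×ˢ X).filter (fun p => ∀ y ∈ Y, B (p.1 - p.2) y = 0)).card ≤
      D.card * X.card ^ 2 + Yf.card * (Fintype.card Q * X.card / σ) := by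
  have h := sum_norm_sq_pairingFourier ψ hψ B Y Yf hY X
  refine le_of_eq_of_le (b := ∑ y ∈ Yf, ‖pairingFourier ψ B X y‖ ^ 2) (by convert h.symm) ?_
  rw [← Finset.sum_sdiff hD, add_comm]
  refine add_le_add ?_ ?_
  · rw [← nsmul_eq_mul]
    refine Finset.sum_le_card_nsmul _ _ _ fun y _ => ?_
    gcongr
    exact norm_pairingFourier_le ψ B X y
  · calc _ ≤ (Yf \ D).card • (Fintype.card Q * X.card / σ) := by
          refine Finset.sum_le_card_nsmul _ _ _ fun y hy => ?_
          obtain ⟨O, hO, hO'⟩ := hsp y (Finset.mem_sdiff.1 hy).2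
          exact norm_sq_pairingFourier_le_div ψ hψ B hB X hσ y O hO hO'
      _ ≤ _ := by
        rw [nsmul_eq_mul]
        gcongr
        exact Finset.sdiff_subset

end Fourier

theorem le_mul_of_spectral_inequality {p g κ Q s a ε x : ℝ} (hp : 1 ≤ p) (hg : 1 ≤ g)
    (hκ : 1 ≤ κ) (hQ : 16 * (p * g * κ) ≤ Q) (hs : Q - 1 ≤ s * p)
    (hε : ε ≤ κ) (hx : (Q - 1) / g ≤ x)
    (h : κ * (s * (x - ε)) ≤ a * x ^ 2 + κ * (κ * Q * x / ((Q - 1) / g))) :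
    κ * Q ≤ 2 * p * (a * x) := by
  by_contra! hcon
  have hgκ : 1 ≤ g * κ := one_le_mul_of_one_le_of_one_le hg hκ
  have hpg : g * κ ≤ p * g * κ := by nlinarith
  have hQ16 : 16 ≤ Q := by linarith
  have hM : 0 < (Q - 1) / g := div_pos (by linarith) (by linarith)
  have hx0 : 0 < x := by linarith
  have hεx : ε ≤ x / 15 := by
    have h1 : 15 * κ ≤ (Q - 1) / g := by
      rw [le_div_iff₀ (by linarith)]
      linarith
    linarith
  have h1 : κ * ((Q - 1) * (x - ε)) ≤ p * (a * x ^ 2 + κ * (κ * Q * x / ((Q - 1) / g))) := by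
    calc κ * ((Q - 1) * (x - ε)) ≤ κ * (s * p * (x - ε)) := by
          gcongr
          linarith
      _ = p * (κ * (s * (x - ε))) := by ring
      _ ≤ _ := by gcongr
  have h2 : p * (a * x ^ 2) ≤ κ * (Q * x / 2) := by nlinarith
  have h3 : p * (κ * Q * x / ((Q - 1) / g)) ≤ Q * x / 15 := by
    rw [← mul_div_assoc, div_le_iff₀ hM]
    have h0 : Q * x / 15 * ((Q - 1) / g) = (Q * x * ((Q - 1) / 15)) / g := by ring
    rw [h0, le_div_iff₀ (by linarith)]
    have : p * g * κ ≤ (Q - 1) / 15 := by linarith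
    have h4 := mul_le_mul_of_nonneg_right this (show 0 ≤ Q * x by nlinarith)
    linarith
  have h4 : κ * ((Q - 1) * (x - ε)) ≤ κ * (Q * x / 2 + Q * x / 15) := by
    have := mul_le_mul_of_nonneg_left h3 (by linarith : 0 ≤ κ)
    linarith
  have h5 := le_of_mul_le_mul_left h4 (by linarith)
  have h6 : (Q * 15 / 16) * (x * 14 / 15) ≤ (Q - 1) * (x - ε) := by
    apply mul_le_mul <;> linarith
  have : 0 < Q * x := by positivity
  linarith

section Spectral

variable {F P Q : Type*} [Field F] [AddCommGroup P] [Module F P]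
  [AddCommGroup Q] [Module F Q]

open Classical in
/-- A lower bound for the size of a set whose Fourier transform is constant on big sets and which
has many pairs with difference in the orthogonal of `Y`. -/
theorem card_lower_bound [Finite F] [Fintype Q] (ψ : AddChar F ℂ) (hψ : ψ ≠ 1)
    (B : P →ₗ[F] Q →ₗ[F] F) (hB : ∀ x, (∀ y, B x y = 0) → x = 0)
    (Y : Submodule F Q) (Yf : Finset Q) (hY : ∀ y, y ∈ Yf ↔ y ∈ Y) (X Z : Finset P) (D : Finset Q)
    (hD : D ⊆ Yf) (hD0 : D.Nonempty) {p g s Q' : ℝ} (hp : 1 ≤ p) (hg : 1 ≤ g)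
    (hQ : 16 * (p * g * Yf.card) ≤ Q') (hcard : (Fintype.card Q : ℝ) = Yf.card * Q')
    (hsp : ∀ y ∉ D, ∃ O : Finset Q, (Q' - 1) / g ≤ O.card ∧
      ∀ y' ∈ O, ‖pairingFourier ψ B X y'‖ = ‖pairingFourier ψ B X y‖)
    (hs : Q' - 1 ≤ s * p) (hZX : Z ⊆ X) (hZ : Z.card ≤ Yf.card)
    (hXZ : ∀ x ∈ X, x ∉ Z → s ≤ (X.filter fun x' => ∀ y ∈ Y, B (x - x') y = 0).card)
    (hX : (Q' - 1) / g ≤ X.card) :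
    Yf.card * Q' ≤ 2 * p * (D.card * X.card) := by
  have hκ : (1 : ℝ) ≤ Yf.card := by
    exact_mod_cast Finset.card_pos.2 (hD0.mono hD)
  refine le_mul_of_spectral_inequality hp hg hκ hQ hs (ε := (Z.card : ℝ)) (Nat.cast_le.2 hZ)
    hX ?_
  rw [← hcard]
  refine le_trans ?_ (card_pairs_le ψ hψ B hB Y Yf hY X D hD (div_pos (by
    have := one_le_mul_of_one_le_of_one_le (one_le_mul_of_one_le_of_one_le hp hg) hκ
    linarith) (by linarith)) hsp)
  refine mul_le_mul_of_nonneg_left ?_ (by positivity)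
  have h1 : ((X ×ˢ X).filter (fun p => ∀ y ∈ Y, B (p.1 - p.2) y = 0)).card =
      ∑ x ∈ X, (X.filter fun x' => ∀ y ∈ Y, B (x - x') y = 0).card := by
    rw [Finset.card_filter, Finset.sum_product]
    refine Finset.sum_congr rfl fun x _ => ?_
    rw [Finset.card_filter]
  rw [h1]
  push_cast
  calc s * ((X.card : ℝ) - Z.card) = ((X \ Z).card) • s := by
        rw [nsmul_eq_mul, Finset.cast_card_sdiff hZX, mul_comm]
    _ ≤ ∑ x ∈ X \ Z, ((X.filter fun x' => ∀ y ∈ Y, B (x - x') y = 0).card : ℝ) := by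
        refine Finset.card_nsmul_le_sum _ _ _ fun x hx => ?_
        rw [Finset.mem_sdiff] at hx
        exact hXZ x hx.1 hx.2
    _ ≤ _ := Finset.sum_le_sum_of_subset_of_nonneg Finset.sdiff_subset (by intros; positivity)

end Spectral

theorem sum_comp_eq_of_mapsTo {α M : Type*} [AddCommMonoid M] (X : Finset α) (g : α → α)
    (hg : Function.Injective g) (hX : ∀ x ∈ X, g x ∈ X) (f : α → M) :
    ∑ x ∈ X, f (g x) = ∑ x ∈ X, f x := by
  classical
  have : X.image g = X := by
    refine Finset.eq_of_subset_of_card_le (Finset.image_subset_iff.2 hX) ?_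
    rw [Finset.card_image_of_injective _ hg]
  conv_rhs => rw [← this]
  rw [Finset.sum_image hg.injOn]

section Spectral

variable {F V : Type*} [Field F] [AddCommGroup V] [Module F V]

theorem natCard_dualAnnihilator_mul [Finite F] [Finite V] (W : Submodule F V) :
    Nat.card W * Nat.card W.dualAnnihilator = Nat.card V := by
  rw [Module.natCard_eq_pow_finrank (K := F) (V := W),
    Module.natCard_eq_pow_finrank (K := F) (V := W.dualAnnihilator),
    Module.natCard_eq_pow_finrank (K := F) (V := V), ← pow_add,
    Subspace.finrank_add_finrank_dualAnnihilator_eq]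

theorem natCard_mul_of_isCompl [Finite F] [Finite V] {U W : Submodule F V} (h : IsCompl U W) :
    Nat.card U * Nat.card W = Nat.card V := by
  rw [Module.natCard_eq_pow_finrank (K := F) (V := W),
    Module.natCard_eq_pow_finrank (K := F) (V := U),
    Module.natCard_eq_pow_finrank (K := F) (V := V), ← pow_add,
    Submodule.finrank_add_eq_of_isCompl h]

theorem pairingFourier_eval_smul_comp (ψ : AddChar F ℂ) (X : Finset V) (f : V →ₗ[F] V)
    (hf : Function.Injective f) (c : F) (hc : c ≠ 0) (hX : ∀ x ∈ X, c • f x ∈ X)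
    (φ : Module.Dual F V) :
    pairingFourier ψ (Module.Dual.eval F V) X (c • (φ ∘ₗ f)) =
      pairingFourier ψ (Module.Dual.eval F V) X φ := by
  have h := sum_comp_eq_of_mapsTo X (fun x => c • f x)
    ((smul_right_injective V hc).comp hf) hX (fun x => ψ (φ x))
  simpa [pairingFourier] using h

theorem pairingFourier_id_smul_apply [Finite V] (ψ : AddChar F ℂ) (X : Finset (Module.Dual F V))
    (f : V →ₗ[F] V)
    (hf : Function.Injective f) (c : F) (hc : c ≠ 0) (hX : ∀ φ ∈ X, c • (φ ∘ₗ f) ∈ X)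
    (v : V) :
    pairingFourier ψ LinearMap.id X (c • f v) =
      pairingFourier ψ LinearMap.id X v := by
  have hsurj : Function.Surjective f := Finite.surjective_of_injective hf
  have h := sum_comp_eq_of_mapsTo X (fun φ => c • (φ ∘ₗ f)) ?_ hX (fun φ => ψ (φ v))
  · simpa [pairingFourier] using h
  · intro φ φ' h
    have h' := smul_right_injective (Module.Dual F V) hc h
    ext v
    obtain ⟨w, rfl⟩ := hsurj v
    exact LinearMap.congr_fun h' w

open Classical in
/-- A set that avoids a subspace of small index has many pairs of elements with difference in this
subspace. -/
theorem card_sq_le_card_pairs [Finite V] {U W : Submodule F V} (h : IsCompl U W) (X : Finset V)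
    (hX : ∀ x ∈ X, x ∉ W) :
    X.card ^ 2 ≤ (Nat.card U - 1) *
      ((X ×ˢ X).filter (fun p => ∀ φ ∈ W.dualAnnihilator, φ (p.1 - p.2) = 0)).card := by
  let _ : Fintype U := Fintype.ofFinite U
  set p : V →ₗ[F] U := U.projectionOnto W h
  have hp : ∀ x, p x = 0 ↔ x ∈ W := fun x => Submodule.projectionOnto_apply_eq_zero_iff h
  have hmaps : ∀ x ∈ X, p x ∈ (Finset.univ.erase 0 : Finset U) := by
    intro x hx
    simp [hp, hX x hx]
  have h1 := Finset.card_eq_sum_card_fiberwise hmaps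
  have h2 := sq_sum_le_card_mul_sum_sq (s := (Finset.univ.erase 0 : Finset U))
    (f := fun u => (X.filter (fun x => p x = u)).card)
  rw [Finset.card_erase_of_mem (Finset.mem_univ _), Finset.card_univ] at h2
  rw [h1, Nat.card_eq_fintype_card]
  refine h2.trans (Nat.mul_le_mul_left _ (le_of_eq ?_))
  rw [Finset.card_filter, Finset.sum_product]
  have h3 : ∀ x ∈ X, (∑ x' ∈ X, if ∀ φ ∈ W.dualAnnihilator, φ (x - x') = 0 then 1 else 0) =
      (X.filter (fun x' => p x' = p x)).card := by
    intro x _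
    rw [← Finset.card_filter]
    congr 1
    ext x'
    simp only [Finset.mem_filter, Subspace.forall_mem_dualAnnihilator_apply_eq_zero_iff]
    rw [← hp, map_sub, sub_eq_zero, eq_comm]
  rw [Finset.sum_congr rfl h3, ← Finset.sum_fiberwise_of_maps_to hmaps]
  refine Finset.sum_congr rfl fun u _ => ?_
  rw [Finset.sum_congr rfl (g := fun _ => (X.filter (fun x => p x = u)).card)]
  · simp [sq]
  · intro x hx
    rw [(Finset.mem_filter.1 hx).2]

theorem card_dualAnnihilator_restrict_le [Finite F] [Finite V] {U W A : Submodule F V}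
    (h : IsCompl U W) (hA : A ≤ U) (S : Finset (Module.Dual F V)) (φ' : Module.Dual F V)
    (hSW : ∀ φ ∈ S, φ ∈ W.dualAnnihilator)
    (hS : ∀ φ ∈ S, ∃ c : F, c ≠ 0 ∧ ∀ a ∈ A, φ' a = c * φ a) :
    S.card * Nat.card A ≤ (Nat.card F - 1) * Nat.card U := by
  classical
  let _ : Fintype F := Fintype.ofFinite F
  have hfin : Finite (Module.Dual F V) := DFunLike.finite _
  let _ : Fintype (Module.Dual F V) := Fintype.ofFinite _
  set β : Submodule F (Module.Dual F V) := (W ⊔ A).dualAnnihilator with hβ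
  have hβcard : Nat.card β * Nat.card A = Nat.card U := by
    have h1 := natCard_dualAnnihilator_mul (W ⊔ A)
    have h2 := natCard_mul_of_isCompl h
    have h3 : Nat.card (W ⊔ A : Submodule F V) = Nat.card W * Nat.card A := by
      rw [Module.natCard_eq_pow_finrank (K := F) (V := W),
        Module.natCard_eq_pow_finrank (K := F) (V := A),
        Module.natCard_eq_pow_finrank (K := F) (V := (W ⊔ A : Submodule F V)), ← pow_add,
        ← Submodule.finrank_sup_add_finrank_inf_eq W A, (h.symm.disjoint.mono_right hA).eq_bot]
      simp
    rw [h3, ← h2, mul_comm (Nat.card U), mul_assoc] at h1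
    have := Nat.eq_of_mul_eq_mul_left Nat.card_pos h1
    rw [← this, mul_comm]
  rw [← hβcard, ← mul_assoc]
  refine Nat.mul_le_mul_right _ ?_
  have hsub : S ⊆ (Finset.univ.erase (0 : F)).biUnion
      (fun c => S.filter (fun φ => ∀ a ∈ A, φ' a = c * φ a)) := by
    intro φ hφ
    obtain ⟨c, hc, h⟩ := hS φ hφ
    simp only [Finset.mem_biUnion, Finset.mem_erase, Finset.mem_univ, Finset.mem_filter]
    exact ⟨c, ⟨hc, trivial⟩, hφ, h⟩
  refine (Finset.card_le_card hsub).trans ?_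
  refine (Finset.card_biUnion_le_card_mul _ _ (Nat.card β) ?_).trans (le_of_eq ?_)
  · intro c hc
    rcases Finset.eq_empty_or_nonempty (S.filter (fun φ => ∀ a ∈ A, φ' a = c * φ a)) with h0 | h0
    · rw [h0]; simp
    obtain ⟨φ₀, hφ₀⟩ := h0
    rw [Finset.mem_filter] at hφ₀
    have hb : Nat.card β = (β : Set (Module.Dual F V)).toFinset.card := by
      rw [Set.toFinset_card, ← Nat.card_eq_fintype_card]; rfl
    rw [hb]
    refine Finset.card_le_card_of_injOn (fun φ => φ - φ₀) ?_ ?_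
    · intro φ hφ
      rw [Finset.mem_coe, Finset.mem_filter] at hφ
      have hc0 : c ≠ 0 := (Finset.mem_erase.1 hc).1
      simp only [Set.coe_toFinset, SetLike.mem_coe, hβ]
      rw [Submodule.dualAnnihilator_sup_eq]
      refine ⟨Submodule.sub_mem _ (hSW _ hφ.1) (hSW _ hφ₀.1), ?_⟩
      rw [SetLike.mem_coe, Submodule.mem_dualAnnihilator]
      intro a ha
      have h1 := hφ.2 a ha
      rw [hφ₀.2 a ha] at h1
      rw [LinearMap.sub_apply, mul_left_cancel₀ hc0 h1, sub_self]
    · intro φ _ φ₂ _ h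
      simpa using h
  · rw [Finset.card_erase_of_mem (Finset.mem_univ _), Finset.card_univ,
      Nat.card_eq_fintype_card (α := F)]

end Spectral

theorem spectral_contradiction {q κ Q N x : ℝ} (hq : 2 ≤ q) (hκ : 1 ≤ κ) (hQ : q ^ 4 * κ ≤ Q)
    (hx0 : 0 < x)
    (h1 : κ * Q ≤ 2 * (q - 1) * x)
    (h2 : x ^ 2 ≤ (κ - 1) * N)
    (h3 : κ * N ≤ x ^ 2 + 2 * (q - 1) ^ 2 * κ * x) : False := by
  have hR : 0 ≤ 2 * (q - 1) ^ 2 * κ * x := by positivity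
  have hN : N ≤ 2 * (q - 1) ^ 2 * κ * x := by linarith
  have h4 : x ^ 2 ≤ κ * (2 * (q - 1) ^ 2 * κ * x) := by
    have := mul_le_mul_of_nonneg_left hN (by linarith : 0 ≤ κ - 1)
    linarith
  have h5 : x ≤ 2 * (q - 1) ^ 2 * κ ^ 2 := by
    by_contra! hc
    nlinarith
  have hq1 : 0 < q - 1 := by linarith
  have h6 : κ * Q ≤ 2 * (q - 1) * (2 * (q - 1) ^ 2 * κ ^ 2) := h1.trans (by gcongr)
  have h7 : κ * Q ≤ κ * (4 * (q - 1) ^ 3 * κ) := by linarith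
  have h8 := le_of_mul_le_mul_left h7 (by linarith)
  have h9 : q ^ 4 * κ ≤ (4 * (q - 1) ^ 3) * κ := hQ.trans h8
  have h10 := le_of_mul_le_mul_right h9 (by linarith)
  obtain ⟨t, rfl⟩ : ∃ t, q = t + 2 := ⟨q - 2, by ring⟩
  have ht : 0 ≤ t := by linarith
  have : 0 ≤ t ^ 2 := by positivity
  have : 0 ≤ t ^ 3 := by positivity
  have : 0 ≤ t ^ 4 := by positivity
  nlinarith

section Spectral

variable {F V : Type*} [Field F] [AddCommGroup V] [Module F V]

theorem Set.ncard_le_card_of_subset {α : Type*} {s : Set α} {t : Finset α}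
    (h : ∀ x ∈ s, x ∈ t) : s.ncard ≤ t.card := by
  rw [← Set.ncard_coe_finset]
  exact Set.ncard_le_ncard h

open Classical in
theorem spectral_lemma [Finite F] [Finite V] {U W A : Submodule F V} (hUW : IsCompl U W)
    (hA : A ≤ U) (K : Set (V →ₗ[F] V)) (hmul : ∀ f ∈ K, ∀ g ∈ K, f ∘ₗ g ∈ K)
    (hinj : ∀ f ∈ K, Function.Injective f) (hfix : ∀ f ∈ K, ∀ a ∈ A, f a = a)
    (hbig : Nat.card F ^ 4 * Nat.card U ≤ Nat.card W)
    (s : ℕ) (hs : Nat.card W - 1 ≤ s * (Nat.card F - 1))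
    (h1 : ∀ v ∉ A, Nat.card W - 1 ≤
      Set.ncard {v' | ∃ c : F, c ≠ 0 ∧ ∃ f ∈ K, v' = c • f v} * (Nat.card F - 1))
    (h2 : ∀ φ : Module.Dual F V, φ ≠ 0 → Nat.card W - 1 ≤
      Set.ncard {φ' : Module.Dual F V | ∃ c : F, c ≠ 0 ∧ ∃ f ∈ K, φ' = c • (φ ∘ₗ f)} *
        (Nat.card F - 1))
    (hs1 : ∀ v ∉ U, s ≤ Set.ncard {v' | (∃ f ∈ K, v' = f v) ∧ v' - v ∈ W})
    (hs2 : ∀ φ ∉ W.dualAnnihilator, s ≤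
      Set.ncard {φ' | (∃ f ∈ K, φ' = φ ∘ₗ f) ∧ φ' - φ ∈ U.dualAnnihilator})
    (X : Set V) (hX1 : ∀ x ∈ X, ∀ f ∈ K, f x ∈ X) (hX2 : ∀ x ∈ X, ∀ c : F, c ≠ 0 → c • x ∈ X)
    (hXW : ∀ x ∈ X, x ∉ W) (hXA : ∀ x ∈ X, x ∉ A) : X = ∅ := by
  let _ : Fintype F := Fintype.ofFinite F
  let _ : Fintype V := Fintype.ofFinite V
  have hfin : Finite (Module.Dual F V) := DFunLike.finite _
  let _ : Fintype (Module.Dual F V) := Fintype.ofFinite _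
  by_contra hne
  obtain ⟨x₀, hx₀⟩ := Set.nonempty_iff_ne_empty.2 hne
  -- numerical set-up
  obtain ⟨q, hqdef⟩ : ∃ q : ℝ, q = Nat.card F := ⟨_, rfl⟩
  obtain ⟨κ, hκdef⟩ : ∃ κ : ℝ, κ = Nat.card U := ⟨_, rfl⟩
  obtain ⟨Q, hQdef⟩ : ∃ Q : ℝ, Q = Nat.card W := ⟨_, rfl⟩
  have hF1 : 1 < Nat.card F := Finite.one_lt_card
  have hW1 : 1 ≤ Nat.card W := Nat.card_pos
  have hq : 2 ≤ q := by rw [hqdef]; exact_mod_cast hF1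
  have hκ : 1 ≤ κ := by rw [hκdef]; exact_mod_cast (Nat.card_pos : 0 < Nat.card U)
  have hQ : q ^ 4 * κ ≤ Q := by rw [hqdef, hκdef, hQdef]; exact_mod_cast hbig
  have hq1' : 1 ≤ q - 1 := by linarith
  have hq4 : 16 * ((q - 1) * (q - 1)) ≤ q ^ 4 := by
    have : 4 * (q - 1) ≤ q ^ 2 := by nlinarith [sq_nonneg (q - 2)]
    nlinarith
  have hQκ : 16 * ((q - 1) * (q - 1) * κ) ≤ Q := by nlinarith
  have hQ0 : 0 < Q := by nlinarith
  have hsR : Q - 1 ≤ s * (q - 1) := by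
    have : ((Nat.card W - 1 : ℕ) : ℝ) ≤ ((s * (Nat.card F - 1) : ℕ) : ℝ) := by exact_mod_cast hs
    rw [Nat.cast_mul, Nat.cast_sub hW1, Nat.cast_sub hF1.le] at this
    rw [hQdef, hqdef]; exact_mod_cast this
  have hcast : ∀ {k l : ℕ}, Nat.card W - 1 ≤ k * (Nat.card F - 1) → k ≤ l →
      (Q - 1) / (q - 1) ≤ (l : ℝ) := by
    intro k l h hkl
    have : ((Nat.card W - 1 : ℕ) : ℝ) ≤ ((k * (Nat.card F - 1) : ℕ) : ℝ) := by exact_mod_cast h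
    rw [Nat.cast_mul, Nat.cast_sub hW1, Nat.cast_sub hF1.le, Nat.cast_one, ← hQdef,
      ← hqdef] at this
    rw [div_le_iff₀ (by linarith)]
    exact this.trans (mul_le_mul_of_nonneg_right (by exact_mod_cast hkl) (by linarith))
  have hV : (Nat.card V : ℝ) = κ * Q := by
    rw [hκdef, hQdef]; exact_mod_cast (natCard_mul_of_isCompl hUW).symm
  have hD : (Nat.card (Module.Dual F V) : ℝ) = κ * Q := by
    rw [← hV, Module.natCard_eq_pow_finrank (K := F) (V := Module.Dual F V),
      Subspace.dual_finrank_eq, Module.natCard_eq_pow_finrank (K := F) (V := V)]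
  have hWann : (Nat.card W.dualAnnihilator : ℝ) = κ := by
    have h := natCard_dualAnnihilator_mul W
    rw [← natCard_mul_of_isCompl hUW, mul_comm] at h
    rw [hκdef, Nat.eq_of_mul_eq_mul_right Nat.card_pos h]
  obtain ⟨ψ, hψ⟩ : ∃ ψ : AddChar F ℂ, ψ ≠ 1 := by
    obtain ⟨ψ, hψ⟩ := AddChar.exists_apply_ne_zero.2 (one_ne_zero : (1 : F) ≠ 0)
    exact ⟨ψ, fun h => hψ (by simp [h])⟩
  have hB1 : ∀ x : V, (∀ φ, Module.Dual.eval F V x φ = 0) → x = 0 := fun x hx =>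
    (Module.forall_dual_apply_eq_zero_iff F x).1 hx
  have hB2 : ∀ φ : Module.Dual F V, (∀ x, (LinearMap.id (R := F) φ : Module.Dual F V) x = 0) →
      φ = 0 :=
    fun φ h => LinearMap.ext h
  set Xf : Finset V := X.toFinset with hXf
  have hmem : ∀ x, x ∈ Xf ↔ x ∈ X := fun x => Set.mem_toFinset
  set Yf : Finset (Module.Dual F V) := (W.dualAnnihilator : Set (Module.Dual F V)).toFinset with hYf
  have hYf' : ∀ y, y ∈ Yf ↔ y ∈ W.dualAnnihilator := fun y => Set.mem_toFinset
  have hYcard : (Yf.card : ℝ) = κ := by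
    rw [← hWann, hYf, Set.toFinset_card, ← Nat.card_eq_fintype_card]; rfl
  have hspX : ∀ φ : Module.Dual F V, ∀ c : F, c ≠ 0 → ∀ f ∈ K,
      ‖pairingFourier ψ (Module.Dual.eval F V) Xf (c • (φ ∘ₗ f))‖ =
      ‖pairingFourier ψ (Module.Dual.eval F V) Xf φ‖ := by
    intro φ c hc f hf
    rw [pairingFourier_eval_smul_comp ψ Xf f (hinj f hf) c hc]
    intro x hx
    rw [hmem] at hx ⊢
    exact hX2 _ (hX1 x hx f hf) c hc
  -- lower bound for `X`
  have hstep2 : κ * Q ≤ 2 * (q - 1) * Xf.card := by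
    have := card_lower_bound ψ hψ (Module.Dual.eval F V) hB1 W.dualAnnihilator Yf hYf' Xf
      (Xf.filter (· ∈ U)) {0} (by simp [hYf']) (by simp) hq1' hq1' (by rwa [hYcard])
      (by rw [← Nat.card_eq_fintype_card, hD, hYcard]) ?_ hsR (Finset.filter_subset _ _) ?_ ?_ ?_
    · rw [hYcard] at this
      simpa using this
    · intro φ hφ
      refine ⟨{φ' : Module.Dual F V | ∃ c : F, c ≠ 0 ∧ ∃ f ∈ K, φ' = c • (φ ∘ₗ f)}.toFinset, ?_, ?_⟩
      · rw [← Set.ncard_eq_toFinset_card']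
        exact hcast (h2 φ (by simpa using hφ)) le_rfl
      · intro φ' hφ'
        rw [Set.mem_toFinset] at hφ'
        obtain ⟨c, hc, f, hf, rfl⟩ := hφ'
        exact hspX φ c hc f hf
    · have h : (Xf.filter (· ∈ U)).card ≤ Nat.card U := by
        have : Nat.card U = (U : Set V).toFinset.card := by
          rw [Set.toFinset_card, ← Nat.card_eq_fintype_card]; rfl
        rw [this]
        exact Finset.card_le_card fun x hx => by simpa using (Finset.mem_filter.1 hx).2
      have h' : ((Xf.filter (· ∈ U)).card : ℝ) ≤ Yf.card := by
        rw [hYcard, hκdef]; exact_mod_cast h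
      exact_mod_cast h'
    · intro x hx hxZ
      have hxU : x ∉ U := fun h => hxZ (Finset.mem_filter.2 ⟨hx, h⟩)
      refine Nat.cast_le.2 ((hs1 x hxU).trans (Set.ncard_le_card_of_subset ?_))
      rintro x' ⟨⟨f, hf, rfl⟩, hx'⟩
      rw [Finset.mem_filter]
      refine ⟨(hmem _).2 (hX1 x ((hmem x).1 hx) f hf), fun φ hφ => ?_⟩
      rw [Module.Dual.eval_apply, ← neg_sub, map_neg, (Submodule.mem_dualAnnihilator φ).1 hφ _ hx',
        neg_zero]
    · refine hcast (h1 x₀ (hXA x₀ hx₀)) (Set.ncard_le_card_of_subset ?_)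
      rintro x' ⟨c, hc, f, hf, rfl⟩
      exact (hmem _).2 (hX2 _ (hX1 x₀ hx₀ f hf) c hc)
  -- lower bound for dual orbits
  set O : Module.Dual F V → Finset (Module.Dual F V) := fun φ =>
    {φ' : Module.Dual F V | ∃ c : F, c ≠ 0 ∧ ∃ f ∈ K, φ' = c • (φ ∘ₗ f)}.toFinset with hO
  have hOmem : ∀ φ φ', φ' ∈ O φ ↔ ∃ c : F, c ≠ 0 ∧ ∃ f ∈ K, φ' = c • (φ ∘ₗ f) :=
    fun φ φ' => Set.mem_toFinset
  have hOinv : ∀ φ, ∀ φ' ∈ O φ, ∀ f ∈ K, ∀ c : F, c ≠ 0 → c • (φ' ∘ₗ f) ∈ O φ := by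
    intro φ φ' h f hf c hc
    obtain ⟨d, hd, g, hg, rfl⟩ := (hOmem _ _).1 h
    refine (hOmem _ _).2 ⟨c * d, mul_ne_zero hc hd, g ∘ₗ f, hmul g hg f hf, ?_⟩
    ext v
    simp [mul_assoc]
  obtain ⟨α, hα⟩ : ∃ α : ℝ, α = Nat.card A := ⟨_, rfl⟩
  set Uf : Finset V := (U : Set V).toFinset with hUf
  set Af : Finset V := (A : Set V).toFinset with hAf
  have hUf' : ∀ y, y ∈ Uf ↔ y ∈ U := fun y => Set.mem_toFinset
  have hAf' : ∀ y, y ∈ Af ↔ y ∈ A := fun y => Set.mem_toFinset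
  have hUcard : (Uf.card : ℝ) = κ := by
    rw [hκdef, hUf, Set.toFinset_card, ← Nat.card_eq_fintype_card]; rfl
  have hAcard : (Af.card : ℝ) = α := by
    rw [hα, hAf, Set.toFinset_card, ← Nat.card_eq_fintype_card]; rfl
  have hstep1 : ∀ φ, φ ≠ 0 → κ * Q ≤ 2 * (q - 1) * (α * (O φ).card) := by
    intro φ hφ
    have hOcard : (Q - 1) / (q - 1) ≤ ((O φ).card : ℝ) := by
      rw [hO, ← Set.ncard_eq_toFinset_card']
      exact hcast (h2 φ hφ) le_rfl
    have := card_lower_bound ψ hψ (LinearMap.id : Module.Dual F V →ₗ[F] Module.Dual F V) hB2 U Uf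
      hUf' (O φ)
      ((O φ).filter (· ∈ W.dualAnnihilator)) Af (fun a ha => (hUf' a).2 (hA ((hAf' a).1 ha)))
      ⟨0, (hAf' 0).2 A.zero_mem⟩ hq1' hq1' (by rwa [hUcard])
      (by rw [← Nat.card_eq_fintype_card, hV, hUcard]) ?_ hsR (Finset.filter_subset _ _) ?_ ?_
      hOcard
    · rwa [hUcard, hAcard] at this
    · intro v hv
      rw [hAf'] at hv
      refine ⟨{v' | ∃ c : F, c ≠ 0 ∧ ∃ f ∈ K, v' = c • f v}.toFinset, ?_, ?_⟩
      · rw [← Set.ncard_eq_toFinset_card']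
        exact hcast (h1 v hv) le_rfl
      · intro v' hv'
        rw [Set.mem_toFinset] at hv'
        obtain ⟨c, hc, f, hf, rfl⟩ := hv'
        rw [pairingFourier_id_smul_apply ψ _ f (hinj f hf) c hc]
        exact fun φ' h => hOinv φ φ' h f hf c hc
    · have h : ((O φ).filter (· ∈ W.dualAnnihilator)).card ≤ Yf.card :=
        Finset.card_le_card fun x hx => (hYf' x).2 (Finset.mem_filter.1 hx).2
      have h' : (((O φ).filter (· ∈ W.dualAnnihilator)).card : ℝ) ≤ κ := by
        rw [← hYcard]; exact_mod_cast h
      rw [← hUcard] at h'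
      exact_mod_cast h'
    · intro φ₁ hφ₁ hφZ
      have hφW : φ₁ ∉ W.dualAnnihilator := fun h => hφZ (Finset.mem_filter.2 ⟨hφ₁, h⟩)
      refine Nat.cast_le.2 ((hs2 φ₁ hφW).trans (Set.ncard_le_card_of_subset ?_))
      rintro φ' ⟨⟨f, hf, rfl⟩, hφ'⟩
      rw [Finset.mem_filter]
      refine ⟨by simpa using hOinv φ φ₁ hφ₁ f hf 1 one_ne_zero, fun u hu => ?_⟩
      rw [LinearMap.id_apply, ← neg_sub, LinearMap.neg_apply,
        (Submodule.mem_dualAnnihilator _).1 hφ' _ hu, neg_zero]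
  -- conclusion
  set N := ((Xf ×ˢ Xf).filter (fun p => ∀ φ ∈ W.dualAnnihilator, φ (p.1 - p.2) = 0)).card with hN
  set T : Module.Dual F V → ℝ := fun φ => ‖pairingFourier ψ (Module.Dual.eval F V) Xf φ‖ ^ 2 with hT
  have hx0 : (0 : ℝ) < Xf.card := by
    exact_mod_cast Finset.card_pos.2 ⟨x₀, (hmem _).2 hx₀⟩
  have hq1 : 0 < q - 1 := by linarith
  have hplan : κ * N = ∑ φ ∈ Yf, T φ := by
    rw [← hYcard]
    convert (sum_norm_sq_pairingFourier ψ hψ (Module.Dual.eval F V) W.dualAnnihilator Yf hYf'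
      Xf).symm using 5
    rfl
  have hplan' : ∑ φ, T φ = κ * Q * Xf.card := by
    rw [← hD, Nat.card_eq_fintype_card]
    exact sum_norm_sq_pairingFourier_univ ψ hψ (Module.Dual.eval F V) hB1 Xf
  have hT0 : T 0 ≤ (Xf.card : ℝ) ^ 2 := by
    simp only [hT]
    gcongr
    exact norm_pairingFourier_le _ _ _ _
  have hTnn : ∀ φ, 0 ≤ T φ := fun φ => by positivity
  have h0Y : (0 : Module.Dual F V) ∈ Yf := (hYf' 0).2 (Submodule.zero_mem _)
  have hkey : κ * Q * ∑ φ ∈ Yf.erase 0, T φ ≤ κ * Q * (2 * (q - 1) ^ 2 * κ * Xf.card) := by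
    calc κ * Q * ∑ φ ∈ Yf.erase 0, T φ
        = ∑ φ ∈ Yf.erase 0, κ * Q * T φ := by rw [Finset.mul_sum]
      _ ≤ ∑ φ ∈ Yf.erase 0, 2 * (q - 1) * α * ((O φ).card * T φ) := by
          refine Finset.sum_le_sum fun φ hφ => ?_
          have := mul_le_mul_of_nonneg_right (hstep1 φ (Finset.mem_erase.1 hφ).1) (hTnn φ)
          linarith
      _ = 2 * (q - 1) * α * ∑ φ ∈ Yf.erase 0, ∑ φ' ∈ O φ, T φ' := by
          rw [Finset.mul_sum]
          refine Finset.sum_congr rfl fun φ _ => ?_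
          congr 1
          rw [← nsmul_eq_mul, ← Finset.sum_const]
          refine Finset.sum_congr rfl fun φ' hφ' => ?_
          obtain ⟨c, hc, f, hf, rfl⟩ := (hOmem _ _).1 hφ'
          simp only [hT, hspX φ c hc f hf]
      _ = 2 * (q - 1) * α * ∑ φ', ((Yf.erase 0).filter (fun φ => φ' ∈ O φ)).card * T φ' := by
          congr 1
          rw [Finset.sum_comm' (t' := Finset.univ)
            (s' := fun φ' => (Yf.erase 0).filter (fun φ => φ' ∈ O φ)) (by simp)]
          refine Finset.sum_congr rfl fun φ' _ => ?_
          rw [Finset.sum_const, nsmul_eq_mul]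
      _ = 2 * (q - 1) * ∑ φ', (((Yf.erase 0).filter (fun φ => φ' ∈ O φ)).card * α) * T φ' := by
          rw [mul_assoc, Finset.mul_sum]
          congr 1
          exact Finset.sum_congr rfl fun φ' _ => by ring
      _ ≤ 2 * (q - 1) * ∑ φ', ((q - 1) * κ) * T φ' := by
          refine mul_le_mul_of_nonneg_left (Finset.sum_le_sum fun φ' _ => ?_) (by linarith)
          refine mul_le_mul_of_nonneg_right ?_ (hTnn φ')
          have := card_dualAnnihilator_restrict_le hUW hA
            ((Yf.erase 0).filter (fun φ => φ' ∈ O φ)) φ' ?_ ?_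
          · have h' : ((((Yf.erase 0).filter (fun φ => φ' ∈ O φ)).card * Nat.card A : ℕ) : ℝ) ≤
              (((Nat.card F - 1) * Nat.card U : ℕ) : ℝ) := by exact_mod_cast this
            rw [Nat.cast_mul, Nat.cast_mul, Nat.cast_sub hF1.le, ← hκdef, ← hqdef, ← hα,
              Nat.cast_one] at h'
            exact h'
          · intro φ hφ
            exact (hYf' φ).1 (Finset.mem_erase.1 (Finset.mem_filter.1 hφ).1).2
          · intro φ hφ
            obtain ⟨c, hc, f, hf, rfl⟩ := (hOmem _ _).1 (Finset.mem_filter.1 hφ).2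
            exact ⟨c, hc, fun a ha => by simp [hfix f hf a ha]⟩
      _ = _ := by
          rw [← Finset.mul_sum, hplan']
          ring
  have hkey' := le_of_mul_le_mul_left hkey (by positivity)
  refine spectral_contradiction (N := N) hq hκ hQ hx0 hstep2 ?_ ?_
  · have := card_sq_le_card_pairs hUW Xf (fun x hx => hXW x ((hmem x).1 hx))
    have h' : ((Xf.card ^ 2 : ℕ) : ℝ) ≤ (((Nat.card U - 1) * N : ℕ) : ℝ) := by
      exact_mod_cast this
    have hU1 : 1 ≤ Nat.card U := Nat.card_pos
    rw [Nat.cast_mul, Nat.cast_sub hU1, ← hκdef] at h'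
    simpa using h'
  · rw [hplan, ← Finset.add_sum_erase _ _ h0Y]
    linarith

end Spectral

section Block

variable {F U E : Type*} [Field F] [AddCommGroup U] [Module F U] [Field E] [Algebra F E]

/-- The linear automorphism of `U × E` that is the identity on `U` and multiplication by `γ` on
`E`. -/
def mulBlock (F U : Type*) {E : Type*} [Field F] [AddCommGroup U] [Module F U] [Field E]
    [Algebra F E] (γ : Eˣ) : (U × E) ≃ₗ[F] (U × E) where
  toFun v := (v.1, γ * v.2)
  invFun v := (v.1, (γ⁻¹ : Eˣ) * v.2)
  map_add' v w := by ext <;> simp [mul_add]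
  map_smul' c v := by ext <;> simp
  left_inv v := by ext <;> simp
  right_inv v := by ext <;> simp

@[simp] theorem mulBlock_apply (γ : Eˣ) (v : U × E) :
    mulBlock F U γ v = (v.1, (γ : E) * v.2) := rfl

/-- An irreducible group of automorphisms of `U × E` containing many multiplications on the second
factor, which is assumed to be large, and, up to scalars, all of them if we allow for an action on
`U` that fixes `U₁`. -/
structure IsBlockGroup (U₁ : Submodule F U) (H : Subgroup ((U × E) ≃ₗ[F] (U × E)))
    (Γ : Set Eˣ) : Prop where
  mem : ∀ γ ∈ Γ, mulBlock F U γ ∈ H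
  card : Nat.card E - 1 ≤ Γ.ncard * (Nat.card F - 1)
  twist : ∀ z : E, z ≠ 0 → ∃ h ∈ H, (∀ u ∈ U₁, h (u, 0) = (u, 0)) ∧
    ∃ a : F, a ≠ 0 ∧ ∀ w : E, h (0, w) = (0, (a • z) * w)
  irr : ∀ M : Submodule F (U × E), (∀ h ∈ H, ∀ v ∈ M, h v ∈ M) → M = ⊥ ∨ M = ⊤
  dim : Module.finrank F U + 4 ≤ Module.finrank F E

/-- The intersection of the translates of `U × 0` that contain `A`. -/
def capS (H : Subgroup ((U × E) ≃ₗ[F] (U × E))) (A : Submodule F (U × E)) :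
    Submodule F (U × E) where
  carrier := {v | ∀ h ∈ H, (∀ a ∈ A, (h.symm a).2 = 0) → (h.symm v).2 = 0}
  add_mem' hv hw h hh hA := by simp [hv h hh hA, hw h hh hA]
  zero_mem' h _ _ := by simp
  smul_mem' c v hv h hh hA := by simp [hv h hh hA]

/-- The span of the translates `h (0 × E)` such that `h (U × 0)` contains `A`. -/
def spanT (H : Subgroup ((U × E) ≃ₗ[F] (U × E))) (A : Submodule F (U × E)) :
    Submodule F (U × E) :=
  Submodule.span F {v | ∃ h ∈ H, (∀ a ∈ A, (h.symm a).2 = 0) ∧ ∃ w : E, v = h (0, w)}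

theorem mem_capS {H : Subgroup ((U × E) ≃ₗ[F] (U × E))} {A : Submodule F (U × E)} {v : U × E} :
    v ∈ capS H A ↔ ∀ h ∈ H, (∀ a ∈ A, (h.symm a).2 = 0) → (h.symm v).2 = 0 := Iff.rfl

theorem le_capS (H : Subgroup ((U × E) ≃ₗ[F] (U × E))) (A : Submodule F (U × E)) :
    A ≤ capS H A := fun _ ha _ _ hA => hA _ ha

theorem mem_spanT {H : Subgroup ((U × E) ≃ₗ[F] (U × E))} {A : Submodule F (U × E)}
    {h : (U × E) ≃ₗ[F] (U × E)} (hh : h ∈ H) (hA : ∀ a ∈ A, (h.symm a).2 = 0) (w : E) :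
    h (0, w) ∈ spanT H A := Submodule.subset_span ⟨h, hh, hA, w, rfl⟩

theorem spanT_le {H : Subgroup ((U × E) ≃ₗ[F] (U × E))} {A M : Submodule F (U × E)}
    (hM : ∀ h ∈ H, (∀ a ∈ A, (h.symm a).2 = 0) → ∀ w : E, h (0, w) ∈ M) : spanT H A ≤ M := by
  refine Submodule.span_le.2 ?_
  rintro _ ⟨h, hh, hA, w, rfl⟩
  exact hM h hh hA w

theorem map_mem_spanT {H : Subgroup ((U × E) ≃ₗ[F] (U × E))} {A : Submodule F (U × E)}
    {g : (U × E) ≃ₗ[F] (U × E)} (hg : g ∈ H) (B : Submodule F (U × E))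
    (hgB : ∀ b ∈ B, g.symm b ∈ A) {v : U × E} (hv : v ∈ spanT H A) : g v ∈ spanT H B := by
  have : spanT H A ≤ (spanT H B).comap (g : (U × E) →ₗ[F] (U × E)) := by
    refine spanT_le fun h hh hA w => ?_
    exact mem_spanT (h := g * h) (H.mul_mem hg hh) (fun b hb => hA _ (hgB b hb)) w
  exact this hv

namespace IsBlockGroup

variable {U₁ : Submodule F U} {H : Subgroup ((U × E) ≃ₗ[F] (U × E))} {Γ : Set Eˣ}

theorem conj_mem (hG : IsBlockGroup U₁ H Γ) {h : (U × E) ≃ₗ[F] (U × E)} (hh : h ∈ H) {γ : Eˣ}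
    (hγ : γ ∈ Γ) : h * mulBlock F U γ * h⁻¹ ∈ H :=
  H.mul_mem (H.mul_mem hh (hG.mem γ hγ)) (H.inv_mem hh)

theorem conj_apply (h : (U × E) ≃ₗ[F] (U × E)) (γ : Eˣ) (v : U × E) :
    (h * mulBlock F U γ * h⁻¹) v = h ((h.symm v).1, (γ : E) * (h.symm v).2) := rfl

theorem conj_apply_of_snd_eq_zero (h : (U × E) ≃ₗ[F] (U × E)) (γ : Eˣ) {v : U × E}
    (hv : (h.symm v).2 = 0) : (h * mulBlock F U γ * h⁻¹) v = v := by
  rw [conj_apply, hv, mul_zero, ← hv]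
  exact h.apply_symm_apply v

/-- The stabilizer of `A ≤ U₁ × 0` is projectively transitive on the vectors of `spanT H A` outside
`A`, if `A` is an intersection of translates of `U × 0`. -/
theorem exists_smul_eq [Finite F] [Finite U] [Finite E] (hG : IsBlockGroup U₁ H Γ)
    {A : Submodule F (U × E)} (hA : ∀ a ∈ A, a.2 = 0) (hA₁ : ∀ a ∈ A, a.1 ∈ U₁)
    (hS : capS H A ≤ A) {v v' : U × E}
    (hv : v ∈ spanT H A) (hvA : v ∉ A) (hv' : v' ∈ spanT H A) (hvA' : v' ∉ A) :
    ∃ h ∈ H, (∀ a ∈ A, h a = a) ∧ ∃ c : F, c ≠ 0 ∧ h v = c • v' := by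
  classical
  have hfinT : Finite (spanT H A) := Subtype.finite
  set T := spanT H A with hT
  have hWT : ∀ w : E, ((0, w) : U × E) ∈ T := fun w =>
    mem_spanT (h := 1) H.one_mem hA w
  set U' : Submodule F T := (LinearMap.ker (LinearMap.snd F U E)).comap T.subtype with hU'
  set W' : Submodule F T := (LinearMap.ker (LinearMap.fst F U E)).comap T.subtype with hW'
  set A' : Submodule F T := A.comap T.subtype with hA'
  have mU : ∀ t : T, t ∈ U' ↔ (t : U × E).2 = 0 := fun t => Iff.rfl
  have mW : ∀ t : T, t ∈ W' ↔ (t : U × E).1 = 0 := fun t => Iff.rfl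
  have mA : ∀ t : T, t ∈ A' ↔ (t : U × E) ∈ A := fun t => Iff.rfl
  have hcompl : IsCompl U' W' := by
    constructor
    · rw [Submodule.disjoint_def]
      intro t h1 h2
      exact Subtype.ext (Prod.ext h2 h1)
    · rw [codisjoint_iff, eq_top_iff]
      rintro t -
      have hw : ((0, (t : U × E).2) : U × E) ∈ T := hWT _
      refine Submodule.mem_sup.2 ⟨t - ⟨_, hw⟩, ?_, ⟨_, hw⟩, ?_, by simp⟩
      · rw [mU]; simp
      · rw [mW]
  set K : Set (T →ₗ[F] T) := {f | ∃ g ∈ H, (∀ a ∈ A, g a = a) ∧ ∀ t, (f t : U × E) = g t} with hK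
  have hrestrict : ∀ g ∈ H, (∀ a ∈ A, g a = a) → ∃ f ∈ K, ∀ t, (f t : U × E) = g t := by
    intro g hg hgA
    have hgT : ∀ t ∈ T, (g : (U × E) →ₗ[F] (U × E)) t ∈ T := fun t ht =>
      map_mem_spanT hg A (fun b hb => by
        have : g.symm b = b := by rw [LinearEquiv.symm_apply_eq, hgA b hb]
        rwa [this]) ht
    exact ⟨LinearMap.restrict _ hgT, ⟨g, hg, hgA, fun t => rfl⟩, fun t => rfl⟩
  have hconj : ∀ h ∈ H, (∀ a ∈ A, (h.symm a).2 = 0) → ∀ γ ∈ Γ, ∃ f ∈ K, ∀ t : T,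
      (f t : U × E) = h ((h.symm t).1, (γ : E) * (h.symm t).2) := by
    intro h hh hhA γ hγ
    exact hrestrict _ (hG.conj_mem hh hγ) (fun a ha => conj_apply_of_snd_eq_zero h γ (hhA a ha))
  have hblock : ∀ γ ∈ Γ, ∃ f ∈ K, ∀ t : T, (f t : U × E) =
      ((t : U × E).1, (γ : E) * (t : U × E).2) :=
    hconj 1 H.one_mem hA
  have hcardW : Nat.card W' = Nat.card E := by
    refine Nat.card_congr ⟨fun t => (t : T).1.2, fun w => ⟨⟨(0, w), hWT w⟩, rfl⟩, ?_, ?_⟩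
    · rintro ⟨⟨⟨u, w⟩, ht⟩, h⟩
      have : u = 0 := h
      subst this; rfl
    · intro w; rfl
  have hcardU : Nat.card U' ≤ Nat.card U := by
    refine Nat.card_le_card_of_injective (fun t : U' => (t : T).1.1) ?_
    rintro ⟨⟨⟨u, w⟩, ht⟩, h⟩ ⟨⟨⟨u', w'⟩, ht'⟩, h'⟩ he
    have h1 : w = 0 := h
    have h2 : w' = 0 := h'
    have h3 : u = u' := he
    subst h1 h2 h3; rfl
  have hS0 : Nat.card W' - 1 ≤ Γ.ncard * (Nat.card F - 1) := hcardW ▸ hG.card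
  have hmain := spectral_lemma hcompl (A := A') (fun t ht => hA _ ht) K
    ?_ ?_ ?_ ?_ Γ.ncard hS0 ?_ ?_ ?_ ?_
  · -- orbits reach `0 × E`
    have horb : ∀ v (hv : v ∈ T), v ∉ A → ∃ h ∈ H, (∀ a ∈ A, h a = a) ∧ ∃ c : F, c ≠ 0 ∧
        (c • h v).1 = 0 := by
      intro v hv hvA
      by_contra! hcon
      have := hmain {t | ∃ g ∈ H, (∀ a ∈ A, g a = a) ∧ ∃ c : F, c ≠ 0 ∧ (t : U × E) = c • g v}
        ?_ ?_ ?_ ?_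
      · rw [Set.eq_empty_iff_forall_notMem] at this
        exact this ⟨v, hv⟩ ⟨1, H.one_mem, fun _ _ => rfl, 1, one_ne_zero, by simp⟩
      · rintro t ⟨g, hg, hgA, c, hc, ht⟩ f ⟨g', hg', hgA', hf⟩
        refine ⟨g' * g, H.mul_mem hg' hg, fun a ha => ?_, c, hc, ?_⟩
        · rw [LinearEquiv.mul_apply, hgA a ha, hgA' a ha]
        · rw [hf, ht, map_smul]; rfl
      · rintro t ⟨g, hg, hgA, c, hc, ht⟩ d hd
        refine ⟨g, hg, hgA, d * c, mul_ne_zero hd hc, ?_⟩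
        rw [Submodule.coe_smul, ht, mul_smul]
      · rintro t ⟨g, hg, hgA, c, hc, ht⟩ h
        rw [mW, ht] at h
        exact hcon g hg hgA c hc h
      · rintro t ⟨g, hg, hgA, c, hc, ht⟩ h
        rw [mA, ht, A.smul_mem_iff hc] at h
        have h' : g v = v := by
          have := hgA _ h
          exact g.injective this
        rw [h'] at h
        exact hvA h
    have hkey : ∀ v (hv : v ∈ T), v ∉ A → ∃ h ∈ H, (∀ a ∈ A, h a = a) ∧ ∃ c : F, c ≠ 0 ∧
        h v = c • ((0, 1) : U × E) := by
      intro v hv hvA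
      obtain ⟨h, hh, hhA, c, hc, h0⟩ := horb v hv hvA
      have h0' : (h v).1 = 0 := by simpa [hc] using h0
      have hz : (h v).2 ≠ 0 := by
        intro hz
        have : h v = 0 := Prod.ext h0' hz
        rw [LinearEquiv.map_eq_zero_iff] at this
        exact hvA (this ▸ A.zero_mem)
      obtain ⟨g, hg, hgU, a, ha, hgE⟩ := hG.twist _ (inv_ne_zero hz)
      refine ⟨g * h, H.mul_mem hg hh, fun b hb => ?_, a, ha, ?_⟩
      · have hb' : b = (b.1, 0) := Prod.ext rfl (hA b hb)
        rw [LinearEquiv.mul_apply, hhA b hb, hb', hgU _ (hA₁ b hb)]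
      · have hhv : h v = (0, (h v).2) := Prod.ext h0' rfl
        rw [LinearEquiv.mul_apply, hhv, hgE]
        refine Prod.ext (by simp) ?_
        simp only [Prod.smul_snd, smul_mul_assoc, inv_mul_cancel₀ hz]
    obtain ⟨h, hh, hhA, c, hc, e1⟩ := hkey v hv hvA
    obtain ⟨h', hh', hhA', c', hc', e2⟩ := hkey v' hv' hvA'
    refine ⟨h'⁻¹ * h, H.mul_mem (H.inv_mem hh') hh, fun a ha => ?_, c / c', div_ne_zero hc hc', ?_⟩
    · rw [LinearEquiv.mul_apply, hhA a ha]
      exact (LinearEquiv.symm_apply_eq h').2 (hhA' a ha).symm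
    · rw [LinearEquiv.mul_apply, e1]
      refine (LinearEquiv.symm_apply_eq h').2 ?_
      rw [map_smul, e2, smul_smul, div_mul_cancel₀ _ hc']
  · rintro f ⟨g, hg, hgA, hf⟩ f' ⟨g', hg', hgA', hf'⟩
    refine ⟨g * g', H.mul_mem hg hg', fun a ha => ?_, fun t => ?_⟩
    · rw [LinearEquiv.mul_apply, hgA' a ha, hgA a ha]
    · rw [LinearMap.comp_apply, hf, hf']; rfl
  · rintro f ⟨g, hg, hgA, hf⟩ t t' h
    have : g t = g t' := by rw [← hf, ← hf, h]
    exact Subtype.ext (g.injective this)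
  · rintro f ⟨g, hg, hgA, hf⟩ t ht
    exact Subtype.ext (by rw [hf]; exact hgA _ ht)
  · rw [hcardW]
    refine (Nat.mul_le_mul_left _ hcardU).trans ?_
    rw [Module.natCard_eq_pow_finrank (K := F) (V := U),
      Module.natCard_eq_pow_finrank (K := F) (V := E), ← pow_add]
    exact Nat.pow_le_pow_right Nat.card_pos (by have := hG.dim; omega)
  · intro t ht
    have : (t : U × E) ∉ capS H A := fun h => ht (hS h)
    rw [mem_capS] at this
    push Not at this
    obtain ⟨h, hh, hhA, hne⟩ := this
    refine Nat.le_trans hS0 (Nat.mul_le_mul_right _ ?_)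
    have hex : ∀ γ : Eˣ, γ ∈ Γ → ∃ t' : T, (∃ c : F, c ≠ 0 ∧ ∃ f ∈ K, t' = c • f t) ∧
        (h.symm t').2 = γ * (h.symm t).2 := by
      intro γ hγ
      obtain ⟨f, hf, hft⟩ := hconj h hh hhA γ hγ
      exact ⟨f t, ⟨1, one_ne_zero, f, hf, (one_smul _ _).symm⟩, by simp [hft]⟩
    choose! φ hφ1 hφ2 using hex
    refine Set.ncard_le_ncard_of_injOn φ (fun z hz => hφ1 z hz) ?_ (Set.toFinite _)
    intro z hz z' hz' he
    have := hφ2 z hz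
    rw [he, hφ2 z' hz'] at this
    exact (Units.ext (mul_right_cancel₀ hne this)).symm
  · intro φ hφ
    have : ∃ h ∈ H, ∃ hhA : ∀ a ∈ A, (h.symm a).2 = 0, ∃ w : E, ∃ hw : h (0, w) ∈ T,
        φ ⟨h (0, w), hw⟩ ≠ 0 := by
      by_contra! hcon
      apply hφ
      have hle : T ≤ (LinearMap.ker φ).map T.subtype := by
        refine spanT_le fun h hh hhA w => ?_
        have hw := mem_spanT hh hhA w
        exact ⟨⟨_, hw⟩, hcon h hh hhA w hw, rfl⟩
      ext t
      obtain ⟨t', ht', he⟩ := hle t.2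
      have : t' = t := Subtype.ext he
      rw [this] at ht'
      exact ht'
    obtain ⟨h, hh, hhA, w, hw, hne⟩ := this
    refine Nat.le_trans hS0 (Nat.mul_le_mul_right _ ?_)
    have hex : ∀ γ : Eˣ, γ ∈ Γ → ∃ φ' : Module.Dual F T,
        (∃ c : F, c ≠ 0 ∧ ∃ f ∈ K, φ' = c • (φ ∘ₗ f)) ∧
        ∀ y : E, φ' ⟨h (0, y), mem_spanT hh hhA y⟩ = φ ⟨h (0, γ * y), mem_spanT hh hhA _⟩ := by
      intro γ hγ
      obtain ⟨f, hf, hft⟩ := hconj h hh hhA γ hγ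
      refine ⟨φ ∘ₗ f, ⟨1, one_ne_zero, f, hf, (one_smul _ _).symm⟩, fun y => ?_⟩
      rw [LinearMap.comp_apply]
      congr 1
      refine Subtype.ext ?_
      rw [hft]
      simp
    choose! ψ hψ1 hψ2 using hex
    have hfinD : Finite (Module.Dual F T) := DFunLike.finite _
    refine Set.ncard_le_ncard_of_injOn ψ (fun z hz => hψ1 z hz) ?_ (Set.toFinite _)
    intro z hz z' hz' he
    by_contra hzz
    have hd : (z : E) - z' ≠ 0 := sub_ne_zero.2 (fun h => hzz (Units.ext h))
    apply hne
    have h1 := hψ2 z hz (w / (z - z'))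
    rw [he, hψ2 z' hz', ← sub_eq_zero, ← map_sub] at h1
    rw [← neg_eq_zero, ← map_neg, ← h1]
    congr 1
    refine Subtype.ext ?_
    simp only [Submodule.coe_neg, Submodule.coe_sub]
    rw [← map_sub, ← map_neg]
    congr 1
    refine Prod.ext (by simp) ?_
    simp only [Prod.snd_neg, Prod.snd_sub]
    field_simp
    ring
  · intro t ht
    rw [mU] at ht
    have hex : ∀ γ : Eˣ, γ ∈ Γ → ∃ t' : T, ((∃ f ∈ K, t' = f t) ∧ t' - t ∈ W') ∧
        (t' : U × E).2 = γ * (t : U × E).2 := by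
      intro γ hγ
      obtain ⟨f, hf, hft⟩ := hblock γ hγ
      refine ⟨f t, ⟨⟨f, hf, rfl⟩, ?_⟩, by rw [hft]⟩
      rw [mW, Submodule.coe_sub, hft]
      simp
    choose! φ hφ1 hφ2 using hex
    refine Set.ncard_le_ncard_of_injOn φ (fun z hz => hφ1 z hz) ?_ (Set.toFinite _)
    intro z hz z' hz' he
    have := hφ2 z hz
    rw [he, hφ2 z' hz'] at this
    exact (Units.ext (mul_right_cancel₀ ht this)).symm
  · intro φ hφ
    have : ∃ w : E, φ ⟨(0, w), hWT w⟩ ≠ 0 := by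
      by_contra! hcon
      apply hφ
      rw [Submodule.mem_dualAnnihilator]
      rintro ⟨⟨u, w⟩, ht⟩ h
      have : u = 0 := h
      subst this
      exact hcon w
    obtain ⟨w, hne⟩ := this
    have hex : ∀ γ : Eˣ, γ ∈ Γ → ∃ φ' : Module.Dual F T,
        ((∃ f ∈ K, φ' = φ ∘ₗ f) ∧ φ' - φ ∈ U'.dualAnnihilator) ∧
        ∀ y : E, φ' ⟨(0, y), hWT y⟩ = φ ⟨(0, γ * y), hWT _⟩ := by
      intro γ hγ
      obtain ⟨f, hf, hft⟩ := hblock γ hγ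
      refine ⟨φ ∘ₗ f, ⟨⟨f, hf, rfl⟩, ?_⟩, fun y => ?_⟩
      · rw [Submodule.mem_dualAnnihilator]
        intro t ht
        rw [mU] at ht
        rw [LinearMap.sub_apply, LinearMap.comp_apply, sub_eq_zero]
        congr 1
        refine Subtype.ext ?_
        rw [hft, ht, mul_zero, ← ht]
      · rw [LinearMap.comp_apply]
        congr 1
        exact Subtype.ext (hft _)
    choose! ψ hψ1 hψ2 using hex
    have hfinD : Finite (Module.Dual F T) := DFunLike.finite _
    refine Set.ncard_le_ncard_of_injOn ψ (fun z hz => hψ1 z hz) ?_ (Set.toFinite _)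
    intro z hz z' hz' he
    by_contra hzz
    have hd : (z : E) - z' ≠ 0 := sub_ne_zero.2 (fun h => hzz (Units.ext h))
    apply hne
    have h1 := hψ2 z hz (w / (z - z'))
    rw [he, hψ2 z' hz', ← sub_eq_zero, ← map_sub] at h1
    rw [← neg_eq_zero, ← map_neg, ← h1]
    congr 1
    refine Subtype.ext ?_
    simp only [Submodule.coe_neg, Submodule.coe_sub]
    refine Prod.ext (by simp) ?_
    simp only [Prod.snd_neg, Prod.snd_sub]
    field_simp
    ring

end IsBlockGroup

end Block

section ProjTrans

variable {F V : Type*} [Field F] [AddCommGroup V] [Module F V]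

/-- The pointwise stabilizer of `B` in `H` is projectively transitive on the vectors outside `B`. -/
def ProjTransOn (H : Subgroup (V ≃ₗ[F] V)) (B : Submodule F V) : Prop :=
  ∀ v ∉ B, ∀ w ∉ B, ∃ h ∈ H, (∀ b ∈ B, h b = b) ∧ ∃ c : F, c ≠ 0 ∧ h v = c • w

/-- `ProjTransOn` for all subspaces of dimension `j`. -/
def ProjTrans (H : Subgroup (V ≃ₗ[F] V)) (j : ℕ) : Prop :=
  ∀ B : Submodule F V, Module.finrank F B = j → ProjTransOn H B

theorem Submodule.exists_le_finrank_eq [FiniteDimensional F V] (A : Submodule F V) {j : ℕ}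
    (hj : j ≤ Module.finrank F A) : ∃ B ≤ A, Module.finrank F B = j := by
  induction j with
  | zero => exact ⟨⊥, bot_le, finrank_bot F V⟩
  | succ j ih =>
    obtain ⟨B, hBA, hB⟩ := ih (by omega)
    obtain ⟨v, hvA, hvB⟩ := SetLike.exists_of_lt (lt_of_le_of_ne hBA (by rintro rfl; omega))
    refine ⟨B ⊔ Submodule.span F {v}, sup_le hBA (by simpa using hvA), ?_⟩
    rw [Submodule.finrank_sup_span_singleton hvB, hB]

theorem Submodule.exists_eq_sup_span_singleton [FiniteDimensional F V] {A : Submodule F V} {j : ℕ}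
    (hA : Module.finrank F A = j + 1) :
    ∃ B ≤ A, Module.finrank F B = j ∧ ∃ v ∉ B, A = B ⊔ Submodule.span F {v} := by
  obtain ⟨B, hBA, hB⟩ := A.exists_le_finrank_eq (j := j) (by omega)
  obtain ⟨v, hvA, hvB⟩ := SetLike.exists_of_lt (lt_of_le_of_ne hBA (by rintro rfl; omega))
  refine ⟨B, hBA, hB, v, hvB, (Submodule.eq_of_le_of_finrank_eq
    (sup_le hBA (by simpa using hvA)) ?_).symm⟩
  rw [Submodule.finrank_sup_span_singleton hvB, hB, hA]

theorem Submodule.sup_span_smul (B : Submodule F V) {c : F} (hc : c ≠ 0) (v : V) :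
    B ⊔ Submodule.span F {c • v} = B ⊔ Submodule.span F {v} := by
  rw [Submodule.span_singleton_smul_eq hc.isUnit]

theorem Submodule.map_sup_span_singleton (B : Submodule F V) (h : V ≃ₗ[F] V) (v : V) :
    (B ⊔ Submodule.span F {v}).map (h : V →ₗ[F] V) =
      B.map (h : V →ₗ[F] V) ⊔ Submodule.span F {h v} := by
  rw [Submodule.map_sup, Submodule.map_span, Set.image_singleton]; rfl

theorem Submodule.map_eq_self_of_fixed {B : Submodule F V} {h : V ≃ₗ[F] V}
    (hB : ∀ b ∈ B, h b = b) : B.map (h : V →ₗ[F] V) = B := by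
  ext x
  constructor
  · rintro ⟨b, hb, rfl⟩
    have : h b = b := hB b hb
    exact (this.symm ▸ hb : h b ∈ B)
  · intro hx
    exact ⟨x, hx, hB x hx⟩

theorem Submodule.map_mul_equiv (B : Submodule F V) (g h : V ≃ₗ[F] V) :
    B.map ((g * h : V ≃ₗ[F] V) : V →ₗ[F] V) =
      (B.map (h : V →ₗ[F] V)).map (g : V →ₗ[F] V) := by
  rw [← Submodule.map_comp]; rfl

theorem Submodule.mem_map_equiv' {B : Submodule F V} {h : V ≃ₗ[F] V} {v : V} :
    h v ∈ B.map (h : V →ₗ[F] V) ↔ v ∈ B := by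
  constructor
  · rintro ⟨b, hb, he⟩
    exact h.injective he ▸ hb
  · intro hv
    exact ⟨v, hv, rfl⟩

variable [FiniteDimensional F V] {H : Subgroup (V ≃ₗ[F] V)}

theorem ProjTrans.exists_map_eq {i : ℕ} (ht : ∀ j < i, ProjTrans H j) {A A' : Submodule F V}
    (hA : Module.finrank F A = i) (hA' : Module.finrank F A' = i) :
    ∃ h ∈ H, A.map (h : V →ₗ[F] V) = A' := by
  induction i generalizing A A' with
  | zero =>
    rw [Submodule.finrank_eq_zero] at hA hA'
    subst hA hA'
    exact ⟨1, H.one_mem, Submodule.map_bot _⟩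
  | succ i ih =>
    obtain ⟨B, -, hB, v, hv, rfl⟩ := Submodule.exists_eq_sup_span_singleton hA
    obtain ⟨B', -, hB', v', hv', rfl⟩ := Submodule.exists_eq_sup_span_singleton hA'
    obtain ⟨h, hh, rfl⟩ := ih (fun j hj => ht j (by omega)) hB hB'
    obtain ⟨g, hg, hgB, c, hc, hgv⟩ := ht i (by omega) _ hB' (h v)
      (fun hm => hv (Submodule.mem_map_equiv'.1 hm)) v' hv'
    refine ⟨g * h, H.mul_mem hg hh, ?_⟩
    rw [Submodule.map_mul_equiv, Submodule.map_sup_span_singleton,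
      Submodule.map_sup_span_singleton, Submodule.map_eq_self_of_fixed hgB, hgv,
      Submodule.sup_span_smul _ hc]

theorem ProjTrans.exists_map_eq_and {i : ℕ} (ht : ∀ j ≤ i, ProjTrans H j) {B B' : Submodule F V}
    (hB : Module.finrank F B = i) (hB' : Module.finrank F B' = i) {v v' : V} (hv : v ∉ B)
    (hv' : v' ∉ B') :
    ∃ h ∈ H, B.map (h : V →ₗ[F] V) = B' ∧ ∃ c : F, c ≠ 0 ∧ h v = c • v' := by
  obtain ⟨h, hh, rfl⟩ := ProjTrans.exists_map_eq (fun j hj => ht j hj.le) hB hB'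
  obtain ⟨g, hg, hgB, c, hc, hgv⟩ := ht i le_rfl _ hB' (h v)
      (fun hm => hv (Submodule.mem_map_equiv'.1 hm)) v' hv'
  refine ⟨g * h, H.mul_mem hg hh, ?_, c, hc, hgv⟩
  rw [Submodule.map_mul_equiv, Submodule.map_eq_self_of_fixed hgB]

/-- If `X \ B` is partitioned by the sets `Bl v \ B` with `Bl v` of dimension `d` containing `B`,
then `d - dim B` divides `dim X - dim B`. -/
theorem Submodule.dvd_finrank_sub_of_partition [Finite F] {B X : Submodule F V} (hBX : B ≤ X)
    (Bl : V → Submodule F V) {d : ℕ} (hmem : ∀ v ∈ X, v ∉ B → v ∈ Bl v)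
    (hB : ∀ v ∈ X, v ∉ B → B ≤ Bl v) (hX : ∀ v ∈ X, v ∉ B → Bl v ≤ X)
    (hd : ∀ v ∈ X, v ∉ B → Module.finrank F (Bl v) = d)
    (heq : ∀ v ∈ X, v ∉ B → ∀ v' ∈ Bl v, v' ∉ B → Bl v' = Bl v) :
    d - Module.finrank F B ∣ Module.finrank F X - Module.finrank F B := by
  classical
  have : Finite V := Module.finite_of_finite F
  let _ : Fintype V := Fintype.ofFinite V
  set b := Module.finrank F B with hb
  have hq : 2 ≤ Nat.card F := Finite.one_lt_card
  have hcard : ∀ Y : Submodule F V, B ≤ Y →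
      (Finset.univ.filter (fun v => v ∈ Y ∧ v ∉ B)).card =
        Nat.card F ^ b * (Nat.card F ^ (Module.finrank F Y - b) - 1) := by
    intro Y hY
    have h1 : (Finset.univ.filter (fun v => v ∈ Y ∧ v ∉ B)) =
        Finset.univ.filter (fun v => v ∈ Y) \ Finset.univ.filter (fun v => v ∈ B) := by
      ext v; simp
    rw [h1, Finset.card_sdiff_of_subset (fun v hv => by simp at hv ⊢; exact hY hv)]
    have h2 : ∀ Z : Submodule F V, (Finset.univ.filter (fun v => v ∈ Z)).card =
        Nat.card F ^ Module.finrank F Z := by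
      intro Z
      rw [← Module.natCard_eq_pow_finrank, Nat.card_eq_fintype_card, Fintype.card_subtype]
    rw [h2, h2, Nat.mul_sub, ← pow_add, mul_one, hb,
      Nat.add_sub_cancel' (Submodule.finrank_mono hY)]
  set S := Finset.univ.filter (fun v => v ∈ X ∧ v ∉ B) with hS
  have hsum := Finset.card_eq_sum_card_image Bl S
  have hfib : ∀ Z ∈ S.image Bl, (S.filter (fun v => Bl v = Z)).card =
      Nat.card F ^ b * (Nat.card F ^ (d - b) - 1) := by
    intro Z hZ
    obtain ⟨v, hv, rfl⟩ := Finset.mem_image.1 hZ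
    simp only [hS, Finset.mem_filter, Finset.mem_univ, true_and] at hv
    rw [← hd v hv.1 hv.2, ← hcard _ (hB v hv.1 hv.2)]
    congr 1
    ext y
    simp only [hS, Finset.mem_filter, Finset.mem_univ, true_and]
    constructor
    · rintro ⟨⟨h1, h2⟩, h3⟩
      exact ⟨h3 ▸ hmem y h1 h2, h2⟩
    · rintro ⟨h1, h2⟩
      exact ⟨⟨hX v hv.1 hv.2 h1, h2⟩, heq v hv.1 hv.2 y h1 h2⟩
  rw [Finset.sum_congr rfl hfib, Finset.sum_const, hcard X hBX, smul_eq_mul] at hsum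
  have hdvd : Nat.card F ^ (d - b) - 1 ∣ Nat.card F ^ (Module.finrank F X - b) - 1 := by
    refine ⟨(S.image Bl).card, ?_⟩
    have hpos : 0 < Nat.card F ^ b := by positivity
    refine Nat.eq_of_mul_eq_mul_left hpos ?_
    rw [hsum]; ring
  have hg := Nat.pow_sub_one_gcd_pow_sub_one (Nat.card F) (d - b) (Module.finrank F X - b)
  rw [Nat.gcd_eq_left hdvd] at hg
  have h3 : Nat.card F ^ (d - b) = Nat.card F ^ ((d - b).gcd (Module.finrank F X - b)) := by
    have h4 : 0 < Nat.card F ^ (d - b) := by positivity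
    have h5 : 0 < Nat.card F ^ ((d - b).gcd (Module.finrank F X - b)) := by positivity
    omega
  have h4 := Nat.pow_right_injective hq h3
  rw [h4]
  exact Nat.gcd_dvd_right _ _

end ProjTrans

section Block

variable {F U E : Type*} [Field F] [AddCommGroup U] [Module F U] [Field E] [Algebra F E]
  {U₁ : Submodule F U} {H : Subgroup ((U × E) ≃ₗ[F] (U × E))} {Γ : Set Eˣ}

theorem capS_mono {A A' : Submodule F (U × E)} (h : A ≤ A') : capS H A ≤ capS H A' :=
  fun _ hv g hg hA => hv g hg fun a ha => hA a (h ha)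

theorem capS_capS (A : Submodule F (U × E)) : capS H (capS H A) = capS H A :=
  le_antisymm (fun _ hv g hg hA => hv g hg fun _ ha => ha g hg hA) (le_capS _ _)

theorem snd_eq_zero_of_mem_capS {A : Submodule F (U × E)} (hA : ∀ a ∈ A, a.2 = 0) {v : U × E}
    (hv : v ∈ capS H A) : v.2 = 0 := hv 1 H.one_mem hA

theorem mem_capS_map {g : (U × E) ≃ₗ[F] (U × E)} (hg : g ∈ H) {A : Submodule F (U × E)}
    {v : U × E} (hv : v ∈ capS H A) :
    g v ∈ capS H (A.map (g : (U × E) →ₗ[F] (U × E))) := by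
  intro h hh hA
  have := hv (g⁻¹ * h) (H.mul_mem (H.inv_mem hg) hh) (fun a ha => by
    have := hA (g a) ⟨a, ha, rfl⟩
    exact this)
  exact this

theorem capS_map {g : (U × E) ≃ₗ[F] (U × E)} (hg : g ∈ H) (A : Submodule F (U × E)) :
    capS H (A.map (g : (U × E) →ₗ[F] (U × E))) =
      (capS H A).map (g : (U × E) →ₗ[F] (U × E)) := by
  apply le_antisymm
  · intro v hv
    have h1 := mem_capS_map (H.inv_mem hg) hv
    rw [← Submodule.map_mul_equiv, inv_mul_cancel] at h1
    have h2 : A.map ((1 : (U × E) ≃ₗ[F] (U × E)) : (U × E) →ₗ[F] (U × E)) = A :=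
      Submodule.map_eq_self_of_fixed fun _ _ => rfl
    rw [h2] at h1
    exact ⟨_, h1, g.apply_symm_apply v⟩
  · rintro _ ⟨v, hv, rfl⟩
    exact mem_capS_map hg hv

theorem mem_spanT_map {g : (U × E) ≃ₗ[F] (U × E)} (hg : g ∈ H) {A : Submodule F (U × E)}
    {v : U × E} (hv : v ∈ spanT H A) :
    g v ∈ spanT H (A.map (g : (U × E) →ₗ[F] (U × E))) := by
  refine map_mem_spanT hg _ ?_ hv
  rintro _ ⟨a, ha, rfl⟩
  have : g.symm (g a) = a := g.symm_apply_apply a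
  exact this.symm ▸ ha

/-- The subspace `U × 0`. -/
def fstSub (F U E : Type*) [Field F] [AddCommGroup U] [Module F U] [Field E] [Algebra F E] :
    Submodule F (U × E) := LinearMap.ker (LinearMap.snd F U E)

theorem mem_fstSub {v : U × E} : v ∈ fstSub F U E ↔ v.2 = 0 := Iff.rfl

theorem finrank_fstSub [FiniteDimensional F U] [FiniteDimensional F E] :
    Module.finrank F (fstSub F U E) = Module.finrank F U := by
  rw [fstSub, LinearMap.ker_snd]
  exact LinearMap.finrank_range_of_inj LinearMap.inl_injective

/-- The subspace `0 × E`. -/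
def sndSub (F U E : Type*) [Field F] [AddCommGroup U] [Module F U] [Field E] [Algebra F E] :
    Submodule F (U × E) := LinearMap.ker (LinearMap.fst F U E)

theorem finrank_sndSub [FiniteDimensional F U] [FiniteDimensional F E] :
    Module.finrank F (sndSub F U E) = Module.finrank F E := by
  rw [sndSub, LinearMap.ker_fst]
  exact LinearMap.finrank_range_of_inj LinearMap.inr_injective

/-- Some element of `H` fixes `P` pointwise and stabilizes the complement `M` of `P`, with strong
restrictions on its invariant subspaces. -/
structure IsSeparator (H : Subgroup ((U × E) ≃ₗ[F] (U × E))) (P M : Submodule F (U × E)) :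
    Prop where
  isCompl : IsCompl P M
  ne_bot : M ≠ ⊥
  coprime : (Module.finrank F M).Coprime (Module.finrank F E)
  le : Module.finrank F U ≤ Module.finrank F P
  exists_mem : ∃ z ∈ H, (∀ v ∈ P, z v = v) ∧ (∀ v ∈ M, z v ∈ M) ∧
    ∀ Z : Submodule F (U × E), (∀ v ∈ Z, z v ∈ Z) → Z ≤ P ∨ M ≤ Z

namespace IsBlockGroup

theorem capS_bot (hG : IsBlockGroup U₁ H Γ) : capS H ⊥ = ⊥ := by
  refine (hG.irr _ fun h hh v hv => ?_).resolve_right fun htop => ?_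
  · have := mem_capS_map hh hv
    rwa [Submodule.map_bot] at this
  · have : ((0, 1) : U × E) ∈ capS H ⊥ := htop ▸ Submodule.mem_top
    have := snd_eq_zero_of_mem_capS (by simp) this
    exact one_ne_zero this

theorem spanT_bot (hG : IsBlockGroup U₁ H Γ) : spanT H ⊥ = ⊤ := by
  refine (hG.irr _ fun h hh v hv => ?_).resolve_left fun hbot => ?_
  · have := mem_spanT_map hh hv
    rwa [Submodule.map_bot] at this
  · have : ((0, 1) : U × E) ∈ spanT H ⊥ := mem_spanT (h := 1) H.one_mem (by simp) 1
    rw [hbot, Submodule.mem_bot] at this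
    exact one_ne_zero (congrArg Prod.snd this)

variable [Finite F] [Finite U] [Finite E]

theorem capS_eq (hG : IsBlockGroup U₁ H Γ) {Fz Mz : Submodule F (U × E)}
    (hz : IsSeparator H Fz Mz) {i : ℕ}
    (hi : i < Module.finrank F U) (ht : ∀ j < i, ProjTrans H j) {A : Submodule F (U × E)}
    (hA : Module.finrank F A = i) : capS H A = A := by
  obtain _ | i := i
  · rw [Submodule.finrank_eq_zero] at hA
    rw [hA, hG.capS_bot]
  obtain ⟨d, hd⟩ : ∃ d, d = Module.finrank F (capS H A) := ⟨_, rfl⟩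
  have hdim : ∀ A' : Submodule F (U × E), Module.finrank F A' = i + 1 →
      Module.finrank F (capS H A') = d := by
    intro A' hA'
    obtain ⟨h, hh, rfl⟩ := ProjTrans.exists_map_eq ht hA hA'
    rw [capS_map hh, hd]
    exact LinearEquiv.finrank_map_eq h _
  have hnk : Module.finrank F (U × E) = Module.finrank F U + Module.finrank F E :=
    Module.finrank_prod
  have hEpos : 0 < Module.finrank F E := by have := hG.dim; omega
  obtain ⟨A₀, hA₀U, hA₀⟩ := (fstSub F U E).exists_le_finrank_eq (j := i + 1)
    (by rw [finrank_fstSub]; omega)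
  have hdk : d ≤ Module.finrank F U := by
    rw [← hdim A₀ hA₀, ← finrank_fstSub (F := F) (U := U) (E := E)]
    exact Submodule.finrank_mono fun v hv =>
      snd_eq_zero_of_mem_capS (H := H) (fun a ha => hA₀U ha) hv
  have hid : i + 1 ≤ d := by
    rw [← hA, hd]
    exact Submodule.finrank_mono (le_capS H A)
  -- blocks
  have hsup : ∀ (B : Submodule F (U × E)), Module.finrank F B = i → ∀ v ∉ B,
      Module.finrank F ↥(B ⊔ Submodule.span F {v}) = i + 1 := by
    intro B hB v hv
    rw [Submodule.finrank_sup_span_singleton hv, hB]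
  have hmemB : ∀ (B : Submodule F (U × E)) v, v ∈ capS H (B ⊔ Submodule.span F {v}) :=
    fun B v => le_capS _ _ (Submodule.mem_sup_right (Submodule.mem_span_singleton_self v))
  have hleB : ∀ (B : Submodule F (U × E)) v, B ≤ capS H (B ⊔ Submodule.span F {v}) :=
    fun B v => le_sup_left.trans (le_capS _ _)
  have heqB : ∀ (B : Submodule F (U × E)), Module.finrank F B = i → ∀ v ∉ B,
      ∀ v' ∈ capS H (B ⊔ Submodule.span F {v}), v' ∉ B →
        capS H (B ⊔ Submodule.span F {v'}) = capS H (B ⊔ Submodule.span F {v}) := by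
    intro B hB v hv v' hv' hvB'
    refine Submodule.eq_of_le_of_finrank_eq ?_ (by rw [hdim _ (hsup B hB v hv),
      hdim _ (hsup B hB v' hvB')])
    calc capS H (B ⊔ Submodule.span F {v'}) ≤ capS H (capS H (B ⊔ Submodule.span F {v})) :=
          capS_mono (sup_le (hleB B v) (by simpa using hv'))
      _ = _ := capS_capS _
  have hpart : ∀ (B X : Submodule F (U × E)), Module.finrank F B = i → B ≤ X →
      (∀ v ∈ X, v ∉ B → capS H (B ⊔ Submodule.span F {v}) ≤ X) →
      d - i ∣ Module.finrank F X - i := by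
    intro B X hB hBX hX
    have := Submodule.dvd_finrank_sub_of_partition hBX
      (fun v => capS H (B ⊔ Submodule.span F {v})) (d := d) (fun v _ _ => hmemB B v)
      (fun v _ _ => hleB B v) hX (fun v _ hv => hdim _ (hsup B hB v hv))
      (fun v _ hv v' hv' hvB' => heqB B hB v hv v' hv' hvB')
    rwa [hB] at this
  obtain ⟨B₀, hB₀U, hB₀⟩ := (fstSub F U E).exists_le_finrank_eq (j := i)
    (by rw [finrank_fstSub]; omega)
  have h1 : d - i ∣ Module.finrank F U + Module.finrank F E - i := by
    have := hpart B₀ ⊤ hB₀ le_top fun _ _ _ => le_top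
    rwa [finrank_top, hnk] at this
  have h2 : d - i ∣ Module.finrank F U - i := by
    have := hpart B₀ _ hB₀ hB₀U fun v hv _ w hw => by
      refine snd_eq_zero_of_mem_capS (H := H) (A := B₀ ⊔ Submodule.span F {v}) ?_ hw
      have : B₀ ⊔ Submodule.span F {v} ≤ fstSub F U E := sup_le hB₀U (by simpa using hv)
      exact fun a ha => this ha
    rwa [finrank_fstSub] at this
  have h3 : d - i ∣ Module.finrank F E := by
    have h4 := Nat.dvd_sub h1 h2
    have h5 : Module.finrank F U + Module.finrank F E - i - (Module.finrank F U - i) =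
        Module.finrank F E := by omega
    rwa [h5] at h4
  by_cases he : d - i = 1
  · exact (Submodule.eq_of_le_of_finrank_eq (le_capS H A) (by omega)).symm
  exfalso
  obtain ⟨hc, hM0, hcop, hkF, z, hzH, hzF, -, hinv⟩ := hz
  have hcard := Submodule.finrank_add_eq_of_isCompl hc
  obtain ⟨B, hBF, hB⟩ := Fz.exists_le_finrank_eq (j := i) (by omega)
  have hzinv : ∀ v ∈ Fz, ∀ w ∈ capS H (B ⊔ Submodule.span F {v}),
      z w ∈ capS H (B ⊔ Submodule.span F {v}) := by
    intro v hv w hw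
    have h6 := mem_capS_map hzH hw
    rwa [Submodule.map_eq_self_of_fixed fun b hb => hzF b
      ((sup_le hBF (by simpa using hv) : B ⊔ Submodule.span F {v} ≤ Fz) hb)] at h6
  by_cases hall : ∀ v ∈ Fz, v ∉ B → capS H (B ⊔ Submodule.span F {v}) ≤ Fz
  · have h6 := hpart B Fz hB hBF hall
    have h7 := hpart B ⊤ hB le_top fun _ _ _ => le_top
    rw [finrank_top] at h7
    have h8 := Nat.dvd_sub h7 h6
    have h9 : Module.finrank F (U × E) - i - (Module.finrank F Fz - i) = Module.finrank F Mz := by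
      omega
    rw [h9] at h8
    exact he (Nat.eq_one_of_dvd_coprimes hcop h8 h3)
  push Not at hall
  obtain ⟨v₀, hv₀F, hv₀B, hv₀⟩ := hall
  have hMZ : Mz ≤ capS H (B ⊔ Submodule.span F {v₀}) :=
    (hinv _ (hzinv v₀ hv₀F)).resolve_left hv₀
  have hZd := hdim _ (hsup B hB v₀ hv₀B)
  set Z₀ := capS H (B ⊔ Submodule.span F {v₀}) with hZ₀
  have hmod : i + 1 + Module.finrank F Mz ≤ d := by
    have h6 : Module.finrank F ↥(B ⊔ Submodule.span F {v₀}) + Module.finrank F Mz ≤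
        Module.finrank F Z₀ := by
      have h7 : Disjoint (B ⊔ Submodule.span F {v₀}) Mz :=
        hc.disjoint.mono_left (sup_le hBF (by simpa using hv₀F))
      have h8 := Submodule.finrank_sup_add_finrank_inf_eq (B ⊔ Submodule.span F {v₀}) Mz
      rw [h7.eq_bot, finrank_bot, add_zero] at h8
      rw [← h8]
      exact Submodule.finrank_mono (sup_le (le_capS _ _) hMZ)
    rw [hsup B hB v₀ hv₀B] at h6
    omega
  obtain ⟨m₀, hm₀, hm₀0⟩ := (Submodule.ne_bot_iff _).1 hM0
  have hm₀B : m₀ ∉ B := fun h => hm₀0 ((Submodule.disjoint_def.1 hc.disjoint) _ (hBF h) hm₀)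
  have hZeq := heqB B hB v₀ hv₀B m₀ (hMZ hm₀) hm₀B
  have hcover : ∀ v, v ∈ Fz ∨ v ∈ Z₀ := by
    intro v
    by_cases hvB : v ∈ B
    · exact Or.inl (hBF hvB)
    have hZ1 := hdim _ (hsup B hB v hvB)
    obtain ⟨v', hv', hvB'⟩ : ∃ v' ∈ capS H (B ⊔ Submodule.span F {v}) ⊓ Fz, v' ∉ B := by
      by_contra! hcon
      have h6 := Submodule.finrank_mono (show capS H (B ⊔ Submodule.span F {v}) ⊓ Fz ≤ B from hcon)
      have h7 := Submodule.finrank_sup_add_finrank_inf_eq (capS H (B ⊔ Submodule.span F {v})) Fz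
      have h8 := Submodule.finrank_le (capS H (B ⊔ Submodule.span F {v}) ⊔ Fz)
      omega
    have h9 := heqB B hB v hvB v' hv'.1 hvB'
    rcases hinv _ (hzinv v' hv'.2) with h | h
    · exact Or.inl (h (h9 ▸ hmemB B v))
    · right
      have h10 := heqB B hB v' hvB' m₀ (h hm₀) hm₀B
      rw [h9, hZeq] at h10
      rw [hZ₀, h10]
      exact hmemB B v
  have hFtop : Fz ≠ ⊤ := by
    rintro rfl
    have h6 := hc.disjoint.eq_bot
    rw [top_inf_eq] at h6
    exact hM0 h6
  have hZtop : Z₀ ≠ ⊤ := by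
    intro h
    rw [h, finrank_top] at hZd
    omega
  obtain ⟨a, -, ha⟩ := SetLike.exists_of_lt hFtop.lt_top
  obtain ⟨b, -, hb⟩ := SetLike.exists_of_lt hZtop.lt_top
  have ha' := (hcover a).resolve_left ha
  have hb' := (hcover b).resolve_right hb
  rcases hcover (a + b) with h | h
  · exact ha ((Submodule.add_mem_iff_left _ hb').1 h)
  · exact hb ((Submodule.add_mem_iff_right _ ha').1 h)

end IsBlockGroup

end Block

section Dual

variable {F V : Type*} [Field F] [AddCommGroup V] [Module F V] [Finite F] [Finite V]

/-- Brauer's permutation lemma: transitivity on the vectors outside `B` implies transitivity on the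
functionals vanishing on `B`. -/
theorem ProjTransOn.exists_comp_eq {H : Subgroup (V ≃ₗ[F] V)} {B : Submodule F V}
    (hB : ProjTransOn H B) {φ φ' : Module.Dual F V} (hφ : φ ≠ 0) (hφB : ∀ b ∈ B, φ b = 0)
    (hφ' : φ' ≠ 0) (hφB' : ∀ b ∈ B, φ' b = 0) :
    ∃ h ∈ H, (∀ b ∈ B, h b = b) ∧ ∃ c : F, c ≠ 0 ∧ φ' = c • (φ ∘ₗ (h : V →ₗ[F] V)) := by
  classical
  let _ : Fintype V := Fintype.ofFinite V
  have : Finite (Module.Dual F V) := DFunLike.finite _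
  let _ : Fintype (Module.Dual F V) := Fintype.ofFinite _
  obtain ⟨ψ, hψ⟩ : ∃ ψ : AddChar F ℂ, ψ ≠ 1 := by
    obtain ⟨ψ, hψ⟩ := AddChar.exists_apply_ne_zero.2 (one_ne_zero : (1 : F) ≠ 0)
    exact ⟨ψ, AddChar.ne_one_iff.2 ⟨1, hψ⟩⟩
  let p : Module.Dual F V →ₗ[F] V →ₗ[F] F := LinearMap.id
  set O : Finset (Module.Dual F V) := Finset.univ.filter fun φ₁ => ∃ h ∈ H, (∀ b ∈ B, h b = b) ∧
    ∃ c : F, c ≠ 0 ∧ φ₁ = c • (φ ∘ₗ (h : V →ₗ[F] V)) with hO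
  have mO : ∀ φ₁, φ₁ ∈ O ↔ ∃ h ∈ H, (∀ b ∈ B, h b = b) ∧
    ∃ c : F, c ≠ 0 ∧ φ₁ = c • (φ ∘ₗ (h : V →ₗ[F] V)) := fun φ₁ => by simp [hO]
  have hφO : φ ∈ O := (mO φ).2 ⟨1, H.one_mem, fun _ _ => rfl, 1, one_ne_zero, by ext; simp⟩
  have hinv : ∀ g ∈ H, (∀ b ∈ B, g b = b) → ∀ c : F, c ≠ 0 → ∀ v,
      pairingFourier ψ p O (c • g v) = pairingFourier ψ p O v := by
    intro g hg hgB c hc v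
    refine pairingFourier_id_smul_apply ψ O (g : V →ₗ[F] V) g.injective c hc ?_ v
    intro φ₁ h₁
    obtain ⟨h, hh, hhB, d, hd, rfl⟩ := (mO _).1 h₁
    refine (mO _).2 ⟨h * g, H.mul_mem hh hg, fun b hb => ?_, c * d, mul_ne_zero hc hd, ?_⟩
    · rw [LinearEquiv.mul_apply, hgB b hb, hhB b hb]
    · ext v
      simp [mul_assoc]
  obtain ⟨v₀, hv₀⟩ : ∃ v, v ∉ B := by
    by_contra! h
    exact hφ (LinearMap.ext fun v => hφB v (h v))
  have hconst : ∀ v ∉ B, pairingFourier ψ p O v = pairingFourier ψ p O v₀ := by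
    intro v hv
    obtain ⟨h, hh, hhB, c, hc, he⟩ := hB v hv v₀ hv₀
    rw [← hinv h hh hhB c⁻¹ (inv_ne_zero hc) v, he, inv_smul_smul₀ hc]
  have hOB : ∀ v ∈ B, pairingFourier ψ p O v = O.card := by
    intro v hv
    unfold pairingFourier
    rw [Finset.sum_congr rfl (g := fun _ => 1), Finset.sum_const, nsmul_eq_mul, mul_one]
    intro φ₁ h₁
    obtain ⟨h, hh, hhB, d, hd, rfl⟩ := (mO _).1 h₁
    simp [p, hhB v hv, hφB v hv]
  set Bf : Finset V := Finset.univ.filter (fun v => v ∈ B) with hBf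
  have hS1 : ∀ φ₁ : Module.Dual F V, ∑ x, pairingFourier ψ p O x * ψ (-(φ₁ x)) =
      if φ₁ ∈ O then (Fintype.card V : ℂ) else 0 := by
    intro φ₁
    unfold pairingFourier
    simp_rw [Finset.sum_mul]
    rw [Finset.sum_comm]
    have : ∀ φ₂ ∈ O, ∑ x, ψ (p φ₂ x) * ψ (-(φ₁ x)) =
        if φ₂ = φ₁ then (Fintype.card V : ℂ) else 0 := by
      intro φ₂ _
      have h := sum_addChar_pairing ψ hψ p ⊤ Finset.univ (by simp) (φ₂ - φ₁)
      have h2 : (∀ y ∈ (⊤ : Submodule F V), p (φ₂ - φ₁) y = 0) ↔ φ₂ = φ₁ := by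
        rw [← sub_eq_zero]
        exact ⟨fun h => LinearMap.ext fun v => h v trivial, fun h v _ => by rw [h]; simp⟩
      simp only [h2, Finset.card_univ] at h
      rw [← h]
      refine Finset.sum_congr rfl fun x _ => ?_
      rw [← AddChar.map_add_eq_mul]
      congr 1
      simp [p, sub_eq_add_neg]
    rw [Finset.sum_congr rfl this, Finset.sum_ite_eq']
  have hS2 : ∀ φ₁ : Module.Dual F V, φ₁ ≠ 0 → (∀ b ∈ B, φ₁ b = 0) →
      ∑ x, pairingFourier ψ p O x * ψ (-(φ₁ x)) =
        (O.card - pairingFourier ψ p O v₀) * Bf.card := by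
    intro φ₁ h₁ h₁B
    have h := sum_addChar_pairing ψ hψ p ⊤ Finset.univ (by simp) (-φ₁)
    rw [if_neg] at h
    swap
    · intro h
      refine h₁ (LinearMap.ext fun v => ?_)
      have := h v trivial
      simpa [p] using this
    have h2 : ∀ x, pairingFourier ψ p O x * ψ (-(φ₁ x)) =
        pairingFourier ψ p O v₀ * ψ (p (-φ₁) x) +
          if x ∈ B then (O.card - pairingFourier ψ p O v₀) else 0 := by
      intro x
      split_ifs with hx
      · rw [hOB x hx]
        simp [p, h₁B x hx]
      · rw [hconst x hx]
        simp [p]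
    rw [Finset.sum_congr rfl fun x _ => h2 x, Finset.sum_add_distrib, ← Finset.mul_sum, h,
      mul_zero, zero_add, ← Finset.sum_filter, Finset.sum_const, nsmul_eq_mul, mul_comm]
  refine (mO φ').1 ?_
  by_contra hn
  have h1 := hS1 φ'
  have h2 := hS1 φ
  rw [if_neg hn, hS2 φ' hφ' hφB'] at h1
  rw [if_pos hφO, hS2 φ hφ hφB, h1] at h2
  have : Fintype.card V ≠ 0 := Fintype.card_ne_zero
  exact this (by exact_mod_cast h2.symm)

end Dual

section Block

variable {F U E : Type*} [Field F] [AddCommGroup U] [Module F U] [Field E] [Algebra F E]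
  {H : Subgroup ((U × E) ≃ₗ[F] (U × E))} [Finite F] [Finite U] [Finite E]

open Classical in
/-- The set of `h ∈ H` such that `h (U × 0)` contains `B`. -/
noncomputable def capD (H : Subgroup ((U × E) ≃ₗ[F] (U × E))) (B : Submodule F (U × E)) :
    Finset ((U × E) ≃ₗ[F] (U × E)) :=
  have : Finite ((U × E) ≃ₗ[F] (U × E)) := DFunLike.finite _
  (Set.toFinite {h : (U × E) ≃ₗ[F] (U × E) | h ∈ H ∧ ∀ b ∈ B, (h.symm b).2 = 0}).toFinset

omit [Finite F] in
theorem mem_capD {B : Submodule F (U × E)} {h : (U × E) ≃ₗ[F] (U × E)} :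
    h ∈ capD H B ↔ h ∈ H ∧ ∀ b ∈ B, (h.symm b).2 = 0 := by
  simp [capD]

omit [Finite F] in
theorem mem_capD_sup {B : Submodule F (U × E)} {h : (U × E) ≃ₗ[F] (U × E)} {v : U × E} :
    h ∈ capD H (B ⊔ Submodule.span F {v}) ↔ h ∈ capD H B ∧ (h.symm v).2 = 0 := by
  rw [mem_capD, mem_capD]
  constructor
  · rintro ⟨h1, h2⟩
    exact ⟨⟨h1, fun b hb => h2 b (Submodule.mem_sup_left hb)⟩,
      h2 v (Submodule.mem_sup_right (Submodule.mem_span_singleton_self v))⟩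
  · rintro ⟨⟨h1, h2⟩, h3⟩
    refine ⟨h1, fun b hb => ?_⟩
    obtain ⟨b', hb', y, hy, rfl⟩ := Submodule.mem_sup.1 hb
    obtain ⟨c, rfl⟩ := Submodule.mem_span_singleton.1 hy
    simp [h2 b' hb', h3]

omit [Finite F] in
theorem card_capD_sup_mul {B : Submodule F (U × E)} (hB : ProjTransOn H B) {v : U × E}
    (hv : v ∉ B) :
    (capD H (B ⊔ Submodule.span F {v})).card * (Nat.card (U × E) - Nat.card B) =
      (capD H B).card * (Nat.card U - Nat.card B) := by
  classical
  let _ : Fintype (U × E) := Fintype.ofFinite _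
  have h := Finset.sum_card_bipartiteAbove_eq_sum_card_bipartiteBelow
    (fun (h : (U × E) ≃ₗ[F] (U × E)) (x : U × E) => (h.symm x).2 = 0)
    (s := capD H B) (t := Finset.univ.filter fun x => x ∉ B)
  have hBc : (Finset.univ.filter fun x => x ∈ B).card = Nat.card B := by
    rw [Nat.card_eq_fintype_card, Fintype.card_subtype]
  have h1 : ∀ h ∈ capD H B, (Finset.bipartiteAbove
      (fun (h : (U × E) ≃ₗ[F] (U × E)) (x : U × E) => (h.symm x).2 = 0)
      (Finset.univ.filter fun x => x ∉ B) h).card = Nat.card U - Nat.card B := by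
    intro g hg
    have h2 := (mem_capD.1 hg).2
    have h3 : Finset.bipartiteAbove
      (fun (h : (U × E) ≃ₗ[F] (U × E)) (x : U × E) => (h.symm x).2 = 0)
      (Finset.univ.filter fun x => x ∉ B) g =
      (Finset.univ.filter fun x => (g.symm x).2 = 0) \ (Finset.univ.filter fun x => x ∈ B) := by
      ext x
      simp [Finset.bipartiteAbove, and_comm]
    rw [h3, Finset.card_sdiff_of_subset (fun x hx => by simp at hx ⊢; exact h2 x hx), hBc]
    congr 1
    rw [← Fintype.card_subtype, ← Nat.card_eq_fintype_card]
    refine Nat.card_congr ⟨fun x => (g.symm x.1).1, fun u => ⟨g (u, 0), by simp⟩, ?_, ?_⟩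
    · rintro ⟨x, hx⟩
      refine Subtype.ext ?_
      have : ((g.symm x).1, (0 : E)) = g.symm x := Prod.ext rfl hx.symm
      simp [this]
    · intro u
      simp
  have h4 : ∀ x ∈ Finset.univ.filter (fun x => x ∉ B), (Finset.bipartiteBelow
      (fun (h : (U × E) ≃ₗ[F] (U × E)) (x : U × E) => (h.symm x).2 = 0) (capD H B) x).card =
      (capD H (B ⊔ Submodule.span F {v})).card := by
    intro x hx
    have hxB : x ∉ B := by simpa using hx
    obtain ⟨g, hg, hgB, c, hc, hgx⟩ := hB x hxB v hv
    have hgB' : ∀ b ∈ B, g.symm b = b := fun b hb => by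
      rw [LinearEquiv.symm_apply_eq, hgB b hb]
    have hgv : g.symm v = c⁻¹ • x := by
      rw [LinearEquiv.symm_apply_eq, map_smul, hgx, inv_smul_smul₀ hc]
    refine Finset.card_bij' (fun h _ => g * h) (fun h _ => g⁻¹ * h) ?_ ?_ (fun h _ => by simp)
      (fun h _ => by simp)
    · intro h hh
      simp only [Finset.bipartiteBelow, Finset.mem_filter, mem_capD] at hh
      rw [mem_capD_sup, mem_capD]
      obtain ⟨⟨a1, a2⟩, a3⟩ := hh
      refine ⟨⟨H.mul_mem hg a1, fun b hb => ?_⟩, ?_⟩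
      · change (h.symm (g.symm b)).2 = 0
        rw [hgB' b hb, a2 b hb]
      · change (h.symm (g.symm v)).2 = 0
        rw [hgv]; simp [a3]
    · intro h hh
      rw [mem_capD_sup, mem_capD] at hh
      simp only [Finset.bipartiteBelow, Finset.mem_filter, mem_capD]
      obtain ⟨⟨a1, a2⟩, a3⟩ := hh
      refine ⟨⟨H.mul_mem (H.inv_mem hg) a1, fun b hb => ?_⟩, ?_⟩
      · change (h.symm (g b)).2 = 0
        rw [hgB b hb, a2 b hb]
      · change (h.symm (g x)).2 = 0
        rw [hgx]; simp [a3]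
  rw [Finset.sum_congr rfl h1, Finset.sum_congr rfl h4, Finset.sum_const, Finset.sum_const,
    smul_eq_mul, smul_eq_mul] at h
  rw [h, mul_comm]
  congr 1
  have h5 : (Finset.univ.filter fun x => x ∉ B) =
      Finset.univ \ (Finset.univ.filter fun x => x ∈ B) := by
    ext x; simp
  rw [h5, Finset.card_sdiff_of_subset (Finset.subset_univ _), hBc, Finset.card_univ,
    Nat.card_eq_fintype_card]

open Classical in
theorem card_capD_filter_mul {B : Submodule F (U × E)} (hB : ProjTransOn H B)
    {φ : Module.Dual F (U × E)} (hφ : φ ≠ 0) (hφB : ∀ b ∈ B, φ b = 0) :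
    ((capD H B).filter fun h => ∀ w : E, φ (h (0, w)) = 0).card *
      (Nat.card (U × E) - Nat.card B) = (capD H B).card * (Nat.card U - Nat.card B) := by
  have : Finite (Module.Dual F (U × E)) := DFunLike.finite _
  let _ : Fintype (Module.Dual F (U × E)) := Fintype.ofFinite _
  have hpos : 0 < Nat.card B := Nat.card_pos
  set t : Finset (Module.Dual F (U × E)) := Finset.univ.filter fun φ => φ ≠ 0 ∧ ∀ b ∈ B, φ b = 0
    with ht
  have h := Finset.sum_card_bipartiteAbove_eq_sum_card_bipartiteBelow
    (fun (h : (U × E) ≃ₗ[F] (U × E)) (φ : Module.Dual F (U × E)) => ∀ w : E, φ (h (0, w)) = 0)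
    (s := capD H B) (t := t)
  have hann : ∀ W : Submodule F (U × E),
      (Finset.univ.filter fun φ : Module.Dual F (U × E) => φ ≠ 0 ∧ ∀ b ∈ W, φ b = 0).card =
        Nat.card W.dualAnnihilator - 1 := by
    intro W
    have h1 : (Finset.univ.filter fun φ : Module.Dual F (U × E) => φ ≠ 0 ∧ ∀ b ∈ W, φ b = 0) =
        (Finset.univ.filter fun φ : Module.Dual F (U × E) => φ ∈ W.dualAnnihilator).erase 0 := by
      ext φ; simp [Submodule.mem_dualAnnihilator]
    rw [h1, Finset.card_erase_of_mem (by simp), ← Fintype.card_subtype,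
      ← Nat.card_eq_fintype_card]
  have h1 : ∀ h ∈ capD H B, (Finset.bipartiteAbove
      (fun (h : (U × E) ≃ₗ[F] (U × E)) (φ : Module.Dual F (U × E)) => ∀ w : E, φ (h (0, w)) = 0)
      t h).card * Nat.card B = Nat.card U - Nat.card B := by
    intro g hg
    have h2 := (mem_capD.1 hg).2
    set W : Submodule F (U × E) := B ⊔ (sndSub F U E).map (g : (U × E) →ₗ[F] (U × E)) with hW
    have h3 : Finset.bipartiteAbove
      (fun (h : (U × E) ≃ₗ[F] (U × E)) (φ : Module.Dual F (U × E)) => ∀ w : E, φ (h (0, w)) = 0)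
      t g = Finset.univ.filter fun φ : Module.Dual F (U × E) => φ ≠ 0 ∧ ∀ b ∈ W, φ b = 0 := by
      ext φ
      simp only [Finset.bipartiteAbove, ht, Finset.mem_filter, Finset.mem_univ, true_and,
        and_assoc]
      refine and_congr_right fun _ => ⟨?_, ?_⟩
      · rintro ⟨a1, a2⟩ x hx
        obtain ⟨b, hb, y, ⟨⟨u, w⟩, hw, rfl⟩, rfl⟩ := Submodule.mem_sup.1 hx
        have hu : u = 0 := hw
        subst hu
        have := a2 w
        simp [a1 b hb, this]
      · intro a
        refine ⟨fun b hb => a b (Submodule.mem_sup_left hb), fun w => a _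
          (Submodule.mem_sup_right ⟨(0, w), rfl, rfl⟩)⟩
    rw [h3, hann, Nat.sub_mul, one_mul]
    congr 1
    have h4 : Disjoint B ((sndSub F U E).map (g : (U × E) →ₗ[F] (U × E))) := by
      rw [Submodule.disjoint_def]
      rintro _ hx ⟨⟨u, w⟩, hw, rfl⟩
      have hu : u = 0 := hw
      have := h2 _ hx
      have hw' : w = 0 := by simpa using this
      subst hu hw'
      exact map_zero _
    have h5 : Nat.card W = Nat.card B * Nat.card E := by
      have h6 := Submodule.finrank_sup_add_finrank_inf_eq B
        ((sndSub F U E).map (g : (U × E) →ₗ[F] (U × E)))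
      rw [h4.eq_bot, finrank_bot, add_zero, LinearEquiv.finrank_map_eq, finrank_sndSub] at h6
      rw [Module.natCard_eq_pow_finrank (K := F) (V := W),
        Module.natCard_eq_pow_finrank (K := F) (V := B),
        Module.natCard_eq_pow_finrank (K := F) (V := E), ← pow_add, h6]
    have h7 := natCard_dualAnnihilator_mul W
    rw [h5, Nat.card_prod] at h7
    have h8 : 0 < Nat.card E := Nat.card_pos
    refine Nat.eq_of_mul_eq_mul_right h8 ?_
    rw [← h7]; ring
  have h4 : ∀ φ' ∈ t, (Finset.bipartiteBelow
      (fun (h : (U × E) ≃ₗ[F] (U × E)) (φ : Module.Dual F (U × E)) => ∀ w : E, φ (h (0, w)) = 0)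
      (capD H B) φ').card = ((capD H B).filter fun h => ∀ w : E, φ (h (0, w)) = 0).card := by
    intro φ' hφ'
    simp only [ht, Finset.mem_filter, Finset.mem_univ, true_and] at hφ'
    obtain ⟨g, hg, hgB, c, hc, hgφ⟩ := hB.exists_comp_eq hφ hφB hφ'.1 hφ'.2
    have hgB' : ∀ b ∈ B, g.symm b = b := fun b hb => by
      rw [LinearEquiv.symm_apply_eq, hgB b hb]
    refine Finset.card_bij' (fun h _ => g * h) (fun h _ => g⁻¹ * h) ?_ ?_ (fun h _ => by simp)
      (fun h _ => by simp)
    · intro h hh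
      simp only [Finset.bipartiteBelow, Finset.mem_filter, mem_capD] at hh ⊢
      obtain ⟨⟨a1, a2⟩, a3⟩ := hh
      refine ⟨⟨H.mul_mem hg a1, fun b hb => ?_⟩, fun w => ?_⟩
      · change (h.symm (g.symm b)).2 = 0
        rw [hgB' b hb, a2 b hb]
      · have := a3 w
        rw [hgφ] at this
        simpa [hc] using this
    · intro h hh
      simp only [Finset.bipartiteBelow, Finset.mem_filter, mem_capD] at hh ⊢
      obtain ⟨⟨a1, a2⟩, a3⟩ := hh
      refine ⟨⟨H.mul_mem (H.inv_mem hg) a1, fun b hb => ?_⟩, fun w => ?_⟩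
      · change (h.symm (g b)).2 = 0
        rw [hgB b hb, a2 b hb]
      · have h5 : g ((g⁻¹ * h) (0, w)) = h (0, w) := g.apply_symm_apply _
        rw [hgφ]
        change c * φ (g ((g⁻¹ * h) (0, w))) = 0
        rw [h5, a3 w, mul_zero]
  rw [Finset.sum_congr rfl h4, Finset.sum_const, smul_eq_mul, ht, hann] at h
  have h5 := congrArg (· * Nat.card B) h
  simp only [Finset.sum_mul] at h5
  rw [Finset.sum_congr rfl h1, Finset.sum_const, smul_eq_mul] at h5
  rw [h5, mul_right_comm, Nat.sub_mul, one_mul, mul_comm (Nat.card _) (Nat.card B),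
    natCard_dualAnnihilator_mul, mul_comm]

/-- A functional vanishing on `B` and on all `h (0 × E)` with `h (U × 0) ∋ v` (and `⊇ B`)
determines the set of `h ∈ H` such that `h (U × 0)` contains `B` and `v`. -/
theorem ProjTransOn.snd_symm_eq_zero {B : Submodule F (U × E)} (hB : ProjTransOn H B)
    {φ : Module.Dual F (U × E)} (hφ : φ ≠ 0) (hφB : ∀ b ∈ B, φ b = 0) {v : U × E} (hv : v ∉ B)
    (hφv : ∀ x ∈ spanT H (B ⊔ Submodule.span F {v}), φ x = 0)
    {h : (U × E) ≃ₗ[F] (U × E)} (hh : h ∈ H) (hhB : ∀ b ∈ B, (h.symm b).2 = 0)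
    (hw : ∀ w : E, φ (h (0, w)) = 0) : (h.symm v).2 = 0 := by
  classical
  have h1 : capD H (B ⊔ Submodule.span F {v}) ⊆
      (capD H B).filter fun h => ∀ w : E, φ (h (0, w)) = 0 := by
    intro g hg
    rw [Finset.mem_filter]
    refine ⟨(mem_capD_sup.1 hg).1, fun w => hφv _ ?_⟩
    rw [mem_capD] at hg
    exact mem_spanT hg.1 hg.2 w
  have hlt : Nat.card B < Nat.card (U × E) := by
    by_contra! hle
    have : B = ⊤ := by
      by_contra hne
      obtain ⟨x, hx⟩ : ∃ x, x ∉ B := by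
        by_contra! hcon
        exact hne (eq_top_iff.2 fun x _ => hcon x)
      have := Set.ncard_lt_ncard (s := (B : Set (U × E))) (t := Set.univ)
        (Set.ssubset_univ_iff.2 fun h => hx (by
          have : x ∈ (B : Set (U × E)) := h ▸ Set.mem_univ x
          exact this)) (Set.toFinite _)
      rw [Set.ncard_univ, ← Nat.card_coe_set_eq] at this
      exact absurd hle (not_le.2 this)
    exact hv (this ▸ Submodule.mem_top)
  have h2 : capD H (B ⊔ Submodule.span F {v}) =
      (capD H B).filter fun h => ∀ w : E, φ (h (0, w)) = 0 := by
    refine Finset.eq_of_subset_of_card_le h1 ?_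
    refine Nat.le_of_mul_le_mul_right (c := Nat.card (U × E) - Nat.card B) ?_ (by omega)
    rw [card_capD_filter_mul hB hφ hφB, card_capD_sup_mul hB hv]
  have h3 : h ∈ capD H (B ⊔ Submodule.span F {v}) := by
    rw [h2, Finset.mem_filter, mem_capD]
    exact ⟨⟨hh, hhB⟩, hw⟩
  exact (mem_capD_sup.1 h3).2

end Block

section Block

variable {F U E : Type*} [Field F] [AddCommGroup U] [Module F U] [Field E] [Algebra F E]
  {U₁ : Submodule F U} {H : Subgroup ((U × E) ≃ₗ[F] (U × E))} {Γ : Set Eˣ}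

/-- The subspace `U₁ × 0`. -/
def inlSub (E : Type*) [Field E] [Algebra F E] (U₁ : Submodule F U) : Submodule F (U × E) :=
  U₁.map (LinearMap.inl F U E)

theorem mem_inlSub {v : U × E} : v ∈ inlSub E U₁ ↔ v.1 ∈ U₁ ∧ v.2 = 0 := by
  constructor
  · rintro ⟨u, hu, rfl⟩
    exact ⟨hu, rfl⟩
  · rintro ⟨h1, h2⟩
    exact ⟨v.1, h1, Prod.ext rfl h2.symm⟩

theorem inlSub_le : inlSub E U₁ ≤ fstSub F U E := fun _ hv => (mem_inlSub.1 hv).2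

theorem finrank_inlSub [FiniteDimensional F U] [FiniteDimensional F E] :
    Module.finrank F (inlSub E U₁) = Module.finrank F U₁ :=
  (Submodule.equivMapOfInjective _ LinearMap.inl_injective U₁).finrank_eq.symm

/-- The subspace generated by `B` and the translates `h (0 × E)` such that `h (U × 0)` contains
`B` and `v`. -/
def spanTB (H : Subgroup ((U × E) ≃ₗ[F] (U × E))) (B : Submodule F (U × E)) (v : U × E) :
    Submodule F (U × E) := spanT H (B ⊔ Submodule.span F {v}) ⊔ B

theorem spanTB_map_le {g : (U × E) ≃ₗ[F] (U × E)} (hg : g ∈ H) {B B' : Submodule F (U × E)}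
    (hB : B.map (g : (U × E) →ₗ[F] (U × E)) = B') {v v' : U × E} {c : F} (hc : c ≠ 0)
    (hv : g v = c • v') {x : U × E} (hx : x ∈ spanTB H B v) : g x ∈ spanTB H B' v' := by
  obtain ⟨t, ht, b, hb, rfl⟩ := Submodule.mem_sup.1 hx
  rw [map_add]
  refine Submodule.add_mem_sup ?_ (hB ▸ Submodule.mem_map_equiv'.2 hb)
  have := mem_spanT_map hg ht
  rwa [Submodule.map_sup_span_singleton, hB, hv, Submodule.sup_span_smul _ hc] at this

theorem spanTB_map {g : (U × E) ≃ₗ[F] (U × E)} (hg : g ∈ H) {B B' : Submodule F (U × E)}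
    (hB : B.map (g : (U × E) →ₗ[F] (U × E)) = B') {v v' : U × E} {c : F} (hc : c ≠ 0)
    (hv : g v = c • v') :
    (spanTB H B v).map (g : (U × E) →ₗ[F] (U × E)) = spanTB H B' v' := by
  apply le_antisymm
  · rintro _ ⟨x, hx, rfl⟩
    exact spanTB_map_le hg hB hc hv hx
  · intro x hx
    have h1 : B'.map ((g⁻¹ : (U × E) ≃ₗ[F] (U × E)) : (U × E) →ₗ[F] (U × E)) = B := by
      rw [← hB, ← Submodule.map_mul_equiv, inv_mul_cancel]
      exact Submodule.map_eq_self_of_fixed fun _ _ => rfl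
    have h2 : (g⁻¹ : (U × E) ≃ₗ[F] (U × E)) v' = c⁻¹ • v := by
      refine (LinearEquiv.symm_apply_eq g).2 ?_
      rw [map_smul, hv, inv_smul_smul₀ hc]
    exact ⟨_, spanTB_map_le (H.inv_mem hg) h1 (inv_ne_zero hc) h2 hx, g.apply_symm_apply x⟩

theorem spanTB_congr {B : Submodule F (U × E)} {v v' : U × E} {c : F} (hc : c ≠ 0)
    (h : v' - c • v ∈ B) : spanTB H B v' = spanTB H B v := by
  have : B ⊔ Submodule.span F {v'} = B ⊔ Submodule.span F {v} := by
    apply le_antisymm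
    · refine sup_le le_sup_left ?_
      rw [Submodule.span_singleton_le_iff_mem]
      have h1 : v' = (v' - c • v) + c • v := by abel
      rw [h1]
      exact Submodule.add_mem_sup h (Submodule.smul_mem _ _ (Submodule.mem_span_singleton_self v))
    · refine sup_le le_sup_left ?_
      rw [Submodule.span_singleton_le_iff_mem]
      have h1 : v = (-c⁻¹) • (v' - c • v) + c⁻¹ • v' := by
        rw [smul_sub, neg_smul, neg_smul, inv_smul_smul₀ hc]; abel
      rw [h1]
      exact Submodule.add_mem_sup (B.smul_mem _ h)
        (Submodule.smul_mem _ _ (Submodule.mem_span_singleton_self v'))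
  rw [spanTB, spanTB, this]

theorem snd_mem_spanTB {B : Submodule F (U × E)} (hB : ∀ b ∈ B, b.2 = 0) {v : U × E}
    (hv : v.2 = 0) (w : E) : ((0, w) : U × E) ∈ spanTB H B v := by
  refine Submodule.mem_sup_left (mem_spanT (h := 1) H.one_mem (fun a ha => ?_) w)
  obtain ⟨b, hb, y, hy, rfl⟩ := Submodule.mem_sup.1 ha
  obtain ⟨c, rfl⟩ := Submodule.mem_span_singleton.1 hy
  change (b + c • v).2 = 0
  simp [hB b hb, hv]

namespace IsBlockGroup

variable [Finite F] [Finite U] [Finite E]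

theorem spanTB_eq_top (hG : IsBlockGroup U₁ H Γ) {Fz Mz : Submodule F (U × E)}
    (hz : IsSeparator H Fz Mz) {i : ℕ}
    (hi₁ : i + 1 ≤ Module.finrank F U₁) (hi : i + 1 < Module.finrank F U)
    (ht : ∀ j ≤ i, ProjTrans H j) {B : Submodule F (U × E)}
    (hB : Module.finrank F B = i) {v : U × E} (hv : v ∉ B) : spanTB H B v = ⊤ := by
  -- reduction to `B ≤ U₁ × 0`
  obtain ⟨B₀, hB₀U₁, hB₀⟩ := (inlSub E U₁).exists_le_finrank_eq (j := i)
    (by rw [finrank_inlSub]; omega)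
  have hB₀U := hB₀U₁.trans inlSub_le
  by_contra hne
  have htop : ∀ x ∉ B₀, spanTB H B₀ x ≠ ⊤ := by
    intro x hx hxt
    obtain ⟨h, hh, hhB, c, hc, hhv⟩ := ProjTrans.exists_map_eq_and ht hB₀ hB hx hv
    apply hne
    rw [← spanTB_map hh hhB hc hhv, hxt, Submodule.map_top, LinearEquiv.range]
  clear hne hv hB
  clear v B
  rename' B₀ => B, hB₀U₁ => hBU₁, hB₀U => hBU, hB₀ => hB
  have hB0 : ∀ b ∈ B, b.2 = 0 := fun b hb => hBU hb
  have htB := ht i le_rfl B hB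
  obtain ⟨A, hBA, hAU₁, hA⟩ : ∃ A, B ≤ A ∧ A ≤ inlSub E U₁ ∧ Module.finrank F A = i + 1 := by
    obtain ⟨v, hvU, hvB⟩ := SetLike.exists_of_lt (lt_of_le_of_ne hBU₁ (by
      rintro rfl; rw [finrank_inlSub] at hB; omega))
    exact ⟨B ⊔ Submodule.span F {v}, le_sup_left, sup_le hBU₁ (by simpa using hvU), by
      rw [Submodule.finrank_sup_span_singleton hvB, hB]⟩
  have hAU := hAU₁.trans inlSub_le
  obtain ⟨u₁, hu₁A, hu₁B⟩ := SetLike.exists_of_lt (lt_of_le_of_ne hBA (by rintro rfl; omega))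
  have hu₁ : u₁.2 = 0 := hAU hu₁A
  have hAeq : B ⊔ Submodule.span F {u₁} = A := by
    refine Submodule.eq_of_le_of_finrank_eq (sup_le hBA (by simpa using hu₁A)) ?_
    rw [Submodule.finrank_sup_span_singleton hu₁B, hB, hA]
  obtain ⟨u₂, hu₂U, hu₂A⟩ := SetLike.exists_of_lt (lt_of_le_of_ne hAU (by
    rintro rfl; rw [finrank_fstSub] at hA; omega))
  have hu₂ : u₂.2 = 0 := hu₂U
  have hu₂B : u₂ ∉ B := fun h => hu₂A (hBA h)
  have hdimC : ∀ x ∉ B, Module.finrank F (spanTB H B x) = Module.finrank F (spanTB H B u₁) := by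
    intro x hx
    obtain ⟨h, hh, hhB, c, hc, hhv⟩ := ProjTrans.exists_map_eq_and ht hB hB hu₁B hx
    rw [← spanTB_map hh hhB hc hhv, LinearEquiv.finrank_map_eq]
  have hnk : Module.finrank F (U × E) = Module.finrank F U + Module.finrank F E :=
    Module.finrank_prod
  -- the codimension is small
  have hcodim : 2 * Module.finrank F U + 2 * Module.finrank F E ≤
      2 * Module.finrank F (spanTB H B u₁) + (Module.finrank F U - i) := by
    have hle : ∀ x : U × E, x.2 = 0 →
        (spanTB H B x).dualAnnihilator ≤ (B ⊔ sndSub F U E).dualAnnihilator := by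
      intro x hx
      refine Submodule.dualAnnihilator_anti (sup_le le_sup_right ?_)
      rintro ⟨u, w⟩ h
      have hu : u = 0 := h
      subst hu
      exact snd_mem_spanTB hB0 hx w
    have hdisj : (spanTB H B u₁).dualAnnihilator ⊓ (spanTB H B u₂).dualAnnihilator = ⊥ := by
      rw [eq_bot_iff]
      rintro φ ⟨h1, h2⟩
      rw [SetLike.mem_coe, Submodule.mem_dualAnnihilator] at h1 h2
      rw [Submodule.mem_bot]
      by_contra hφ
      have h3 : u₂ ∈ capS H (B ⊔ Submodule.span F {u₁}) := by
        intro h hh hhA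
        refine htB.snd_symm_eq_zero hφ (fun b hb => h1 b (Submodule.mem_sup_right hb)) hu₂B
          (fun x hx => h2 x (Submodule.mem_sup_left hx)) hh
          (fun b hb => hhA b (Submodule.mem_sup_left hb))
          (fun w => h1 _ (Submodule.mem_sup_left (mem_spanT hh hhA w)))
      rw [hAeq, hG.capS_eq hz hi (fun j hj => ht j (by omega)) hA] at h3
      exact hu₂A h3
    have h4 := Submodule.finrank_sup_add_finrank_inf_eq (spanTB H B u₁).dualAnnihilator
      (spanTB H B u₂).dualAnnihilator
    rw [hdisj, finrank_bot, add_zero] at h4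
    have h5 := Submodule.finrank_mono (sup_le (hle u₁ hu₁) (hle u₂ hu₂))
    have h6 := Subspace.finrank_add_finrank_dualAnnihilator_eq (spanTB H B u₁)
    have h7 := Subspace.finrank_add_finrank_dualAnnihilator_eq (spanTB H B u₂)
    have h8 := Subspace.finrank_add_finrank_dualAnnihilator_eq (B ⊔ sndSub F U E)
    have h9 := Submodule.finrank_sup_add_finrank_inf_eq B (sndSub F U E)
    have h10 : B ⊓ sndSub F U E = ⊥ := by
      rw [eq_bot_iff]
      rintro x ⟨hx1, hx2⟩
      exact Prod.ext hx2 (hB0 x hx1)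
    rw [h10, finrank_bot, add_zero, finrank_sndSub, hB] at h9
    have h11 := hdimC u₂ hu₂B
    omega
  -- a single orbital
  have horb : ∀ v v', v ∉ B → v' ∈ spanTB H B v → v' ∉ B ⊔ Submodule.span F {v} →
      ∀ w' : E, w' ≠ 0 → ∃ g ∈ H, (∀ b ∈ B, g b = b) ∧
        ∃ c : F, c ≠ 0 ∧ g v = c • u₁ ∧ ∃ c' : F, c' ≠ 0 ∧ ∃ b ∈ B, g v' = c' • (0, w') + b := by
    intro v v' hv hv' hvv w' hw'
    obtain ⟨g₁, hg₁, hg₁B, c, hc, hg₁v⟩ := htB v hv u₁ hu₁B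
    have hmapB := Submodule.map_eq_self_of_fixed hg₁B
    have h1 := spanTB_map_le hg₁ hmapB hc hg₁v hv'
    have hA0 : ∀ a ∈ B ⊔ Submodule.span F {u₁}, a ∈ inlSub E U₁ := by
      rw [hAeq]
      exact hAU₁
    obtain ⟨t, htT, b, hb, hsum⟩ := Submodule.mem_sup.1 h1
    have htA : t ∉ B ⊔ Submodule.span F {u₁} := by
      intro h
      apply hvv
      rw [← Submodule.mem_map_equiv' (h := g₁), Submodule.map_sup_span_singleton, hmapB, hg₁v,
        Submodule.sup_span_smul _ hc, ← hsum]
      exact Submodule.add_mem _ h (Submodule.mem_sup_left hb)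
    have hA1 : Module.finrank F ↥(B ⊔ Submodule.span F {u₁}) = i + 1 := by
      rw [Submodule.finrank_sup_span_singleton hu₁B, hB]
    obtain ⟨g₂, hg₂, hg₂A, c', hc', hg₂t⟩ := hG.exists_smul_eq
      (fun a ha => (mem_inlSub.1 (hA0 a ha)).2) (fun a ha => (mem_inlSub.1 (hA0 a ha)).1)
      (hG.capS_eq hz hi (fun j hj => ht j (by omega)) hA1).le htT htA (v' := (0, w'))
      (mem_spanT (h := 1) H.one_mem (fun a ha => (mem_inlSub.1 (hA0 a ha)).2) w')
      (fun h => hw' (mem_inlSub.1 (hA0 _ h)).2)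
    refine ⟨g₂ * g₁, H.mul_mem hg₂ hg₁, fun b hb => ?_, c, hc, ?_, c', hc', b, hb, ?_⟩
    · rw [LinearEquiv.mul_apply, hg₁B b hb, hg₂A b (Submodule.mem_sup_left hb)]
    · rw [LinearEquiv.mul_apply, hg₁v, map_smul,
        hg₂A u₁ (Submodule.mem_sup_right (Submodule.mem_span_singleton_self u₁))]
    · rw [LinearEquiv.mul_apply, ← hsum, map_add, hg₂t, hg₂A b (Submodule.mem_sup_left hb)]
  have hsnd : ∀ w : E, w ≠ 0 → ((0, w) : U × E) ∉ B := fun w hw h => hw (hB0 _ h)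
  have hu₁T : ∀ w : E, w ≠ 0 → u₁ ∈ spanTB H B (0, w) := by
    obtain ⟨u₀, hu₀, hu₀B⟩ : ∃ u₀ ∈ fstSub F U E ⊓ spanTB H B (0, 1), u₀ ∉ B := by
      by_contra! hcon
      have h1 := Submodule.finrank_mono
        (show fstSub F U E ⊓ spanTB H B (0, 1) ≤ B from hcon)
      have h2 := Submodule.finrank_sup_add_finrank_inf_eq (fstSub F U E) (spanTB H B (0, 1))
      have h3 := Submodule.finrank_le (fstSub F U E ⊔ spanTB H B (0, 1))
      rw [finrank_fstSub, hdimC _ (hsnd 1 one_ne_zero)] at h2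
      omega
    have hu₀2 : u₀.2 = 0 := hu₀.1
    have hu₀3 : u₀ ∉ B ⊔ Submodule.span F {((0, 1) : U × E)} := by
      intro h
      obtain ⟨b, hb, y, hy, he⟩ := Submodule.mem_sup.1 h
      obtain ⟨c, rfl⟩ := Submodule.mem_span_singleton.1 hy
      have h2 := congrArg Prod.snd he
      simp only [Prod.snd_add, hB0 b hb, Prod.smul_snd, zero_add, hu₀2] at h2
      have h3 : c • ((0, 1) : U × E) = 0 := Prod.ext (by simp) (by simpa using h2)
      rw [h3, add_zero] at he
      exact hu₀B (he ▸ hb)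
    intro w hw
    obtain ⟨g, hg, hgB, c, hc, hg1, c', hc', b, hb, hg2⟩ :=
      horb _ _ (hsnd 1 one_ne_zero) hu₀.2 hu₀3 w hw
    have h1 : ((0, 1) : U × E) ∈ spanTB H B u₀ := snd_mem_spanTB hB0 hu₀2 1
    have h2 := spanTB_map_le hg (Submodule.map_eq_self_of_fixed hgB) (one_ne_zero (α := F))
      (one_smul F _).symm h1
    rw [spanTB_congr hc' (v := (0, w)) (by rw [hg2]; simpa using hb), hg1,
      Submodule.smul_mem_iff _ hc] at h2
    exact h2
  have hsymm : ∀ v v', v ∉ B → v' ∈ spanTB H B v → v' ∉ B ⊔ Submodule.span F {v} →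
      v ∈ spanTB H B v' := by
    intro v v' hv hv' hvv
    obtain ⟨g, hg, hgB, c, hc, hg1, c', hc', b, hb, hg2⟩ :=
      horb v v' hv hv' hvv 1 one_ne_zero
    have h1 : g v ∈ spanTB H B (g v') := by
      rw [spanTB_congr hc' (v := (0, 1)) (by rw [hg2]; simpa using hb), hg1]
      exact Submodule.smul_mem _ _ (hu₁T 1 one_ne_zero)
    rw [← spanTB_map hg (Submodule.map_eq_self_of_fixed hgB) (one_ne_zero (α := F))
      (one_smul F _).symm, Submodule.mem_map_equiv'] at h1
    exact h1
  have hUT : ∀ w : E, w ≠ 0 → fstSub F U E ≤ spanTB H B (0, w) := by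
    intro w hw u hu
    by_cases huB : u ∈ B
    · exact Submodule.mem_sup_right huB
    refine hsymm _ _ huB (snd_mem_spanTB hB0 hu w) fun h => hw ?_
    have : B ⊔ Submodule.span F {u} ≤ fstSub F U E := sup_le hBU (by simpa using hu)
    exact this h
  -- Hua's identity
  set X : Submodule F E := (spanTB H B (0, 1)).comap (LinearMap.inr F U E) with hX
  have mX : ∀ z : E, z ∈ X ↔ ((0, z) : U × E) ∈ spanTB H B (0, 1) := fun z => Iff.rfl
  have hXinv : ∀ z ∈ X, z⁻¹ ∈ X := by
    intro z hzX
    by_cases hz0 : z = 0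
    · simp [hz0]
    by_cases hzF : ∃ a : F, z = a • (1 : E)
    · obtain ⟨a, rfl⟩ := hzF
      have ha : a ≠ 0 := by rintro rfl; simp at hz0
      have h1 : (a • (1 : E))⁻¹ = a⁻¹ • a⁻¹ • (a • (1 : E)) := by
        rw [inv_smul_smul₀ ha]
        simp [Algebra.smul_def]
      rw [h1]
      exact X.smul_mem _ (X.smul_mem _ hzX)
    · have h1 : ((0, z) : U × E) ∉ B ⊔ Submodule.span F {((0, 1) : U × E)} := by
        intro h
        obtain ⟨b, hb, y, hy, he⟩ := Submodule.mem_sup.1 h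
        obtain ⟨c, rfl⟩ := Submodule.mem_span_singleton.1 hy
        have h2 := congrArg Prod.snd he
        simp only [Prod.snd_add, hB0 b hb, Prod.smul_snd, zero_add] at h2
        exact hzF ⟨c, h2.symm⟩
      have h2 := hsymm _ _ (hsnd 1 one_ne_zero) ((mX z).1 hzX) h1
      obtain ⟨g, hg, hgU, a, ha, hgE⟩ := hG.twist _ (inv_ne_zero hz0)
      have h3 := spanTB_map_le hg (B := B) (B' := B)
        (Submodule.map_eq_self_of_fixed fun b hb => by
          have hb' : b = (b.1, 0) := Prod.ext rfl (hB0 b hb)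
          rw [hb', hgU _ (mem_inlSub.1 (hBU₁ hb)).1])
        (c := a) ha (v' := (0, 1)) (by
          rw [hgE]
          refine Prod.ext (by simp) ?_
          simp only [Prod.smul_snd, smul_mul_assoc, inv_mul_cancel₀ hz0]) h2
      rw [hgE, mul_one] at h3
      rw [← X.smul_mem_iff ha]
      exact (mX _).2 h3
  have hXdim : Module.finrank F (spanTB H B u₁) ≤ Module.finrank F X + Module.finrank F U := by
    rw [← hdimC _ (hsnd 1 one_ne_zero)]
    have h1 : spanTB H B (0, 1) ≤ X.map (LinearMap.inr F U E) ⊔ fstSub F U E := by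
      rintro ⟨u, w⟩ hx
      have h2 : ((u, 0) : U × E) ∈ fstSub F U E := by rw [mem_fstSub]
      have h3 : ((0, w) : U × E) ∈ spanTB H B (0, 1) := by
        have := Submodule.sub_mem _ hx (hUT 1 one_ne_zero h2)
        simpa using this
      refine Submodule.mem_sup.2 ⟨(0, w), ⟨w, h3, rfl⟩, (u, 0), h2, by simp⟩
    refine (Submodule.finrank_mono h1).trans ?_
    refine (Submodule.finrank_add_le_finrank_add_finrank _ _).trans ?_
    rw [finrank_fstSub]
    exact Nat.add_le_add_right (Submodule.finrank_map_le _ _) _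
  have hXtop : X.toAddSubgroup = ⊤ := by
    refine AddSubgroup.eq_top_of_inv_mem _ hXinv ?_
    have h1 : Nat.card X.toAddSubgroup = Nat.card F ^ Module.finrank F X :=
      Module.natCard_eq_pow_finrank (K := F) (V := X)
    have hq : 2 ≤ Nat.card F := Finite.one_lt_card
    rw [h1, ← pow_add, Module.natCard_eq_pow_finrank (K := F) (V := E)]
    have := hG.dim
    calc 4 * Nat.card F ^ Module.finrank F E ≤ Nat.card F ^ 2 * Nat.card F ^ Module.finrank F E :=
          Nat.mul_le_mul_right _ (by nlinarith)
      _ = Nat.card F ^ (2 + Module.finrank F E) := (pow_add _ _ _).symm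
      _ ≤ _ := Nat.pow_le_pow_right (by omega) (by omega)
  refine htop _ (hsnd 1 one_ne_zero) (eq_top_iff.2 ?_)
  rintro ⟨u, w⟩ -
  have h1 : w ∈ X.toAddSubgroup := hXtop ▸ AddSubgroup.mem_top w
  have h2 : ((0, w) : U × E) ∈ spanTB H B (0, 1) := h1
  have h3 : ((u, 0) : U × E) ∈ spanTB H B (0, 1) := hUT 1 one_ne_zero rfl
  have := Submodule.add_mem _ h3 h2
  simpa using this

theorem spanT_eq_top (hG : IsBlockGroup U₁ H Γ) {Fz Mz : Submodule F (U × E)}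
    (hz : IsSeparator H Fz Mz) {i : ℕ}
    (hi₁ : i ≤ Module.finrank F U₁) (hi : i < Module.finrank F U) (ht : ∀ j < i, ProjTrans H j)
    {A : Submodule F (U × E)}
    (hA : Module.finrank F A = i) : spanT H A = ⊤ := by
  obtain _ | i := i
  · rw [Submodule.finrank_eq_zero] at hA
    rw [hA, hG.spanT_bot]
  have hkey : ∀ B ≤ A, Module.finrank F B = i → spanT H A ⊔ B = ⊤ := by
    intro B hBA hB
    obtain ⟨v, hvA, hvB⟩ := SetLike.exists_of_lt (lt_of_le_of_ne hBA (by rintro rfl; omega))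
    have h1 := hG.spanTB_eq_top hz hi₁ hi (fun j hj => ht j (by omega)) hB hvB
    have h2 : B ⊔ Submodule.span F {v} = A := by
      refine Submodule.eq_of_le_of_finrank_eq (sup_le hBA (by simpa using hvA)) ?_
      rw [Submodule.finrank_sup_span_singleton hvB, hB, hA]
    rwa [spanTB, h2] at h1
  by_cases hle : A ≤ spanT H A
  · obtain ⟨B, hBA, hB⟩ := A.exists_le_finrank_eq (j := i) (by omega)
    have := hkey B hBA hB
    rwa [sup_eq_left.2 (hBA.trans hle)] at this
  · exfalso
    obtain ⟨a, haA, haT⟩ := SetLike.not_le_iff_exists.1 hle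
    have hlt : Module.finrank F ↥(A ⊓ spanT H A) < i + 1 := by
      rw [← hA]
      exact Submodule.finrank_lt_finrank_of_lt (lt_of_le_of_ne inf_le_left fun h =>
        haT (inf_eq_left.1 h haA))
    have hext : ∀ j, ∀ C : Submodule F (U × E), C ≤ A → Module.finrank F C + j = i →
        ∃ B, C ≤ B ∧ B ≤ A ∧ Module.finrank F B = i := by
      intro j
      induction j with
      | zero => exact fun C hC hj => ⟨C, le_rfl, hC, hj⟩
      | succ j ih =>
        intro C hC hj
        obtain ⟨v, hvA, hvC⟩ := SetLike.exists_of_lt (lt_of_le_of_ne hC (by rintro rfl; omega))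
        obtain ⟨B, h1, h2, h3⟩ := ih (C ⊔ Submodule.span F {v})
          (sup_le hC (by simpa using hvA))
          (by rw [Submodule.finrank_sup_span_singleton hvC]; omega)
        exact ⟨B, le_sup_left.trans h1, h2, h3⟩
    obtain ⟨B, hCB, hBA, hB⟩ := hext (i - Module.finrank F ↥(A ⊓ spanT H A)) (A ⊓ spanT H A)
      inf_le_left (by omega)
    have h1 := hkey B hBA hB
    have h2 : A ≤ B := by
      intro x hx
      obtain ⟨t, ht', b, hb, rfl⟩ := Submodule.mem_sup.1 (h1 ▸ Submodule.mem_top : x ∈ _)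
      have h3 : t ∈ A := by
        have := A.sub_mem hx (hBA hb)
        simpa using this
      exact B.add_mem (hCB ⟨h3, ht'⟩) hb
    have := Submodule.finrank_mono h2
    omega

theorem projTrans (hG : IsBlockGroup U₁ H Γ) {Fz Mz : Submodule F (U × E)}
    (hz : IsSeparator H Fz Mz) (i : ℕ)
    (hi₁ : i ≤ Module.finrank F U₁) (hi : i < Module.finrank F U) : ProjTrans H i := by
  induction i using Nat.strong_induction_on with
  | _ i ih =>
    have ht : ∀ j < i, ProjTrans H j := fun j hj => ih j hj (by omega) (by omega)
    obtain ⟨A, hAU, hA⟩ := (inlSub E U₁).exists_le_finrank_eq (j := i)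
      (by rw [finrank_inlSub]; omega)
    intro A' hA' v hv v' hv'
    obtain ⟨h, hh, rfl⟩ := ProjTrans.exists_map_eq ht hA hA'
    have hm : ∀ x, x ∉ A.map (h : (U × E) →ₗ[F] (U × E)) → h.symm x ∉ A := by
      intro x hx hxA
      exact hx ⟨_, hxA, h.apply_symm_apply x⟩
    have hT := hG.spanT_eq_top hz hi₁ hi ht hA
    obtain ⟨g, hg, hgA, c, hc, he⟩ := hG.exists_smul_eq
      (fun a ha => (mem_inlSub.1 (hAU ha)).2) (fun a ha => (mem_inlSub.1 (hAU ha)).1)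
      (hG.capS_eq hz hi ht hA).le (hT ▸ Submodule.mem_top) (hm v hv) (hT ▸ Submodule.mem_top)
      (hm v' hv')
    refine ⟨h * g * h⁻¹, H.mul_mem (H.mul_mem hh hg) (H.inv_mem hh), ?_, c, hc, ?_⟩
    · rintro _ ⟨a, ha, rfl⟩
      change h (g (h.symm (h a))) = h a
      rw [h.symm_apply_apply, hgA a ha]
    · change h (g (h.symm v)) = c • v'
      rw [he, map_smul, h.apply_symm_apply]

end IsBlockGroup

end Block

section Commutator

variable {F U : Type*} [Field F] [AddCommGroup U] [Module F U]

theorem LinearEquiv.commutator_apply_eq {f₁ f₂ : U ≃ₗ[F] U} {β : Module.Dual F U} {b : U}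
    (h : ∀ x, f₁ (f₂ x) = f₂ (f₁ x) + β (f₂ (f₁ x)) • b) (y : U) :
    (f₁ * f₂ * f₁⁻¹ * f₂⁻¹) y = y + β y • b := by
  have h1 := h (f₁.symm (f₂.symm y))
  rw [f₁.apply_symm_apply, f₂.apply_symm_apply] at h1
  exact h1

theorem exists_commutator_eq_transvection [Finite F] [Finite U] {M : Subgroup (U ≃ₗ[F] U)}
    (hU : 3 ≤ Module.finrank F U)
    (hM : ∀ (α : Module.Dual F U) (u a : U), α u = 1 → α a = 0 → ∃ f ∈ M, ∃ c : F, c ≠ 0 ∧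
      ∀ x, f x = x + α x • ((c - 1) • u + c • a)) :
    ∃ f₁ ∈ M, ∃ f₂ ∈ M, ∃ β : Module.Dual F U, β ≠ 0 ∧ ∃ b : U, b ≠ 0 ∧ β b = 0 ∧
      ∀ x, (f₁ * f₂ * f₁⁻¹ * f₂⁻¹) x = x + β x • b := by
  classical
  by_cases hcase : ∃ (α : Module.Dual F U) (u a : U), α u = 1 ∧ α a = 0 ∧ ∃ f ∈ M, ∃ c : F,
      c ≠ 0 ∧ c ≠ 1 ∧ ∀ x, f x = x + α x • ((c - 1) • u + c • a)
  · obtain ⟨α, u, a, hu, ha, f, hf, c, hc, hc1, hfx⟩ := hcase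
    have hα : α ≠ 0 := by rintro rfl; simp at hu
    obtain ⟨b₀, hb₀, hαb, t, ht, htx⟩ : ∃ b₀ : U, b₀ ≠ 0 ∧ α b₀ = 0 ∧ ∃ t ∈ M, ∀ x,
        t x = x + α x • b₀ := by
      let _ : Fintype F := Fintype.ofFinite F
      let _ : Fintype U := Fintype.ofFinite U
      choose g hg d hd hgx using fun a : LinearMap.ker α => hM α u a hu a.2
      have hcard : Fintype.card F < Fintype.card (LinearMap.ker α) := by
        rw [← Nat.card_eq_fintype_card, ← Nat.card_eq_fintype_card,
          Module.natCard_eq_pow_finrank (K := F) (V := LinearMap.ker α)]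
        have h1 := Module.Dual.finrank_ker_add_one_of_ne_zero hα
        have hq : 2 ≤ Nat.card F := Finite.one_lt_card
        calc Nat.card F = Nat.card F ^ 1 := (pow_one _).symm
          _ < _ := Nat.pow_lt_pow_right hq (by omega)
      obtain ⟨a₁, a₂, hne, heq⟩ := Fintype.exists_ne_map_eq_of_card_lt d hcard
      refine ⟨a₂ - a₁, fun h => hne (Subtype.ext (sub_eq_zero.1 h).symm), by simp, g a₂ * (g a₁)⁻¹,
        M.mul_mem (hg _) (M.inv_mem (hg _)), fun y => ?_⟩
      obtain ⟨x, rfl⟩ := (g a₁).surjective y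
      have h1 : (g a₂ * (g a₁)⁻¹) ((g a₁) x) = g a₂ x := by
        change g a₂ ((g a₁).symm (g a₁ x)) = _
        rw [LinearEquiv.symm_apply_apply]
      have ha₁ : α a₁ = 0 := a₁.2
      rw [h1, hgx, hgx, heq]
      simp only [map_add, map_smul, smul_eq_mul, hu, ha₁]
      module
    refine ⟨f, hf, t, ht, α, hα, (c⁻¹ - 1) • b₀, smul_ne_zero ?_ hb₀, by simp [hαb],
      LinearEquiv.commutator_apply_eq fun x => ?_⟩
    · rw [sub_ne_zero]
      intro h
      exact hc1 (inv_eq_one.1 h)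
    · simp only [hfx, htx, map_add, map_smul, smul_eq_mul, hu, ha, hαb]
      have : (α x + α x * ((c - 1) * 1 + c * 0) + (α x + α x * ((c - 1) * 1 + c * 0)) * 0) •
          (c⁻¹ - 1) • b₀ = (α x * (1 - c)) • b₀ := by
        rw [smul_smul]
        congr 1
        field_simp
        ring
      rw [this]
      module
  · push Not at hcase
    have hM' : ∀ (α : Module.Dual F U) (u a : U), α u = 1 → α a = 0 → ∃ f ∈ M,
        ∀ x, f x = x + α x • a := by
      intro α u a hu ha
      obtain ⟨f, hf, c, hc, hfx⟩ := hM α u a hu ha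
      by_cases hc1 : c = 1
      · refine ⟨f, hf, fun x => ?_⟩
        rw [hfx, hc1]
        module
      · obtain ⟨x, hx⟩ := hcase α u a hu ha f hf c hc hc1
        exact absurd (hfx x) hx
    have : Nontrivial U := Module.nontrivial_of_finrank_pos (R := F) (by omega)
    obtain ⟨x₀, hx₀⟩ := exists_ne (0 : U)
    have key : ∀ (p : Submodule F U) (v : U), v ∉ p →
        ∃ f : Module.Dual F U, f v = 1 ∧ ∀ x ∈ p, f x = 0 := by
      intro p v hv
      obtain ⟨f, hfv, hfp⟩ := Submodule.exists_le_ker_of_notMem hv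
      refine ⟨(f v)⁻¹ • f, by simp [hfv], fun x hx => ?_⟩
      have : f x = 0 := hfp hx
      simp [this]
    obtain ⟨β, hβ, -⟩ := key ⊥ x₀ (by simpa using hx₀)
    have hβ0 : β ≠ 0 := by rintro rfl; simp at hβ
    have hker := Module.Dual.finrank_ker_add_one_of_ne_zero hβ0
    obtain ⟨e₁, he₁, he₁0⟩ := (LinearMap.ker β).exists_mem_ne_zero_of_ne_bot (by
      intro h
      rw [h, finrank_bot] at hker
      omega)
    have hlt : F ∙ e₁ < LinearMap.ker β := by
      refine lt_of_le_of_ne ((Submodule.span_singleton_le_iff_mem _ _).2 he₁) fun h => ?_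
      rw [← h, finrank_span_singleton he₁0] at hker
      omega
    obtain ⟨e₂, he₂, he₂'⟩ := SetLike.exists_of_lt hlt
    obtain ⟨α, hα, hα0⟩ := key _ e₂ he₂'
    have hαe₁ : α e₁ = 0 := hα0 _ (Submodule.mem_span_singleton_self _)
    have hβe₁ : β e₁ = 0 := he₁
    have hβe₂ : β e₂ = 0 := he₂
    obtain ⟨t₁, ht₁, h₁⟩ := hM' α e₂ e₁ hα hαe₁
    obtain ⟨t₂, ht₂, h₂⟩ := hM' β x₀ e₂ hβ hβe₂
    refine ⟨t₁, ht₁, t₂, ht₂, β, hβ0, e₁, he₁0, hβe₁, LinearEquiv.commutator_apply_eq fun x => ?_⟩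
    simp only [h₁, h₂, map_add, map_smul, smul_eq_mul, hα, hβe₁, hβe₂]
    module

end Commutator

section PrimitivePrime

theorem Nat.dvd_of_prime_dvd_pow_sub_one {r q m t : ℕ} (hm : 0 < m) (hr : r ∣ q ^ m - 1)
    (hmin : ∀ j, 0 < j → j < m → ¬ r ∣ q ^ j - 1) (ht : r ∣ q ^ t - 1) : m ∣ t := by
  have h1 : r ∣ q ^ (Nat.gcd m t) - 1 := by
    rw [← Nat.pow_sub_one_gcd_pow_sub_one]
    exact Nat.dvd_gcd hr ht
  have h2 : 0 < Nat.gcd m t := Nat.gcd_pos_of_pos_left _ hm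
  have h3 : Nat.gcd m t ≤ m := Nat.gcd_le_left _ hm
  have h4 : Nat.gcd m t = m := by
    by_contra h
    exact hmin _ h2 (lt_of_le_of_ne h3 h) h1
  rw [← h4]
  exact Nat.gcd_dvd_right m t

theorem Nat.not_dvd_of_prime_dvd_pow_sub_one {r q m : ℕ} (hr : r.Prime) (hq : 2 ≤ q) (hm : 0 < m)
    (hdvd : r ∣ q ^ m - 1) : ¬ r ∣ q := by
  intro h
  have h1 : r ∣ q ^ m := h.trans (dvd_pow_self q hm.ne')
  have h2 : 1 ≤ q ^ m := Nat.one_le_pow _ _ (by omega)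
  have h3 := Nat.dvd_sub h1 hdvd
  rw [Nat.sub_sub_self h2] at h3
  exact hr.one_lt.ne' (Nat.dvd_one.1 h3)

theorem Nat.factorization_prod_pow_sub_pow {r q m n : ℕ} (hr : r.Prime) (hq : 2 ≤ q) (hm : 0 < m)
    (hmn : m ≤ n) (hn : n < 2 * m) (hdvd : r ∣ q ^ m - 1)
    (hmin : ∀ j, 0 < j → j < m → ¬ r ∣ q ^ j - 1) :
    (∏ i : Fin n, (q ^ n - q ^ (i : ℕ))).factorization r = (q ^ m - 1).factorization r := by
  have hrq := Nat.not_dvd_of_prime_dvd_pow_sub_one hr hq hm hdvd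
  have hpos : ∀ i : Fin n, q ^ n - q ^ (i : ℕ) ≠ 0 := fun i =>
    Nat.sub_ne_zero_of_lt (Nat.pow_lt_pow_right (by omega) i.2)
  have hfac : ∀ i : Fin n, (q ^ n - q ^ (i : ℕ)).factorization r =
      (q ^ (n - i) - 1).factorization r := by
    intro i
    have h1 : q ^ n - q ^ (i : ℕ) = q ^ (i : ℕ) * (q ^ (n - i) - 1) := by
      rw [Nat.mul_sub, ← pow_add, mul_one]
      congr 2
      omega
    have h2 : q ^ (n - (i : ℕ)) - 1 ≠ 0 := by
      intro h
      apply hpos i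
      rw [h1, h, mul_zero]
    rw [h1, Nat.factorization_mul (pow_ne_zero _ (by omega)) h2, Nat.factorization_pow]
    simp [Nat.factorization_eq_zero_of_not_dvd hrq]
  rw [Nat.factorization_prod fun i _ => hpos i, Finsupp.finsetSum_apply]
  rw [Finset.sum_eq_single (⟨n - m, by omega⟩ : Fin n)]
  · rw [hfac]
    congr 3
    change q ^ (n - (n - m)) = _
    congr 1
    omega
  · intro i _ hi
    rw [hfac]
    refine Nat.factorization_eq_zero_of_not_dvd fun h => hi ?_
    have h1 := Nat.dvd_of_prime_dvd_pow_sub_one hm hdvd hmin h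
    obtain ⟨c, hc⟩ := h1
    have h3 := i.2
    have h2 : c = 1 := by
      rcases c with _ | _ | c
      · omega
      · rfl
      · rw [mul_add] at hc
        nlinarith [Nat.sub_le n i, Nat.zero_le (m * c)]
    ext
    simp only
    rw [h2] at hc
    omega
  · simp

theorem Nat.card_linearEquiv_self {F V : Type*} [Field F] [Finite F] [AddCommGroup V] [Module F V]
    [FiniteDimensional F V] : Nat.card (V ≃ₗ[F] V) =
      ∏ i : Fin (Module.finrank F V),
        (Nat.card F ^ (Module.finrank F V) - Nat.card F ^ (i : ℕ)) := by
  let _ : Fintype F := Fintype.ofFinite F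
  rw [Nat.card_eq_fintype_card (α := F), ← Matrix.card_GL_field (𝔽 := F)]
  let e : V ≃ₗ[F] (Fin (Module.finrank F V) → F) :=
    LinearEquiv.ofFinrankEq _ _ (by simp)
  exact Nat.card_congr ((LinearMap.GeneralLinearGroup.generalLinearEquiv F V).symm.trans
    ((LinearMap.GeneralLinearGroup.congrLinearEquiv e).trans
      Matrix.GeneralLinearGroup.toLin.symm)).toEquiv

theorem exists_conj_eq_zpow_of_orderOf {G : Type*} [Group G] [Finite G] {r : ℕ} [Fact r.Prime]
    (K : Subgroup G) {x y : G} (hx : x ∈ K) (hy : y ∈ K)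
    (hox : orderOf x = r ^ (Nat.card G).factorization r) (hoy : orderOf y = orderOf x) :
    ∃ k ∈ K, ∃ j : ℤ, k * y * k⁻¹ = x ^ j := by
  have hr : r.Prime := Fact.out
  have hdvd : Nat.card K ∣ Nat.card G := Subgroup.card_subgroup_dvd_card K
  have hK : (Nat.card K).factorization r = (Nat.card G).factorization r := by
    refine le_antisymm
      ((Nat.factorization_le_iff_dvd Nat.card_pos.ne' Nat.card_pos.ne').2 hdvd r) ?_
    rw [← hr.pow_dvd_iff_le_factorization Nat.card_pos.ne', ← hox]
    exact Subgroup.orderOf_dvd_natCard K hx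
  have hcard : ∀ z : K, orderOf (z : G) = orderOf x →
      Nat.card (Subgroup.zpowers z) = r ^ (Nat.card K).factorization r := by
    intro z hz
    rw [Nat.card_zpowers, hK, ← hox, ← hz, Subgroup.orderOf_coe]
  let P : Sylow r K := Sylow.ofCard _ (hcard ⟨x, hx⟩ rfl)
  let Q : Sylow r K := Sylow.ofCard _ (hcard ⟨y, hy⟩ hoy)
  obtain ⟨k, hk⟩ := MulAction.exists_smul_eq K Q P
  have h1 : (⟨y, hy⟩ : K) ∈ Q := Subgroup.mem_zpowers (⟨y, hy⟩ : K)
  have h2 : MulAut.conj k ⟨y, hy⟩ ∈ k • Q := by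
    rw [Sylow.smul_def]
    exact Subgroup.smul_mem_pointwise_smul _ _ _ h1
  rw [hk] at h2
  obtain ⟨j, hj⟩ := Subgroup.mem_zpowers_iff.1 (show _ ∈ Subgroup.zpowers (⟨x, hx⟩ : K) from h2)
  refine ⟨k, k.2, j, ?_⟩
  have := congrArg (Subtype.val) hj
  simpa using this.symm

theorem Algebra.adjoin_eq_top_of_prime_dvd_orderOf {F E : Type*} [Field F] [Finite F] [Field E]
    [Finite E] [Algebra F E] {r : ℕ}
    (hmin : ∀ j, 0 < j → j < Module.finrank F E → ¬ r ∣ Nat.card F ^ j - 1) (e : Eˣ)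
    (he : r ∣ orderOf e) : Algebra.adjoin F {(e : E)} = ⊤ := by
  rw [← IntermediateField.adjoin_simple_toSubalgebra_of_isAlgebraic
    (Algebra.IsAlgebraic.isAlgebraic (R := F) (e : E))]
  have h0 : (e : E) ∈ IntermediateField.adjoin F {(e : E)} :=
    IntermediateField.mem_adjoin_simple_self F (e : E)
  let K := IntermediateField.adjoin F {(e : E)}
  have hpos : 0 < Module.finrank F K := Module.finrank_pos
  have hle : Module.finrank F K ≤ Module.finrank F E := Submodule.finrank_le K.toSubmodule
  have hdvd : r ∣ Nat.card F ^ Module.finrank F K - 1 := by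
    refine he.trans (orderOf_dvd_of_pow_eq_one ?_)
    rw [← Module.natCard_eq_pow_finrank (K := F) (V := K)]
    let _ : Fintype K := Fintype.ofFinite K
    have h1 : (⟨e, h0⟩ : K) ≠ 0 := fun h => e.ne_zero (congrArg Subtype.val h)
    have h2 := FiniteField.pow_card_sub_one_eq_one _ h1
    rw [← Nat.card_eq_fintype_card] at h2
    ext
    have := congrArg Subtype.val h2
    simpa using this
  have heq : Module.finrank F K = Module.finrank F E := by
    by_contra h
    exact hmin _ hpos (lt_of_le_of_ne hle h) hdvd
  have : K = ⊤ := by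
    refine IntermediateField.eq_of_le_of_finrank_eq le_top ?_
    rw [heq, IntermediateField.finrank_top']
  change K.toSubalgebra = _
  rw [this, IntermediateField.top_toSubalgebra]

theorem exists_unit_orderOf_eq_ordProj (E : Type*) [Field E] [Finite E] (r : ℕ) :
    ∃ e : Eˣ, orderOf e = r ^ (Nat.card E - 1).factorization r := by
  let _ : Fintype E := Fintype.ofFinite E
  obtain ⟨g, hg⟩ := IsCyclic.exists_ofOrder_eq_natCard (α := Eˣ)
  have hc : Nat.card Eˣ = Nat.card E - 1 := Nat.card_units E
  refine ⟨g ^ (ordCompl[r] (Nat.card Eˣ)), ?_⟩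
  have hpos : 0 < Nat.card Eˣ := Nat.card_pos
  rw [orderOf_pow_of_dvd, hg, hc]
  · exact Nat.div_div_self (Nat.ordProj_dvd _ _) (by omega)
  · exact (Nat.ordCompl_pos _ hpos.ne').ne'
  · rw [hg]
    exact Nat.ordCompl_dvd _ _

end PrimitivePrime

theorem orderOf_conj_eq {G : Type*} [Group G] (g x : G) : orderOf (g * x * g⁻¹) = orderOf x :=
  orderOf_injective (MulAut.conj g).toMonoidHom (MulAut.conj g).injective x

section Transvection

variable {F U E : Type*} [Field F] [AddCommGroup U] [Module F U] [Field E] [Algebra F E]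

/-- `mulBlock` as a group homomorphism. -/
def mulBlockHom (F U E : Type*) [Field F] [AddCommGroup U] [Module F U] [Field E]
    [Algebra F E] : Eˣ →* ((U × E) ≃ₗ[F] (U × E)) where
  toFun γ := mulBlock F U γ
  map_one' := by ext v <;> simp
  map_mul' γ δ := by ext v <;> simp [mul_assoc]

@[simp] theorem mulBlockHom_apply (γ : Eˣ) (v : U × E) :
    mulBlockHom F U E γ v = (v.1, (γ : E) * v.2) := rfl

theorem mulBlockHom_injective : Function.Injective (mulBlockHom F U E) := by
  intro γ δ h
  have := congrArg (fun f => (f ((0, 1) : U × E)).2) h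
  ext
  simpa using this

theorem mulBlockHom_mem_of_coprime [Finite F] {H : Subgroup ((U × E) ≃ₗ[F] (U × E))} {e : Eˣ}
    (h : ∃ γ : Eˣ, mulBlockHom F U E γ ∈ H ∧ ∃ a : F, (e : E) = a • (γ : E))
    (hcop : (orderOf e).Coprime (Nat.card F - 1)) : mulBlockHom F U E e ∈ H := by
  obtain ⟨γ, hγ, a, ha⟩ := h
  let _ : Fintype F := Fintype.ofFinite F
  have ha0 : a ≠ 0 := by
    rintro rfl
    rw [zero_smul] at ha
    exact e.ne_zero ha
  have hpow : e ^ (Nat.card F - 1) = γ ^ (Nat.card F - 1) := by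
    ext
    rw [Units.val_pow_eq_pow_val, ha, smul_pow, Nat.card_eq_fintype_card,
      FiniteField.pow_card_sub_one_eq_one a ha0, one_smul, Units.val_pow_eq_pow_val]
  obtain ⟨m, hm⟩ := exists_pow_eq_self_of_coprime hcop.symm
  rw [← hm, hpow, map_pow, map_pow]
  exact H.pow_mem (H.pow_mem hγ _) _

theorem IsBlockGroup.exists_transvection [Finite F] [Finite U] [Finite E]
    {H : Subgroup ((U × E) ≃ₗ[F] (U × E))} {Γ : Set Eˣ} (hG : IsBlockGroup (⊤ : Submodule F U) H Γ)
    (hU : 3 ≤ Module.finrank F U) (ht : ProjTrans H (Module.finrank F U - 1)) {r : ℕ}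
    (hr : r.Prime) (hdvd : r ∣ Nat.card F ^ Module.finrank F E - 1)
    (hmin : ∀ j, 0 < j → j < Module.finrank F E → ¬ r ∣ Nat.card F ^ j - 1) :
    ∃ h ∈ H, ∃ φ : Module.Dual F (U × E), φ ≠ 0 ∧ ∃ b : U × E, b ≠ 0 ∧ φ b = 0 ∧
      ∀ v, h v = v + φ v • b := by
  have hq : 2 ≤ Nat.card F := Finite.one_lt_card
  have hm := hG.dim
  have : Fact r.Prime := ⟨hr⟩
  have hfinite : Finite ((U × E) ≃ₗ[F] (U × E)) := DFunLike.finite _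
  have hcardE : Nat.card E = Nat.card F ^ Module.finrank F E :=
    Module.natCard_eq_pow_finrank (K := F) (V := E)
  -- an element generating a Sylow `r`-subgroup
  obtain ⟨e, he⟩ := exists_unit_orderOf_eq_ordProj E r
  have heH : mulBlockHom F U E e ∈ H := by
    refine mulBlockHom_mem_of_coprime ?_ ?_
    · obtain ⟨h, hh, h1, a, ha, h2⟩ := hG.twist e e.ne_zero
      refine ⟨Units.mk0 (a • (e : E)) (smul_ne_zero ha e.ne_zero), ?_, a⁻¹, ?_⟩
      · convert hh using 1
        refine LinearEquiv.ext fun v => ?_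
        have hv : v = (v.1, 0) + (0, v.2) := by ext <;> simp
        conv_rhs => rw [hv]
        rw [map_add, h1 _ Submodule.mem_top, h2, mulBlockHom_apply, Units.val_mk0]
        ext <;> simp
      · rw [Units.val_mk0, smul_smul, inv_mul_cancel₀ ha, one_smul]
    · rw [he]
      refine Nat.Coprime.pow_left _ ((Nat.Prime.coprime_iff_not_dvd hr).2 ?_)
      have := hmin 1 one_pos (by omega)
      rwa [pow_one] at this
  have hcardG : (Nat.card ((U × E) ≃ₗ[F] (U × E))).factorization r =
      (Nat.card E - 1).factorization r := by
    have hfin : Module.finrank F (U × E) = Module.finrank F U + Module.finrank F E :=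
      Module.finrank_prod
    rw [Nat.card_linearEquiv_self, hcardE]
    exact Nat.factorization_prod_pow_sub_pow hr hq (by omega) (by omega) (by omega) hdvd hmin
  have hox : orderOf (mulBlockHom F U E e) = orderOf e :=
    orderOf_injective _ mulBlockHom_injective e
  -- the pointwise stabiliser of `U × 0` in `H`
  let K : Subgroup ((U × E) ≃ₗ[F] (U × E)) :=
    { carrier := {h | h ∈ H ∧ ∀ u : U, h (u, 0) = (u, 0)}
      mul_mem' := fun {a b} ha hb => ⟨H.mul_mem ha.1 hb.1, fun u => by
        rw [LinearEquiv.mul_apply, hb.2, ha.2]⟩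
      one_mem' := ⟨H.one_mem, fun u => rfl⟩
      inv_mem' := fun {a} ha => ⟨H.inv_mem ha.1, fun u => by
        change a.symm (u, 0) = _
        rw [LinearEquiv.symm_apply_eq, ha.2]⟩ }
  have hxK : mulBlockHom F U E e ∈ K := ⟨heH, fun u => by simp⟩
  let M : Subgroup (U ≃ₗ[F] U) :=
    { carrier := {f | ∃ κ ∈ H, ∀ u : U, κ (u, 0) = (f u, 0)}
      mul_mem' := fun {a b} ⟨κ, hκ, h⟩ ⟨κ', hκ', h'⟩ => ⟨κ * κ', H.mul_mem hκ hκ', fun u => by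
        rw [LinearEquiv.mul_apply, h', h]; rfl⟩
      one_mem' := ⟨1, H.one_mem, fun u => rfl⟩
      inv_mem' := fun {a} ⟨κ, hκ, h⟩ => ⟨κ⁻¹, H.inv_mem hκ, fun u => by
        change κ.symm (u, 0) = (a.symm u, 0)
        rw [LinearEquiv.symm_apply_eq, h, LinearEquiv.apply_symm_apply]⟩ }
  have hM : ∀ (α : Module.Dual F U) (u a : U), α u = 1 → α a = 0 → ∃ f ∈ M, ∃ c : F, c ≠ 0 ∧
      ∀ x, f x = x + α x • ((c - 1) • u + c • a) := by
    intro α u a hu ha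
    have hα : α ≠ 0 := by rintro rfl; simp at hu
    let A : Submodule F (U × E) := (LinearMap.ker α).map (LinearMap.inl F U E)
    have hA : Module.finrank F A = Module.finrank F U - 1 := by
      have h1 := Module.Dual.finrank_ker_add_one_of_ne_zero hα
      rw [← (Submodule.equivMapOfInjective _ LinearMap.inl_injective _).finrank_eq]
      omega
    have hnot : ∀ y : U, α y = 1 → ((y, 0) : U × E) ∉ A := by
      rintro y hy ⟨z, hz, hzy⟩
      have : z = y := congrArg Prod.fst hzy
      rw [← this] at hy
      exact one_ne_zero (hy.symm.trans hz)
    obtain ⟨κ, hκ, hfix, c, hc, hκu⟩ := ht A hA (u, 0) (hnot u hu) (u + a, 0)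
      (hnot _ (by rw [map_add, hu, ha, add_zero]))
    have hform : ∀ x : U, κ (x, 0) = (x + α x • ((c - 1) • u + c • a), 0) := by
      intro x
      have hx : ((x, 0) : U × E) = (x - α x • u, 0) + α x • (u, 0) := by
        ext <;> simp
      have hxA : ((x - α x • u, 0) : U × E) ∈ A :=
        ⟨x - α x • u, by simp [hu], rfl⟩
      rw [hx, map_add, map_smul, hfix _ hxA, hκu]
      ext
      · simp only [Prod.fst_add, Prod.smul_fst]
        module
      · simp
    let f₀ : U →ₗ[F] U := LinearMap.fst F U E ∘ₗ (κ : (U × E) →ₗ[F] (U × E)) ∘ₗ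
      LinearMap.inl F U E
    have hf₀ : ∀ x, κ (x, 0) = (f₀ x, 0) := by
      intro x
      have : f₀ x = (κ (x, 0)).1 := rfl
      rw [this, hform]
    have hinj : Function.Injective f₀ := by
      intro x y hxy
      have h1 : κ (x, 0) = κ (y, 0) := by rw [hf₀, hf₀, hxy]
      exact congrArg Prod.fst (κ.injective h1)
    refine ⟨LinearEquiv.ofInjectiveEndo f₀ hinj, ⟨κ, hκ, fun x => hf₀ x⟩, c, hc, fun x => ?_⟩
    have : f₀ x = (κ (x, 0)).1 := rfl
    rw [LinearEquiv.coe_ofInjectiveEndo, this, hform]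
  -- every element of `M` is induced by an element normalising the Sylow subgroup
  have hlift : ∀ f ∈ M, ∃ n ∈ H, (∀ u : U, n (u, 0) = (f u, 0)) ∧ ∃ j : ℤ,
      n * mulBlockHom F U E e * n⁻¹ = (mulBlockHom F U E e) ^ j := by
    rintro f ⟨κ, hκ, hκf⟩
    have hyK : κ * mulBlockHom F U E e * κ⁻¹ ∈ K := by
      refine ⟨H.mul_mem (H.mul_mem hκ heH) (H.inv_mem hκ), fun u => ?_⟩
      have h1 : κ⁻¹ (u, 0) = (f.symm u, 0) := by
        change κ.symm (u, 0) = _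
        rw [LinearEquiv.symm_apply_eq, hκf, LinearEquiv.apply_symm_apply]
      rw [LinearEquiv.mul_apply, LinearEquiv.mul_apply, h1, mulBlockHom_apply]
      simp only [mul_zero]
      rw [hκf, LinearEquiv.apply_symm_apply]
    obtain ⟨k, hk, j, hj⟩ := exists_conj_eq_zpow_of_orderOf K hxK hyK
      (by rw [hox, he, hcardG]) (orderOf_conj_eq _ _)
    refine ⟨k * κ, H.mul_mem hk.1 hκ, fun u => ?_, j, ?_⟩
    · rw [LinearEquiv.mul_apply, hκf, hk.2]
    · rw [← hj]
      group
  obtain ⟨f₁, hf₁, f₂, hf₂, β, hβ, b, hb, hβb, hcomm⟩ := exists_commutator_eq_transvection hU hM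
  obtain ⟨n₁, hn₁, hn₁f, j₁, hj₁⟩ := hlift f₁ hf₁
  obtain ⟨n₂, hn₂, hn₂f, j₂, hj₂⟩ := hlift f₂ hf₂
  set x := mulBlockHom F U E e with hx
  have hswap : ∀ (n n' : (U × E) ≃ₗ[F] (U × E)) (j j' : ℤ), n * x * n⁻¹ = x ^ j →
      n' * x * n'⁻¹ = x ^ j' → (n * n') * x * (n * n')⁻¹ = x ^ (j * j') := by
    intro n n' j j' h h'
    have : (n * n') * x * (n * n')⁻¹ = n * (n' * x * n'⁻¹) * n⁻¹ := by group
    rw [this, h', ← conj_zpow, h, zpow_mul]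
  have h12 := hswap n₁ n₂ j₁ j₂ hj₁ hj₂
  have h21 := hswap n₂ n₁ j₂ j₁ hj₂ hj₁
  rw [mul_comm j₂ j₁] at h21
  set z := n₁ * n₂ * n₁⁻¹ * n₂⁻¹ with hz
  have hzH : z ∈ H := H.mul_mem (H.mul_mem (H.mul_mem hn₁ hn₂) (H.inv_mem hn₁)) (H.inv_mem hn₂)
  have hzx : z * x ^ (j₁ * j₂) = x ^ (j₁ * j₂) * z := by
    have h3 : z = (n₁ * n₂) * (n₂ * n₁)⁻¹ := by rw [hz]; group
    rw [h3]
    nth_rewrite 1 [← h21]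
    rw [← h12]
    group
  set e' := e ^ (j₁ * j₂) with he'
  have hxe' : x ^ (j₁ * j₂) = mulBlockHom F U E e' := by rw [he', map_zpow]
  have hoe' : orderOf e' = orderOf e := by
    rw [← orderOf_injective _ (mulBlockHom_injective (F := F) (U := U)) e', ← hxe', ← h12,
      ← hox]
    exact orderOf_conj_eq _ _
  have hre' : r ∣ orderOf e' := by
    rw [hoe', he]
    refine dvd_pow_self r (Nat.pos_iff_ne_zero.1 ?_)
    refine hr.factorization_pos_of_dvd ?_ (by rw [hcardE]; exact hdvd)
    have : 1 < Nat.card E := Finite.one_lt_card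
    omega
  have hadj := Algebra.adjoin_eq_top_of_prime_dvd_orderOf hmin e' hre'
  have he1 : (e' : E) ≠ 1 := by
    intro h
    have : e' = 1 := Units.ext h
    rw [this, orderOf_one] at hre'
    exact hr.one_lt.ne' (Nat.dvd_one.1 hre')
  have hze : ∀ w : E, z (0, (e' : E) * w) = ((z (0, w)).1, (e' : E) * (z (0, w)).2) := by
    intro w
    rw [hxe'] at hzx
    have := congrArg (fun g => g ((0, w) : U × E)) hzx
    simpa [LinearEquiv.mul_apply] using this
  have hz1 : ∀ w : E, (z (0, w)).1 = 0 := by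
    intro w
    have hne : (e' : E) - 1 ≠ 0 := sub_ne_zero.2 he1
    have hw : ((0, w) : U × E) = (0, (e' : E) * (((e' : E) - 1)⁻¹ * w)) -
        (0, ((e' : E) - 1)⁻¹ * w) := by
      ext
      · simp
      · simp only [Prod.snd_sub]
        field_simp
    rw [hw, map_sub, hze]
    simp
  have hz2 : ∀ c w : E, (z (0, c * w)).2 = c * (z (0, w)).2 := by
    intro c
    have hc : c ∈ Algebra.adjoin F {(e' : E)} := hadj ▸ Algebra.mem_top
    induction hc using Algebra.adjoin_induction with
    | mem c hc =>
      rw [Set.mem_singleton_iff] at hc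
      subst hc
      intro w
      rw [hze]
    | algebraMap a =>
      intro w
      have : ((0, algebraMap F E a * w) : U × E) = a • (0, w) := by
        ext <;> simp [Algebra.smul_def]
      rw [this, map_smul, Prod.smul_snd, Algebra.smul_def]
    | add c d _ _ hc hd =>
      intro w
      have : ((0, (c + d) * w) : U × E) = (0, c * w) + (0, d * w) := by
        ext <;> simp [add_mul]
      rw [this, map_add, Prod.snd_add, hc, hd, add_mul]
    | mul c d _ _ hc hd =>
      intro w
      rw [mul_assoc, hc, hd, mul_assoc]
  set y := (z (0, 1)).2 with hy
  have hzw : ∀ w : E, z (0, w) = (0, y * w) := by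
    intro w
    refine Prod.ext (hz1 w) ?_
    have := hz2 w 1
    rw [mul_one] at this
    rw [this, hy, mul_comm]
  have hy0 : y ≠ 0 := by
    intro h
    have h1 : z (0, 1) = 0 := by rw [hzw, h, zero_mul]; rfl
    have h2 := (LinearEquiv.map_eq_zero_iff z).1 h1
    exact one_ne_zero (congrArg Prod.snd h2)
  have hzu : ∀ u : U, z (u, 0) = (u + β u • b, 0) := by
    have hinv : ∀ (n : (U × E) ≃ₗ[F] (U × E)) (f : U ≃ₗ[F] U), (∀ u : U, n (u, 0) = (f u, 0)) →
        ∀ u : U, n⁻¹ (u, 0) = (f⁻¹ u, 0) := by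
      intro n f h u
      change n.symm (u, 0) = (f.symm u, 0)
      rw [LinearEquiv.symm_apply_eq, h, LinearEquiv.apply_symm_apply]
    intro u
    rw [← hcomm u, hz]
    simp only [LinearEquiv.mul_apply]
    rw [hinv n₂ f₂ hn₂f, hinv n₁ f₁ hn₁f, hn₂f, hn₁f]
  have hzpow : ∀ (i : ℕ) (v : U × E), (z ^ i) v = (v.1 + (i : F) • β v.1 • b, y ^ i * v.2) := by
    intro i
    induction i with
    | zero => intro v; simp
    | succ i ih =>
      intro v
      have hv : ∀ v : U × E, z v = (v.1 + β v.1 • b, y * v.2) := by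
        intro v
        have : v = (v.1, 0) + (0, v.2) := by ext <;> simp
        conv_lhs => rw [this]
        rw [map_add, hzu, hzw]
        ext <;> simp
      rw [pow_succ', LinearEquiv.mul_apply, ih, hv]
      simp only [map_add, map_smul, hβb, smul_zero, add_zero]
      refine Prod.ext ?_ ?_
      · push_cast
        module
      · simp only
        ring
  refine ⟨z ^ (Nat.card E - 1), H.pow_mem hzH _, β ∘ₗ LinearMap.fst F U E, ?_,
    (-b, 0), ?_, ?_, fun v => ?_⟩
  · intro h
    apply hβ
    ext u
    have := LinearMap.congr_fun h ((u, 0) : U × E)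
    simpa using this
  · intro h
    exact hb (neg_eq_zero.1 (congrArg Prod.fst h))
  · simp [hβb]
  · have hyc : y ^ (Nat.card E - 1) = 1 := by
      let _ : Fintype E := Fintype.ofFinite E
      rw [Nat.card_eq_fintype_card]
      exact FiniteField.pow_card_sub_one_eq_one y hy0
    have hc : ((Nat.card E - 1 : ℕ) : F) = -1 := by
      have : 1 ≤ Nat.card E := Nat.card_pos
      have hF0 : (Nat.card F : F) = 0 := by
        let _ : Fintype F := Fintype.ofFinite F
        rw [Nat.card_eq_fintype_card]
        exact FiniteField.cast_card_eq_zero F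
      rw [Nat.cast_sub this, hcardE, Nat.cast_pow, hF0, zero_pow (by omega)]
      simp
    rw [hzpow, hyc, hc]
    refine Prod.ext ?_ ?_ <;> simp

end Transvection

section SquareZero

open Module

variable {F V : Type*} [Field F] [AddCommGroup V] [Module F V] [FiniteDimensional F V]
  {H : Subgroup (V ≃ₗ[F] V)}

/-- A commutator of two elements `1 + φ`, `1 + φ'` with `φ' φ = 0` and `φ φ'` of rank one is a
transvection. -/
theorem exists_transvection_of_comp_self_eq_zero {t : V ≃ₗ[F] V} (ht : t ∈ H) {φ : V →ₗ[F] V}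
    (hφt : ∀ v, t v = v + φ v) (hφφ : ∀ v, φ (φ v) = 0) (hφ : φ ≠ 0)
    (hrank : 2 * finrank F φ.range < finrank F V)
    (hp : ∀ j ≤ finrank F φ.range, ProjTrans H j) :
    ∃ h ∈ H, ∃ ψ : Dual F V, ψ ≠ 0 ∧ ∃ b : V, b ≠ 0 ∧ ψ b = 0 ∧ ∀ v, h v = v + ψ v • b := by
  obtain ⟨w, hw⟩ : ∃ w, φ w ≠ 0 := by
    by_contra! h
    exact hφ (LinearMap.ext h)
  have hpos : 0 < finrank F φ.range := by
    rw [Nat.pos_iff_ne_zero, Ne, Submodule.finrank_eq_zero, LinearMap.range_eq_bot]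
    exact hφ
  obtain ⟨k, hk⟩ := Nat.exists_eq_succ_of_ne_zero hpos.ne'
  obtain ⟨J, hJI, hJ, i₁, hi₁, hI⟩ := Submodule.exists_eq_sup_span_singleton hk
  have hi₁I : i₁ ∈ φ.range := hI ▸ Submodule.mem_sup_right (Submodule.mem_span_singleton_self _)
  have hker : ∀ x ∈ φ.range, φ x = 0 := by
    rintro _ ⟨v, rfl⟩
    exact hφφ v
  have hJw : ∀ x ∈ J, φ x = 0 := fun x hx => hker x (hJI hx)
  have hwJ : w ∉ J := fun h => hw (hJw w h)
  obtain ⟨y, hyk, hyI⟩ : ∃ y ∈ φ.ker, y ∉ φ.range := by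
    by_contra! h
    have h1 := Submodule.finrank_mono (show φ.ker ≤ φ.range from h)
    have h2 := φ.finrank_range_add_finrank_ker
    omega
  obtain ⟨g₁, hg₁, hg₁J, c, hc, hg₁i⟩ := hp k (by omega) J hJ i₁ hi₁ w hwJ
  have hmap : φ.range.map (g₁ : V →ₗ[F] V) = J ⊔ F ∙ w := by
    rw [hI, Submodule.map_sup_span_singleton, Submodule.map_eq_self_of_fixed hg₁J, hg₁i,
      Submodule.sup_span_smul _ hc]
  have hdim : finrank F ↥(J ⊔ F ∙ w) = finrank F φ.range := by
    rw [Submodule.finrank_sup_span_singleton hwJ, hJ, hk]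
  obtain ⟨g₂, hg₂, hg₂J, c', hc', hg₂y⟩ := hp _ le_rfl (J ⊔ F ∙ w) hdim (g₁ y)
    (fun h => hyI (by rw [← hmap] at h; exact Submodule.mem_map_equiv'.1 h)) i₁ (by
      intro h
      obtain ⟨a, ha, b, hb, hab⟩ := Submodule.mem_sup.1 h
      obtain ⟨d, rfl⟩ := Submodule.mem_span_singleton.1 hb
      have h1 := congrArg φ hab
      rw [map_add, hJw a ha, map_smul, hker _ hi₁I, zero_add] at h1
      have hd : d = 0 := (smul_eq_zero.1 h1).resolve_right hw
      rw [hd, zero_smul, add_zero] at hab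
      exact hi₁ (hab ▸ ha))
  set g := g₂ * g₁ with hg
  have hgH : g ∈ H := H.mul_mem hg₂ hg₁
  have hgJ : ∀ x ∈ J, g x = x := fun x hx => by
    rw [hg, LinearEquiv.mul_apply, hg₁J x hx, hg₂J x (Submodule.mem_sup_left hx)]
  have hgi : g i₁ = c • w := by
    rw [hg, LinearEquiv.mul_apply, hg₁i, map_smul,
      hg₂J w (Submodule.mem_sup_right (Submodule.mem_span_singleton_self _))]
  have hgy : g y = c' • i₁ := hg₂y
  -- `φ (g x)` for `x` in the range of `φ`
  have hφg : ∀ x ∈ φ.range, φ (g x) ∈ F ∙ φ w := by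
    intro x hx
    rw [hI] at hx
    obtain ⟨a, ha, b, hb, rfl⟩ := Submodule.mem_sup.1 hx
    obtain ⟨d, rfl⟩ := Submodule.mem_span_singleton.1 hb
    rw [map_add, hgJ a ha, map_smul, hgi, map_add, hJw a ha, map_smul, map_smul, zero_add]
    exact Submodule.smul_mem _ _ (Submodule.smul_mem _ _ (Submodule.mem_span_singleton_self _))
  have hφ'φ : ∀ x ∈ φ.range, φ (g.symm x) = 0 := by
    intro x hx
    rw [hI] at hx
    obtain ⟨a, ha, b, hb, rfl⟩ := Submodule.mem_sup.1 hx
    obtain ⟨d, rfl⟩ := Submodule.mem_span_singleton.1 hb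
    have h1 : g.symm a = a := by rw [LinearEquiv.symm_apply_eq, hgJ a ha]
    have h2 : g.symm i₁ = c'⁻¹ • y := by
      rw [LinearEquiv.symm_apply_eq, map_smul, hgy, smul_smul, inv_mul_cancel₀ hc', one_smul]
    rw [map_add, map_smul, h1, h2, map_add, hJw a ha, map_smul, map_smul,
      LinearMap.mem_ker.1 hyk, smul_zero, smul_zero, zero_add]
  let φ' : V →ₗ[F] V := (g : V →ₗ[F] V) ∘ₗ φ ∘ₗ (g.symm : V →ₗ[F] V)
  have hφ' : ∀ v, φ' v = g (φ (g.symm v)) := fun v => rfl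
  set t' := g * t * g⁻¹ with ht'
  have ht'H : t' ∈ H := H.mul_mem (H.mul_mem hgH ht) (H.inv_mem hgH)
  have ht'v : ∀ v, t' v = v + φ' v := by
    intro v
    change g (t (g.symm v)) = _
    rw [hφt, map_add, g.apply_symm_apply, hφ']
  have h1 : ∀ v, φ' (φ v) = 0 := fun v => by rw [hφ', hφ'φ _ ⟨v, rfl⟩, map_zero]
  have h2 : ∀ v, φ' (φ' v) = 0 := fun v => by
    rw [hφ', hφ', g.symm_apply_apply, hφφ, map_zero]
  obtain ⟨f, hf⟩ : ∃ f : Dual F V, f (φ w) = 1 := Module.Projective.exists_dual_eq_one F hw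
  let ψ : Dual F V := f ∘ₗ φ ∘ₗ φ'
  have hψ : ∀ v, φ (φ' v) = ψ v • φ w := by
    intro v
    obtain ⟨d, hd⟩ := Submodule.mem_span_singleton.1 (hφg (φ (g.symm v)) ⟨_, rfl⟩)
    have : ψ v = d := by
      change f (φ (φ' v)) = d
      rw [hφ', ← hd, map_smul, hf, smul_eq_mul, mul_one]
    rw [this, hd, hφ']
  refine ⟨t * t' * t⁻¹ * t'⁻¹, H.mul_mem (H.mul_mem (H.mul_mem ht ht'H) (H.inv_mem ht))
    (H.inv_mem ht'H), ψ, ?_, φ w, hw, ?_, ?_⟩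
  · intro h0
    obtain ⟨x, hx⟩ := hi₁I
    have h3 := hψ (g x)
    rw [h0, hφ', g.symm_apply_apply, hx, hgi, map_smul, LinearMap.zero_apply, zero_smul] at h3
    exact (smul_ne_zero hc hw) h3
  · change f (φ (φ' (φ w))) = 0
    rw [h1, map_zero, map_zero]
  · refine fun v => LinearEquiv.commutator_apply_eq (β := ψ) (b := φ w) (fun x => ?_) v
    have h3 : t' (t x) = x + φ x + φ' x := by
      rw [hφt, ht'v, map_add, h1]; abel
    have h4 : t (t' x) = x + φ x + φ' x + φ (φ' x) := by
      rw [ht'v, hφt, map_add]; abel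
    rw [h3, h4, ← hψ]
    simp only [map_add, h1, h2, add_zero]

end SquareZero

section Separator

open Module

variable {F V : Type*} [Field F] [AddCommGroup V] [Module F V] [FiniteDimensional F V]
  {H : Subgroup (V ≃ₗ[F] V)}

theorem exists_transvection_of_fixed_compl {P M : Submodule F V} (hPM : IsCompl P M)
    (hP : P ≠ ⊥) (hM : 2 * finrank F M < finrank F V)
    (hp : ∀ j ≤ finrank F M, ProjTrans H j) {z : V ≃ₗ[F] V} (hz : z ∈ H)
    (hzP : ∀ v ∈ P, z v = v) (hzM : ∀ v ∈ M, z v ∈ M) (hzm : ∃ m ∈ M, z m ≠ m) :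
    ∃ h ∈ H, ∃ ψ : Dual F V, ψ ≠ 0 ∧ ∃ b : V, b ≠ 0 ∧ ψ b = 0 ∧ ∀ v, h v = v + ψ v • b := by
  obtain ⟨m, hm, hzm⟩ := hzm
  obtain ⟨v, hv, hv0⟩ := Submodule.exists_mem_ne_zero_of_ne_bot hP
  have hvM : v ∉ M := fun h => hv0 ((Submodule.disjoint_def.1 hPM.disjoint) v hv h)
  obtain ⟨h, hh, hhM, c, hc, hhv⟩ := hp _ le_rfl M rfl v hvM (v + m)
    (fun h => hvM ((Submodule.add_mem_iff_left _ hm).1 h))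
  have hzM' : ∀ v ∈ M, z.symm v ∈ M := by
    intro v hv
    have hle : M.map (z : V →ₗ[F] V) ≤ M := by
      rintro _ ⟨x, hx, rfl⟩
      exact hzM x hx
    have heq := Submodule.eq_of_le_of_finrank_eq hle (LinearEquiv.finrank_map_eq z M)
    rw [← heq] at hv
    obtain ⟨x, hx, rfl⟩ := hv
    simpa using hx
  have hzP' : ∀ v ∈ P, z.symm v = v := fun v hv => by
    rw [LinearEquiv.symm_apply_eq, hzP v hv]
  have hmod : ∀ v, z v - v ∈ M := by
    intro v
    obtain ⟨p, hp, m, hm, rfl⟩ := Submodule.mem_sup.1 (hPM.sup_eq_top ▸ Submodule.mem_top (x := v))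
    rw [map_add, hzP p hp]
    have : p + z m - (p + m) = z m - m := by abel
    rw [this]
    exact M.sub_mem (hzM m hm) hm
  have hmod' : ∀ v, z.symm v - v ∈ M := by
    intro v
    have := hmod (z.symm v)
    rw [z.apply_symm_apply] at this
    rw [← neg_sub]
    exact M.neg_mem this
  set t := z⁻¹ * h * z * h⁻¹ with ht
  have htv : ∀ x, t x = z.symm (h (z (h.symm x))) := fun x => rfl
  have hhM' : ∀ x ∈ M, h.symm x = x := fun x hx => by
    rw [LinearEquiv.symm_apply_eq, hhM x hx]
  have htM : ∀ x ∈ M, t x = x := by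
    intro x hx
    rw [htv, hhM' x hx, hhM _ (hzM x hx), z.symm_apply_apply]
  have htmod : ∀ x, t x - x ∈ M := by
    intro x
    have h1 : h (z (h.symm x)) - x ∈ M := by
      have h2 := hmod (h.symm x)
      have h3 := hhM _ h2
      rw [map_sub, h.apply_symm_apply] at h3
      rwa [h3]
    have h2 := hmod' (h (z (h.symm x)))
    rw [← htv] at h2
    have := M.add_mem h2 h1
    rwa [sub_add_sub_cancel] at this
  let φ : V →ₗ[F] V := (t : V →ₗ[F] V) - LinearMap.id
  have hφ : ∀ x, φ x = t x - x := fun x => rfl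
  have hrange : φ.range ≤ M := by
    rintro _ ⟨x, rfl⟩
    exact htmod x
  have hle := Submodule.finrank_mono hrange
  refine exists_transvection_of_comp_self_eq_zero (t := t) (φ := φ)
    (H.mul_mem (H.mul_mem (H.mul_mem (H.inv_mem hz) hh) hz) (H.inv_mem hh))
    (fun x => by rw [hφ]; abel) (fun x => ?_) ?_ (by omega) (fun j hj => hp j (hj.trans hle))
  · rw [hφ (φ x), htM (φ x) (htmod x), sub_self]
  · intro h0
    have h1 : φ (h v) = 0 := by rw [h0]; rfl
    rw [hφ, sub_eq_zero, htv, h.symm_apply_apply, hzP v hv, LinearEquiv.symm_apply_eq, hhv,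
      map_smul, map_add, hzP v hv] at h1
    have h2 := smul_right_injective V hc h1
    exact hzm (add_left_cancel h2).symm

end Separator

section Root

variable {F V : Type*} [Field F] [AddCommGroup V] [Module F V]

/-- The functionals `φ` such that `x ↦ x + φ x • v` is a transvection in `H`. -/
def rootGroup (H : Subgroup (V ≃ₗ[F] V)) (v : V) : AddSubgroup (Module.Dual F V) where
  carrier := {φ | φ v = 0 ∧ ∃ h ∈ H, ∀ x, h x = x + φ x • v}
  zero_mem' := ⟨rfl, 1, H.one_mem, fun x => by simp⟩
  add_mem' := by
    rintro φ ψ ⟨hφ, h, hh, hx⟩ ⟨hψ, g, hg, gx⟩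
    refine ⟨by simp [hφ, hψ], h * g, H.mul_mem hh hg, fun x => ?_⟩
    rw [LinearEquiv.mul_apply, gx, hx]
    simp only [map_add, map_smul, hφ, smul_zero, add_zero, LinearMap.add_apply]
    module
  neg_mem' := by
    rintro φ ⟨hφ, h, hh, hx⟩
    refine ⟨by simp [hφ], h⁻¹, H.inv_mem hh, fun x => ?_⟩
    change h.symm x = _
    rw [LinearEquiv.symm_apply_eq, hx]
    simp [hφ]

variable {H : Subgroup (V ≃ₗ[F] V)}

theorem mem_rootGroup {v : V} {φ : Module.Dual F V} :
    φ ∈ rootGroup H v ↔ φ v = 0 ∧ ∃ h ∈ H, ∀ x, h x = x + φ x • v := Iff.rfl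

theorem comp_mem_rootGroup {v : V} {φ : Module.Dual F V} {h : V ≃ₗ[F] V} (hh : h ∈ H)
    (hφ : φ ∈ rootGroup H (h v)) : φ ∘ₗ (h : V →ₗ[F] V) ∈ rootGroup H v := by
  obtain ⟨h0, g, hg, gx⟩ := hφ
  refine ⟨h0, h⁻¹ * g * h, H.mul_mem (H.mul_mem (H.inv_mem hh) hg) hh, fun x => ?_⟩
  change h.symm (g (h x)) = _
  rw [LinearEquiv.symm_apply_eq, gx]
  simp

theorem comp_symm_mem_rootGroup {v : V} {φ : Module.Dual F V} {h : V ≃ₗ[F] V} (hh : h ∈ H)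
    (hφ : φ ∈ rootGroup H v) : φ ∘ₗ (h.symm : V →ₗ[F] V) ∈ rootGroup H (h v) := by
  refine comp_mem_rootGroup (h := h⁻¹) (H.inv_mem hh) ?_
  change φ ∈ rootGroup H (h.symm (h v))
  rwa [h.symm_apply_apply]

theorem smul_mem_rootGroup {v : V} {φ : Module.Dual F V} {c : F} (hc : c ≠ 0)
    (hφ : φ ∈ rootGroup H (c • v)) : c • φ ∈ rootGroup H v := by
  obtain ⟨h0, g, hg, gx⟩ := hφ
  refine ⟨?_, g, hg, fun x => ?_⟩
  · rw [map_smul, smul_eq_mul, mul_eq_zero] at h0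
    simp [h0.resolve_left hc]
  · rw [gx, LinearMap.smul_apply, smul_smul, smul_eq_mul, mul_comm]

theorem ProjTrans.rootGroup_ne_bot (ht : ProjTrans H 0) {v w : V} (hv : v ≠ 0) (hw : w ≠ 0)
    (h : rootGroup H v ≠ ⊥) : rootGroup H w ≠ ⊥ := by
  obtain ⟨g, hg, -, c, hc, hgw⟩ := ht ⊥ (finrank_bot F V) w
    (by simpa using hw) v (by simpa using hv)
  obtain ⟨⟨φ, hφ⟩, hφ0⟩ := AddSubgroup.ne_bot_iff_exists_ne_zero.1 h
  intro hbot
  have h1 : c⁻¹ • φ ∈ rootGroup H (c • v) := by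
    refine smul_mem_rootGroup (inv_ne_zero hc) ?_
    rwa [smul_smul, inv_mul_cancel₀ hc, one_smul]
  rw [← hgw] at h1
  have h2 := comp_mem_rootGroup hg h1
  rw [hbot, AddSubgroup.mem_bot] at h2
  refine hφ0 (Subtype.ext (LinearMap.ext fun x => ?_))
  have h3 := LinearMap.congr_fun h2 (g.symm x)
  simpa [hc] using h3

theorem ProjTrans.exists_mem_rootGroup_apply_ne_zero (ht : ProjTrans H 1) {v : V} (hv : v ≠ 0)
    (h : rootGroup H v ≠ ⊥) {x : V} (hx : x ∉ F ∙ v) : ∃ φ ∈ rootGroup H v, φ x ≠ 0 := by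
  obtain ⟨⟨φ, hφ⟩, hφ0⟩ := AddSubgroup.ne_bot_iff_exists_ne_zero.1 h
  obtain ⟨x₀, hx₀⟩ : ∃ x₀, φ x₀ ≠ 0 := by
    by_contra! hcon
    exact hφ0 (Subtype.ext (LinearMap.ext hcon))
  have hx₀' : x₀ ∉ F ∙ v := by
    intro hmem
    obtain ⟨c, rfl⟩ := Submodule.mem_span_singleton.1 hmem
    exact hx₀ (by rw [map_smul, hφ.1, smul_zero])
  obtain ⟨g, hg, hgv, c, hc, hgx⟩ := ht (F ∙ v) (finrank_span_singleton hv) x hx x₀ hx₀'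
  have hgv' : g v = v := hgv v (Submodule.mem_span_singleton_self v)
  refine ⟨φ ∘ₗ (g : V →ₗ[F] V), comp_mem_rootGroup hg (by rwa [hgv']), ?_⟩
  change φ (g x) ≠ 0
  rw [hgx, map_smul]
  exact smul_ne_zero hc hx₀

end Root

theorem Subring.eq_top_of_card_lt {E : Type*} [Field E] [Finite E] (S : Subring E)
    (h : Nat.card E < Nat.card S * Nat.card S) : S = ⊤ := by
  by_contra hS
  obtain ⟨z, hz⟩ : ∃ z, z ∉ S := by
    by_contra! hcon
    exact hS (eq_top_iff.2 fun x _ => hcon x)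
  have hinv : ∀ x ∈ S, x⁻¹ ∈ S := by
    intro x hx
    by_cases hx0 : x = 0
    · rw [hx0, inv_zero]; exact S.zero_mem
    · obtain ⟨n, hn, hxn⟩ := (isOfFinOrder_of_finite (Units.mk0 x hx0)).exists_pow_eq_one
      have h1 : x ^ n = 1 := by simpa using congrArg Units.val hxn
      have h2 : x⁻¹ = x ^ (n - 1) := by
        rw [inv_eq_iff_eq_inv, ← mul_eq_one_iff_eq_inv₀ (pow_ne_zero _ hx0), ← pow_succ',
          Nat.sub_add_cancel hn, h1]
      rw [h2]
      exact S.pow_mem hx _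
  have hinj : Function.Injective (fun p : S × S => (p.1 : E) + p.2 * z) := by
    rintro ⟨a, b⟩ ⟨a', b'⟩ hab
    simp only at hab
    have hb : b = b' := by
      by_contra hne
      have hne' : (b : E) - b' ≠ 0 := fun h => hne (Subtype.ext (sub_eq_zero.1 h))
      apply hz
      have : z = ((a' : E) - a) * ((b : E) - b')⁻¹ := by
        rw [eq_mul_inv_iff_mul_eq₀ hne']
        linear_combination hab
      rw [this]
      exact S.mul_mem (S.sub_mem a'.2 a.2) (hinv _ (S.sub_mem b.2 b'.2))
    subst hb
    simpa using hab
  have := Nat.card_le_card_of_injective _ hinj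
  rw [Nat.card_prod] at this
  omega

section BlockRoot

variable {F U E : Type*} [Field F] [AddCommGroup U] [Module F U] [Field E] [Algebra F E]
  [Finite F] [Finite U] [Finite E] {U₁ : Submodule F U} {H : Subgroup ((U × E) ≃ₗ[F] (U × E))}
  {Γ : Set Eˣ}

omit [Finite U] in
theorem IsBlockGroup.subring_eq_top (hG : IsBlockGroup U₁ H Γ) (S : Subring E)
    (hS : ∀ γ : Eˣ, mulBlock F U γ ∈ H → (γ : E) ∈ S) : S = ⊤ := by
  refine Subring.eq_top_of_card_lt S ?_
  have h1 : Nat.card E ≤ Nat.card F * Nat.card S := by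
    have hle : Γ.ncard ≤ Nat.card S := by
      rw [← Nat.card_coe_set_eq]
      exact Nat.card_le_card_of_injective
        (fun γ : Γ => (⟨(γ : Eˣ), hS γ (hG.mem γ γ.2)⟩ : S))
        fun a b hab => Subtype.ext (Units.ext (congrArg Subtype.val hab))
    have hq : 1 < Nat.card F := Finite.one_lt_card
    have hs : 0 < Nat.card S := Nat.card_pos
    have := hG.card
    have h2 := Nat.mul_le_mul_right (Nat.card F - 1) hle
    obtain ⟨k, hk⟩ := Nat.exists_eq_add_of_lt hq
    rw [hk] at this h2 ⊢
    simp only [Nat.add_sub_cancel] at this h2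
    have h4 : (1 + k + 1) * Nat.card S = Nat.card S * (1 + k) + Nat.card S := by ring
    omega
  have h2 : Nat.card E = Nat.card F ^ Module.finrank F E :=
    Module.natCard_eq_pow_finrank (K := F) (V := E)
  have hq : 2 ≤ Nat.card F := Finite.one_lt_card
  have h3 : Nat.card F ^ 3 ≤ Nat.card E := by
    rw [h2]
    exact Nat.pow_le_pow_right (by omega) (by have := hG.dim; omega)
  set q := Nat.card F
  set s := Nat.card S
  have h4 : q * q ≤ s := by
    by_contra! hlt
    have : q * s < q * (q * q) := Nat.mul_lt_mul_of_pos_left hlt (by omega)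
    have h5 : q ^ 3 = q * (q * q) := by ring
    omega
  calc Nat.card E ≤ q * s := h1
    _ < s * s := Nat.mul_lt_mul_of_pos_right (by nlinarith) (by nlinarith)

omit [Finite U] in
theorem IsBlockGroup.mem_rootGroup_of_fst_eq_zero (hG : IsBlockGroup U₁ H Γ) {v : U × E}
    (hv : v.2 = 0) (h : ∃ φ ∈ rootGroup H v, ∃ w : E, φ (0, w) ≠ 0) {ψ : Module.Dual F (U × E)}
    (hψ : ∀ u : U, ψ (u, 0) = 0) : ψ ∈ rootGroup H v := by
  -- the functionals on `E` that extend to an element of the root group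
  let X : AddSubgroup (Module.Dual F E) :=
    (rootGroup H v).comap
      ((LinearMap.lcomp F F (LinearMap.snd F U E)).toAddMonoidHom)
  have hX : ∀ f : Module.Dual F E, f ∈ X ↔ f ∘ₗ LinearMap.snd F U E ∈ rootGroup H v :=
    fun f => Iff.rfl
  let S : Subring E :=
    { carrier := {c | ∀ f ∈ X, f ∘ₗ LinearMap.mulLeft F c ∈ X}
      zero_mem' := fun f _ => by
        convert X.zero_mem
        ext
        simp
      one_mem' := fun f hf => by
        convert hf
        ext
        simp
      add_mem' := fun {a b} ha hb f hf => by
        convert X.add_mem (ha f hf) (hb f hf)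
        ext
        simp [add_mul]
      mul_mem' := fun {a b} ha hb f hf => by
        convert hb _ (ha f hf) using 1
        ext
        simp
      neg_mem' := fun {a} ha f hf => by
        convert X.neg_mem (ha f hf)
        ext
        simp }
  have hvfix : ∀ γ : Eˣ, mulBlock F U γ v = v := fun γ => by
    rw [mulBlock_apply, hv, mul_zero, ← hv]
  have hS : S = ⊤ := by
    refine hG.subring_eq_top S fun γ hγ f hf => ?_
    rw [hX] at hf ⊢
    have h1 := comp_mem_rootGroup (v := v) hγ (by rwa [hvfix])
    convert h1 using 1
    exact LinearMap.ext fun x => rfl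
  have hXc : ∀ c : E, ∀ f ∈ X, f ∘ₗ LinearMap.mulLeft F c ∈ X := by
    intro c
    have : c ∈ S := hS ▸ Subring.mem_top c
    exact this
  obtain ⟨f, hfX, hf0⟩ : ∃ f ∈ X, f ≠ 0 := by
    obtain ⟨φ, hφ, w, hw⟩ := h
    obtain ⟨γ, hγ, hγ1⟩ : ∃ γ : Eˣ, mulBlock F U γ ∈ H ∧ (γ : E) ≠ 1 := by
      by_contra! hcon
      have h1 := hG.subring_eq_top (algebraMap F E).range fun γ hγ => by
        rw [hcon γ hγ]
        exact Subring.one_mem _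
      have h2 : Function.Surjective (algebraMap F E) := RingHom.range_eq_top.1 h1
      have h3 : Module.finrank F E ≤ 1 :=
        finrank_le_one (1 : E) fun w => by
          obtain ⟨c, rfl⟩ := h2 w
          exact ⟨c, by rw [Algebra.smul_def, mul_one]⟩
      have := hG.dim
      omega
    let f : Module.Dual F E := φ ∘ₗ LinearMap.inr F U E ∘ₗ LinearMap.mulLeft F (1 - (γ : E))
    refine ⟨f, ?_, ?_⟩
    · rw [hX]
      have h1 := (rootGroup H v).sub_mem hφ (comp_mem_rootGroup (v := v) hγ (by rwa [hvfix]))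
      convert h1 using 1
      refine LinearMap.ext fun x => ?_
      change φ (0, (1 - (γ : E)) * x.2) = φ x - φ (x.1, (γ : E) * x.2)
      rw [← map_sub]
      congr 1
      ext
      · simp
      · simp only [Prod.snd_sub]
        ring
    · intro h0
      have hne : (1 - (γ : E)) ≠ 0 := sub_ne_zero.2 hγ1.symm
      apply hw
      have h1 := LinearMap.congr_fun h0 ((1 - (γ : E))⁻¹ * w)
      change φ (0, (1 - (γ : E)) * ((1 - (γ : E))⁻¹ * w)) = 0 at h1
      rwa [mul_inv_cancel_left₀ hne] at h1
  -- all functionals on `E` are translates of `f`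
  let T : E →ₗ[F] Module.Dual F E :=
    { toFun := fun c => f ∘ₗ LinearMap.mulLeft F c
      map_add' := fun a b => by ext; simp [add_mul]
      map_smul' := fun a b => by ext; simp }
  have hTinj : Function.Injective T := by
    rw [injective_iff_map_eq_zero]
    intro c hc
    by_contra hc0
    apply hf0
    ext w
    have := LinearMap.congr_fun hc (c⁻¹ * w)
    change f (c * (c⁻¹ * w)) = 0 at this
    rwa [mul_inv_cancel_left₀ hc0] at this
  have hTsurj : Function.Surjective T :=
    (LinearMap.injective_iff_surjective_of_finrank_eq_finrank
      (Subspace.dual_finrank_eq (K := F) (V := E)).symm).1 hTinj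
  obtain ⟨c, hc⟩ := hTsurj (ψ ∘ₗ LinearMap.inr F U E)
  have h1 : ψ ∘ₗ LinearMap.inr F U E ∈ X := hc ▸ hXc c f hfX
  rw [hX] at h1
  convert h1 using 1
  refine LinearMap.ext fun x => ?_
  have hx : x = (x.1, 0) + (0, x.2) := by ext <;> simp
  conv_lhs => rw [hx, map_add, hψ, zero_add]
  rfl

end BlockRoot

section Transvections

open Module

variable {F U E : Type*} [Field F] [AddCommGroup U] [Module F U] [Field E] [Algebra F E]
  [Finite F] [Finite U] [Finite E] {U₁ : Submodule F U} {H : Subgroup ((U × E) ≃ₗ[F] (U × E))}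
  {Γ : Set Eˣ}

/-- If `H` contains one transvection, then it contains all of them. -/
theorem IsBlockGroup.forall_mem_rootGroup (hG : IsBlockGroup U₁ H Γ) (hU : 0 < finrank F U)
    (h0 : ProjTrans H 0) (h1 : ProjTrans H 1)
    (ht : ∃ h ∈ H, ∃ ψ : Dual F (U × E), ψ ≠ 0 ∧ ∃ b : U × E, b ≠ 0 ∧ ψ b = 0 ∧
      ∀ v, h v = v + ψ v • b) (ψ : Dual F (U × E)) (w : U × E) (hψw : ψ w = 0) :
    ψ ∈ rootGroup H w := by
  rcases eq_or_ne ψ 0 with rfl | hψ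
  · exact (rootGroup H w).zero_mem
  rcases eq_or_ne w 0 with rfl | hw
  · exact mem_rootGroup.2 ⟨map_zero ψ, 1, H.one_mem, fun x => by simp⟩
  obtain ⟨u, hu⟩ : ∃ u : U, u ≠ 0 := by
    have := Module.nontrivial_of_finrank_pos hU
    exact exists_ne 0
  set v : U × E := (u, 0) with hv
  have hv0 : v ≠ 0 := fun h => hu (congrArg Prod.fst h)
  have hbot : rootGroup H v ≠ ⊥ := by
    obtain ⟨h, hh, φ, hφ, b, hb, hφb, hx⟩ := ht
    refine h0.rootGroup_ne_bot hb hv0 fun hbot => hφ ?_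
    have : φ ∈ rootGroup H b := mem_rootGroup.2 ⟨hφb, h, hh, hx⟩
    rwa [hbot, AddSubgroup.mem_bot] at this
  obtain ⟨φ, hφ, hφ1⟩ := h1.exists_mem_rootGroup_apply_ne_zero hv0 hbot (x := (0, 1)) (by
    intro h
    obtain ⟨c, hc⟩ := Submodule.mem_span_singleton.1 h
    have := congrArg Prod.snd hc
    simp [hv] at this)
  have hroot : ∀ ψ : Dual F (U × E), (∀ u : U, ψ (u, 0) = 0) → ψ ∈ rootGroup H v :=
    fun ψ hψ => hG.mem_rootGroup_of_fst_eq_zero rfl ⟨φ, hφ, 1, hφ1⟩ hψ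
  obtain ⟨f, hf⟩ : ∃ f : Dual F E, f 1 = 1 :=
    Module.Projective.exists_dual_eq_one F one_ne_zero
  set φ₀ : Dual F (U × E) := f ∘ₗ LinearMap.snd F U E with hφ₀
  have hφ₀0 : φ₀ ≠ 0 := by
    intro h
    have := LinearMap.congr_fun h ((0, 1) : U × E)
    simp [hφ₀, hf] at this
  have hφ₀u : ∀ u : U, φ₀ (u, 0) = 0 := fun u => by simp [hφ₀]
  -- transport `w` to `v`
  obtain ⟨g, hg, -, c, hc, hgv⟩ := h0 ⊥ (finrank_bot F _) v (by simpa using hv0) w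
    (by simpa using hw)
  have hspan : finrank F (F ∙ v) = 1 := finrank_span_singleton hv0
  obtain ⟨k, hk, hkv, d, hd, hkφ⟩ := (h1 _ hspan).exists_comp_eq (φ := φ₀)
    (φ' := (c⁻¹ • ψ) ∘ₗ (g : (U × E) →ₗ[F] (U × E))) hφ₀0 (fun b hb => by
      obtain ⟨a, rfl⟩ := Submodule.mem_span_singleton.1 hb
      rw [map_smul, hφ₀u, smul_zero]) (fun h => hψ (LinearMap.ext fun x => by
      have := LinearMap.congr_fun h (g.symm x)
      simpa [hc] using this)) (fun b hb => by
      obtain ⟨a, rfl⟩ := Submodule.mem_span_singleton.1 hb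
      rw [map_smul, LinearMap.comp_apply, LinearEquiv.coe_coe, hgv, LinearMap.smul_apply, map_smul,
        hψw,
        smul_zero, smul_zero, smul_zero])
  have hkv' : k v = v := hkv v (Submodule.mem_span_singleton_self v)
  have h2 : (c⁻¹ • ψ) ∘ₗ (g : (U × E) →ₗ[F] (U × E)) ∈ rootGroup H v := by
    rw [hkφ]
    have h3 : d • φ₀ ∈ rootGroup H (k v) := by
      rw [hkv']
      exact hroot _ fun u => by rw [LinearMap.smul_apply, hφ₀u, smul_zero]
    exact comp_mem_rootGroup (φ := d • φ₀) hk h3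
  have h3 := comp_symm_mem_rootGroup hg h2
  rw [hgv] at h3
  have h4 : (((c⁻¹ • ψ) ∘ₗ (g : (U × E) →ₗ[F] (U × E))) ∘ₗ
      (g.symm : (U × E) →ₗ[F] (U × E))) = c⁻¹ • ψ := LinearMap.ext fun x => by simp
  rw [h4] at h3
  have h5 := smul_mem_rootGroup hc h3
  rwa [smul_smul, mul_inv_cancel₀ hc, one_smul] at h5

end Transvections

section Generation

open Module

variable {F V : Type*} [Field F] [AddCommGroup V] [Module F V] [FiniteDimensional F V]
  {H : Subgroup (V ≃ₗ[F] V)}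

theorem exists_mem_apply_eq_of_forall_mem_rootGroup
    (hH : ∀ (ψ : Dual F V) (w : V), ψ w = 0 → ψ ∈ rootGroup H w)
    {W : Submodule F V} (hW : finrank F W + 2 ≤ finrank F V) {v w : V} (hv : v ∉ W)
    (hw : w ∉ W) : ∃ h ∈ H, (∀ x ∈ W, h x = x) ∧ h w = v := by
  have key : ∀ v w : V, w ∉ W ⊔ F ∙ (v - w) → ∃ h ∈ H, (∀ x ∈ W, h x = x) ∧ h w = v := by
    intro v w hvw
    obtain ⟨f, hf, hker⟩ := Submodule.exists_le_ker_of_notMem hvw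
    have hfvw : f (v - w) = 0 :=
      hker (Submodule.mem_sup_right (Submodule.mem_span_singleton_self _))
    obtain ⟨h, hh, hx⟩ := (mem_rootGroup.1 (hH ((f w)⁻¹ • f) (v - w) (by simp [hfvw]))).2
    refine ⟨h, hh, fun x hxW => ?_, ?_⟩
    · have : f x = 0 := hker (Submodule.mem_sup_left hxW)
      simp [hx, this]
    · simp [hx, inv_mul_cancel₀ hf]
  by_cases hvw : w ∈ W ⊔ F ∙ (v - w)
  · have hle : finrank F ↥(W ⊔ F ∙ v) < finrank F V := by
      rw [Submodule.finrank_sup_span_singleton hv]; omega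
    have hlt : W ⊔ F ∙ v < ⊤ := by
      rw [lt_top_iff_ne_top]
      intro h
      rw [h, finrank_top] at hle
      exact lt_irrefl _ hle
    obtain ⟨u, -, hu⟩ := SetLike.exists_of_lt hlt
    obtain ⟨a, ha, b, hb, hab⟩ := Submodule.mem_sup.1 hvw
    obtain ⟨c, rfl⟩ := Submodule.mem_span_singleton.1 hb
    have hwv : w ∈ W ⊔ F ∙ v := by
      have hc : (1 + c) • w = a + c • v := by
        rw [add_smul, one_smul]; nth_rewrite 1 [← hab]; module
      have hc0 : 1 + c ≠ 0 := by
        intro h0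
        rw [h0, zero_smul] at hc
        have hc1 : c = -1 := by linear_combination h0
        rw [hc1, neg_one_smul, ← sub_eq_add_neg] at hc
        exact hv (sub_eq_zero.1 hc.symm ▸ ha)
      have : w = (1 + c)⁻¹ • (a + c • v) := by rw [← hc, inv_smul_smul₀ hc0]
      rw [this]
      exact Submodule.smul_mem _ _ (Submodule.add_mem_sup ha
        (Submodule.smul_mem _ _ (Submodule.mem_span_singleton_self _)))
    have huv : ∀ x ∈ W ⊔ F ∙ v, x ∉ W → x ∉ W ⊔ F ∙ (u - x) := by
      intro x hx hxW hmem
      obtain ⟨a, ha, b, hb, hab⟩ := Submodule.mem_sup.1 hmem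
      obtain ⟨c, rfl⟩ := Submodule.mem_span_singleton.1 hb
      by_cases hc : c = 0
      · rw [hc, zero_smul, add_zero] at hab
        exact hxW (hab ▸ ha)
      · apply hu
        have : u = c⁻¹ • (x - a) + x := by
          rw [← sub_eq_iff_eq_add, eq_inv_smul_iff₀ hc, eq_sub_iff_add_eq, add_comm, hab]
        rw [this]
        exact Submodule.add_mem _ (Submodule.smul_mem _ _
          (Submodule.sub_mem _ hx (Submodule.mem_sup_left ha))) hx
    obtain ⟨h₁, hh₁, hW₁, h₁w⟩ := key u w (huv w hwv hw)
    obtain ⟨h₂, hh₂, hW₂, h₂v⟩ := key u v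
      (huv v (Submodule.mem_sup_right (Submodule.mem_span_singleton_self _)) hv)
    refine ⟨h₂⁻¹ * h₁, H.mul_mem (H.inv_mem hh₂) hh₁, fun x hx => ?_, ?_⟩
    · rw [LinearEquiv.mul_apply, hW₁ x hx]
      exact h₂.symm_apply_eq.2 (hW₂ x hx).symm
    · rw [LinearEquiv.mul_apply, h₁w]
      exact h₂.symm_apply_eq.2 h₂v.symm
  · exact key v w hvw

/-- A group containing all transvections contains every automorphism of determinant one. -/
theorem mem_of_det_eq_one_of_forall_mem_rootGroup
    (hH : ∀ (ψ : Dual F V) (w : V), ψ w = 0 → ψ ∈ rootGroup H w)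
    (g : V ≃ₗ[F] V) (hg : LinearMap.det (g : V →ₗ[F] V) = 1) : g ∈ H := by
  have hH' : ∀ (ψ : Dual F V) (w : V), ψ w = 0 →
      ψ ∈ rootGroup (H ⊓ (LinearEquiv.det (R := F) (M := V)).ker) w := by
    intro ψ w h0
    obtain ⟨t, ht, hx⟩ := (mem_rootGroup.1 (hH ψ w h0)).2
    refine mem_rootGroup.2 ⟨h0, t, ⟨ht, MonoidHom.mem_ker.2 (Units.ext ?_)⟩, hx⟩
    have : (t : V →ₗ[F] V) = LinearMap.transvection ψ w := LinearMap.ext fun x => by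
      rw [LinearMap.transvection.apply]; exact hx x
    rw [LinearEquiv.coe_det, this, LinearMap.transvection.det, h0, add_zero, Units.val_one]
  have key : ∀ k, k + 1 ≤ finrank F V → ∃ h ∈ H ⊓ (LinearEquiv.det (R := F) (M := V)).ker,
      ∃ W : Submodule F V, finrank F W = k ∧
      ∀ x ∈ W, (h * g) x = x := by
    intro k
    induction k with
    | zero => exact fun _ => ⟨1, Subgroup.one_mem _, ⊥, by simp, by simp⟩
    | succ k ih =>
      intro hk
      obtain ⟨h, hh, W, hWk, hW⟩ := ih (by omega)
      have hlt : W < ⊤ := by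
        rw [lt_top_iff_ne_top]
        rintro rfl
        rw [finrank_top] at hWk
        omega
      obtain ⟨v, -, hv⟩ := SetLike.exists_of_lt hlt
      have hw : (h * g) v ∉ W := by
        intro hmem
        have := hW _ hmem
        exact hv ((h * g).injective this ▸ hmem)
      obtain ⟨t, ht, htW, htv⟩ := exists_mem_apply_eq_of_forall_mem_rootGroup hH'
        (W := W) (by omega) hv hw
      refine ⟨t * h, Subgroup.mul_mem _ ht hh, W ⊔ F ∙ v, by
        rw [Submodule.finrank_sup_span_singleton hv, hWk], fun x hx => ?_⟩
      obtain ⟨a, ha, b, hb, rfl⟩ := Submodule.mem_sup.1 hx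
      obtain ⟨c, rfl⟩ := Submodule.mem_span_singleton.1 hb
      rw [mul_assoc, LinearEquiv.mul_apply, map_add, map_smul, map_add, map_smul, hW a ha,
        htW a ha, htv]
  have hV : 0 < finrank F V ∨ finrank F V = 0 := by omega
  rcases hV with hV | hV
  · obtain ⟨h, hh, W, hWk, hW⟩ := key (finrank F V - 1) (by omega)
    have hle : W ≤ (h * g : V ≃ₗ[F] V).toLinearMap.fixedSubmodule := fun x hx => by
      rw [LinearMap.mem_fixedSubmodule_iff]; exact hW x hx
    have h1 := Submodule.finrank_mono hle
    have h2 := Submodule.finrank_quotient_add_finrank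
      (h * g : V ≃ₗ[F] V).toLinearMap.fixedSubmodule
    obtain ⟨f, v, hfv⟩ :=
      (LinearEquiv.mem_dilatransvections_iff_finrank_quotient (e := h * g)).2 (by omega)
    have hd : LinearMap.det ((h * g : V ≃ₗ[F] V) : V →ₗ[F] V) = 1 + f v := by
      rw [hfv, LinearMap.transvection.det]
    have hdh := congrArg Units.val (MonoidHom.mem_ker.1 hh.2)
    rw [LinearEquiv.coe_det, Units.val_one] at hdh
    have hd' : LinearMap.det ((h * g : V ≃ₗ[F] V) : V →ₗ[F] V) = 1 := by
      have : ((h * g : V ≃ₗ[F] V) : V →ₗ[F] V) = (h : V →ₗ[F] V) * (g : V →ₗ[F] V) := rfl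
      rw [this, map_mul, hdh, hg, one_mul]
    have hf0 : f v = 0 := by linear_combination hd' - hd
    obtain ⟨t, ht, hx⟩ := (mem_rootGroup.1 (hH f v hf0)).2
    have htg : t = h * g := LinearEquiv.ext fun x => by
      rw [hx, ← LinearEquiv.coe_coe (h * g), hfv, LinearMap.transvection.apply]
    rw [eq_inv_mul_of_mul_eq htg.symm]
    exact H.mul_mem (H.inv_mem hh.1) ht
  · have := Module.finrank_zero_iff.1 hV
    rw [show g = 1 from LinearEquiv.ext fun x => Subsingleton.elim _ _]
    exact H.one_mem

end Generation

section Zsigmondy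

open Polynomial

theorem Polynomial.eval_cyclotomic_mul_pow_succ {R : Type*} [CommRing R] {r : ℕ} (hr : r.Prime)
    (m k : ℕ) (x : R) :
    (cyclotomic (m * r ^ (k + 1)) R).eval x = (cyclotomic (m * r) R).eval (x ^ r ^ k) := by
  induction k generalizing x with
  | zero => simp
  | succ k ih =>
    rw [pow_succ r (k + 1), ← mul_assoc, ← cyclotomic_expand_eq_cyclotomic hr
      (dvd_mul_of_dvd_right (dvd_pow_self r (Nat.succ_ne_zero k)) m), expand_eval, ih,
      ← pow_mul, ← pow_succ']

theorem Polynomial.pow_totient_le_eval_cyclotomic_mul {r m : ℕ} (hr : r.Prime) (hm : ¬r ∣ m)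
    {b : ℝ} (hb : 1 < b) :
    (b ^ r - 1) ^ m.totient ≤ (cyclotomic (m * r) ℝ).eval b * (b + 1) ^ m.totient := by
  have h1 := congrArg (eval b) (cyclotomic_expand_eq_cyclotomic_mul hr hm ℝ)
  rw [expand_eval, eval_mul] at h1
  calc (b ^ r - 1) ^ m.totient ≤ (cyclotomic m ℝ).eval (b ^ r) :=
        sub_one_pow_totient_le_cyclotomic_eval (one_lt_pow₀ hb hr.ne_zero) m
    _ = _ := h1
    _ ≤ _ := mul_le_mul_of_nonneg_left (cyclotomic_eval_le_add_one_pow_totient hb m)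
        (cyclotomic_pos' _ hb).le

theorem isPrimitiveRoot_of_dvd_eval_cyclotomic {r m k q : ℕ} (hr : r.Prime) (hm : ¬r ∣ m)
    (h : (r : ℤ) ∣ (cyclotomic (r ^ k * m) ℤ).eval (q : ℤ)) : IsPrimitiveRoot (q : ZMod r) m := by
  have := Fact.mk hr
  have : NeZero (m : ZMod r) := ⟨by rwa [Ne, ZMod.natCast_eq_zero_iff]⟩
  refine (isRoot_cyclotomic_prime_pow_mul_iff_of_charP (p := r) (k := k)).1 ?_
  rw [IsRoot.def, ← map_cyclotomic_int, eval_natCast_map, eq_intCast,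
    ZMod.intCast_zmod_eq_zero_iff_dvd]
  exact h

theorem pow_le_of_pow_pow_le {b r : ℕ} (hb : 2 ≤ b) (hr : 3 ≤ r) {φ : ℕ} (hφ : 0 < φ)
    (h : ((b : ℝ) ^ r - 1) ^ φ ≤ r * ((b : ℝ) + 1) ^ φ) : b = 2 ∧ r = 3 := by
  have hb' : (2 : ℝ) ≤ b := by exact_mod_cast hb
  have h1 : (b : ℝ) ^ r - 1 ≤ r * (b + 1) := by
    by_contra! hcon
    have hr1 : (1 : ℝ) ≤ r := by exact_mod_cast (by omega : 1 ≤ r)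
    have h2 : (r * ((b : ℝ) + 1)) ^ φ < ((b : ℝ) ^ r - 1) ^ φ :=
      pow_lt_pow_left₀ hcon (by positivity) hφ.ne'
    rw [mul_pow] at h2
    have h3 : (r : ℝ) ≤ r ^ φ := le_self_pow₀ hr1 hφ.ne'
    have h4 : (r : ℝ) * (b + 1) ^ φ ≤ r ^ φ * (b + 1) ^ φ :=
      mul_le_mul_of_nonneg_right h3 (by positivity)
    linarith
  have h2 : b ^ r ≤ r * (b + 1) + 1 := by
    have : (b : ℝ) ^ r ≤ r * (b + 1) + 1 := by linarith
    exact_mod_cast this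
  have key : ∀ s, (s + 4) * (b + 1) + 1 < b ^ (s + 4) := by
    intro s
    induction s with
    | zero =>
      have : 8 * b ≤ b ^ 4 := by
        calc 8 * b ≤ b ^ 3 * b := Nat.mul_le_mul_right _ (Nat.pow_le_pow_left hb 3)
          _ = b ^ 4 := by ring
      rw [zero_add]
      omega
    | succ s ih =>
      rw [show s + 1 + 4 = (s + 4) + 1 by omega, pow_succ, add_mul (s + 4)]
      have h5 : b ^ (s + 4) * 2 ≤ b ^ (s + 4) * b := Nat.mul_le_mul_left _ hb
      have h6 : 1 * (b + 1) ≤ (s + 4) * (b + 1) := Nat.mul_le_mul_right _ (by omega)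
      omega
  obtain hr3 | hr4 := hr.eq_or_lt
  · subst hr3
    refine ⟨?_, rfl⟩
    by_contra hb2
    have : 3 ≤ b := by omega
    have : 9 * b ≤ b ^ 3 := by
      calc 9 * b ≤ b ^ 2 * b := Nat.mul_le_mul_right _ (Nat.pow_le_pow_left this 2)
        _ = b ^ 3 := by ring
    omega
  · have := key (r - 4)
    rw [show r - 4 + 4 = r by omega] at this
    omega

/-- Zsigmondy's theorem for `q ^ d - 1`. -/
theorem exists_prime_dvd_pow_sub_one {q d : ℕ} (hq : 2 ≤ q) (hd : 3 ≤ d) (hd6 : d ≠ 6) :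
    ∃ r, r.Prime ∧ r ∣ q ^ d - 1 ∧ ∀ j, 0 < j → j < d → ¬r ∣ q ^ j - 1 := by
  by_contra! hcon
  set Φ := (cyclotomic d ℤ).eval (q : ℤ) with hΦ
  have hq1 : (1 : ℝ) < q := by exact_mod_cast (by omega : 1 < q)
  have hΦR : (cyclotomic d ℝ).eval (q : ℝ) = (Φ : ℝ) := by
    rw [hΦ, ← map_cyclotomic_int, eval_natCast_map, eq_intCast]
  have hΦ1 : 1 < Φ := by
    have h1 := sub_one_pow_totient_lt_cyclotomic_eval (n := d) (by omega) hq1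
    rw [hΦR] at h1
    have h2 : (1 : ℝ) ≤ ((q : ℝ) - 1) ^ d.totient := by
      refine one_le_pow₀ ?_
      have : (2 : ℝ) ≤ q := by exact_mod_cast hq
      linarith
    exact_mod_cast lt_of_le_of_lt h2 h1
  obtain ⟨N, hN⟩ := Int.eq_ofNat_of_zero_le (by omega : 0 ≤ Φ)
  have hN1 : 1 < N := by omega
  have hprim : ∀ r k m, r.Prime → ¬r ∣ m → r ∣ N → d = r ^ k * m →
      IsPrimitiveRoot (q : ZMod r) m := by
    intro r k m hr hm hrN hdk
    refine isPrimitiveRoot_of_dvd_eval_cyclotomic (k := k) hr hm ?_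
    rw [← hdk, ← hΦ, hN]
    exact_mod_cast hrN
  have hone : ∀ r j : ℕ, (q : ZMod r) ^ j = 1 ↔ r ∣ q ^ j - 1 := by
    intro r j
    rw [← ZMod.natCast_eq_zero_iff, Nat.cast_sub (Nat.one_le_pow _ _ (by omega)), sub_eq_zero]
    simp
  have hfac : ∀ r, r.Prime → r ∣ N → ∃ k m, ¬r ∣ m ∧ d = r ^ (k + 1) * m ∧
      IsPrimitiveRoot (q : ZMod r) m ∧ m ∣ r - 1 := by
    intro r hr hrN
    obtain ⟨k, m, hm, hdk⟩ := Nat.exists_eq_pow_mul_and_not_dvd (n := d) (by omega) r hr.ne_one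
    have hp := hprim r k m hr hm hrN hdk
    obtain _ | k := k
    · rw [pow_zero, one_mul] at hdk
      subst hdk
      obtain ⟨j, hj0, hjd, hj⟩ := hcon r hr ((hone r d).1 hp.pow_eq_one)
      exact absurd (Nat.le_of_dvd hj0 (hp.dvd_of_pow_eq_one j ((hone r j).2 hj))) (by omega)
    · have := Fact.mk hr
      have hq0 : (q : ZMod r) ≠ 0 := by
        intro h0
        have := hp.pow_eq_one
        rw [h0, zero_pow (by rintro rfl; simp at hm)] at this
        exact zero_ne_one this
      exact ⟨k, m, hm, hdk, hp, hp.dvd_of_pow_eq_one _ (ZMod.pow_card_sub_one_eq_one hq0)⟩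
  have huniq : ∀ r s, r.Prime → s.Prime → r ∣ N → s ∣ N → s ≤ r := by
    intro r s hr hs hrN hsN
    by_contra! hlt
    obtain ⟨k, m, hm, hdk, -, hmr⟩ := hfac r hr hrN
    obtain ⟨k', m', -, hdk', -, -⟩ := hfac s hs hsN
    have hsd : s ∣ d := hdk' ▸ Dvd.dvd.mul_right (dvd_pow_self s (Nat.succ_ne_zero k')) m'
    rw [hdk] at hsd
    obtain h | h := hs.dvd_mul.1 hsd
    · exact hlt.ne' ((Nat.prime_dvd_prime_iff_eq hs hr).1 (hs.dvd_of_dvd_pow h))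
    · have := Nat.le_of_dvd (by have := hr.two_le; omega) (h.trans hmr)
      omega
  obtain ⟨r, hr, hrN⟩ := Nat.exists_prime_and_dvd hN1.ne'
  have hNr := Nat.eq_prime_pow_of_unique_prime_dvd (n := N) (p := r) (by omega)
    (fun {s} hs hsN => le_antisymm (huniq r s hr hs hrN hsN) (huniq s r hs hr hsN hrN))
  obtain ⟨k, m, hm, hdk, hp, hmr⟩ := hfac r hr hrN
  have hm0 : 0 < m := Nat.pos_of_ne_zero (by rintro rfl; simp at hm)
  obtain rfl | hr2 := eq_or_ne r 2
  · have hm1 : m = 1 := Nat.dvd_one.1 hmr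
    subst hm1
    rw [mul_one] at hdk
    obtain _ | k := k
    · omega
    have hval : N = q ^ 2 ^ (k + 1) + 1 := by
      have : Φ = (q : ℤ) ^ 2 ^ (k + 1) + 1 := by
        rw [hΦ, hdk, cyclotomic_prime_pow_eq_geom_sum Nat.prime_two]
        simp [Finset.sum_range_succ, add_comm]
      rw [hN] at this
      exact_mod_cast this
    have hsq : N = (q ^ 2 ^ k) * (q ^ 2 ^ k) + 1 := by rw [hval, ← pow_add]; congr 2; ring
    have h4 : 4 ∣ N := by
      rw [hNr]
      have h2 : 2 < N := by
        have : 2 ≤ q ^ 2 ^ k := hq.trans (Nat.le_self_pow (by positivity) q)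
        nlinarith
      have : 2 ≤ N.primeFactorsList.length := by
        by_contra! hlt
        have : (2 : ℕ) ^ N.primeFactorsList.length ≤ 2 ^ 1 :=
          Nat.pow_le_pow_right (by norm_num) (by omega)
        omega
      exact pow_dvd_pow 2 this
    rw [hsq] at h4
    generalize q ^ 2 ^ k = y at h4
    have hy := Nat.mod_lt y (by norm_num : 0 < 4)
    have : (y * y + 1) % 4 = 0 := Nat.mod_eq_zero_of_dvd h4
    rw [Nat.add_mod, Nat.mul_mod] at this
    interval_cases y % 4 <;> simp at this
  · have hr3 : 3 ≤ r := by have := hr.two_le; omega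
    have hfr := Fact.mk hr
    have hNle : N ≤ r := by
      have hsq : ¬r ^ 2 ∣ N := by
        intro hdvd
        have hd' : r ^ k * m ∈ d.properDivisors := by
          rw [Nat.mem_properDivisors]
          refine ⟨⟨r, by rw [hdk]; ring⟩, ?_⟩
          rw [hdk, pow_succ]
          have : 0 < r ^ k * m := by have := hr.pos; positivity
          nlinarith
        obtain ⟨P, hP⟩ := X_pow_sub_one_mul_cyclotomic_dvd_X_pow_sub_one_of_dvd ℤ hd'
        have hev := congrArg (eval (q : ℤ)) hP
        simp only [eval_sub, eval_pow, eval_X, eval_one, eval_mul, ← hΦ, hN] at hev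
        have hge : ∀ j, 1 ≤ q ^ j := fun j => Nat.one_le_pow _ _ (by omega)
        have hdv : (q ^ (r ^ k * m) - 1) * N ∣ q ^ d - 1 := by
          have : (((q ^ (r ^ k * m) - 1) * N : ℕ) : ℤ) ∣ ((q ^ d - 1 : ℕ) : ℤ) := by
            push_cast [hge]
            exact ⟨_, hev⟩
          exact_mod_cast this
        have hrq : r ∣ q ^ (r ^ k * m) - 1 := (hone _ _).1 (by
          rw [mul_comm, pow_mul, hp.pow_eq_one, one_pow])
        have hlt : 1 < q ^ (r ^ k * m) :=
          Nat.one_lt_pow (by have := hr.pos; positivity) (by omega)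
        have hlte := padicValNat.pow_sub_pow (p := r) (hr.odd_of_ne_two hr2) (x := q ^ (r ^ k * m))
          (y := 1) hlt hrq (by
            intro h
            have := (Nat.dvd_sub_iff_right (hge _) h).1 hrq
            exact hr.one_lt.ne' (Nat.dvd_one.1 this)) hr.ne_zero
        rw [one_pow, ← pow_mul, show r ^ k * m * r = d by rw [hdk]; ring,
          padicValNat_self] at hlte
        have hd0 : q ^ d - 1 ≠ 0 := by
          have := Nat.one_lt_pow (n := d) (by omega) (by omega : 1 < q)
          omega
        have hdv2 := (mul_dvd_mul (pow_padicValNat_dvd (p := r) (n := q ^ (r ^ k * m) - 1))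
          hdvd).trans hdv
        rw [← pow_add] at hdv2
        have hle := (padicValNat_dvd_iff_le (p := r) hd0).1 hdv2
        omega
      rw [hNr]
      have : N.primeFactorsList.length ≤ 1 := by
        by_contra! hlt
        exact hsq (hNr.symm ▸ pow_dvd_pow r hlt)
      calc r ^ N.primeFactorsList.length ≤ r ^ 1 := Nat.pow_le_pow_right hr.pos this
        _ = r := pow_one r
    have hb : (1 : ℝ) < (q : ℝ) ^ r ^ k := one_lt_pow₀ hq1 (pow_pos hr.pos k).ne'
    have hbound := pow_totient_le_eval_cyclotomic_mul hr hm hb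
    rw [← eval_cyclotomic_mul_pow_succ hr, mul_comm m, ← hdk, hΦR, hN] at hbound
    obtain ⟨hb2, hr3'⟩ := pow_le_of_pow_pow_le (b := q ^ r ^ k) (r := r)
      (hq.trans (Nat.le_self_pow (pow_pos hr.pos k).ne' q)) hr3 (Nat.totient_pos.2 hm0) (by
        push_cast
        refine hbound.trans (mul_le_mul_of_nonneg_right ?_ (by positivity))
        exact_mod_cast hNle)
    subst hr3'
    have hk : k = 0 := by
      by_contra hk
      have h3 : 3 ≤ 3 ^ k := Nat.le_self_pow hk 3
      have : 2 ^ 3 ≤ q ^ 3 ^ k :=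
        (Nat.pow_le_pow_left hq 3).trans (Nat.pow_le_pow_right (by omega) h3)
      omega
    subst hk
    rw [pow_zero, pow_one] at hb2
    subst hb2
    have hm2 : m ≤ 2 := Nat.le_of_dvd (by norm_num) hmr
    interval_cases m
    · have := (hone _ _).1 hp.pow_eq_one
      norm_num at this
    · omega

end Zsigmondy

section Splitting

variable {F V K : Type*} [Field F] [AddCommGroup V] [Module F V] [Field K] [Algebra F K]

/-- An invariant subspace of a map acting as multiplication by a generator on a summand `K` and as
the identity on a complement contains the summand or is contained in the complement. -/
theorem Submodule.le_ker_or_range_le_of_mul {g : V ≃ₗ[F] V} {ι : K →ₗ[F] V} {π : V →ₗ[F] K}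
    (hπι : ∀ k, π (ι k) = k) {ζ : K} (hζ1 : ζ ≠ 1) (hζ : Algebra.adjoin F {ζ} = ⊤)
    (hg : ∀ v, g v = v + ι ((ζ - 1) * π v)) {Z : Submodule F V} (hZ : ∀ v ∈ Z, g v ∈ Z) :
    Z ≤ π.ker ∨ ι.range ≤ Z := by
  by_cases h : Z ≤ π.ker
  · exact Or.inl h
  right
  obtain ⟨v, hv, hπv⟩ := Set.not_subset.1 h
  have hπv : π v ≠ 0 := hπv
  set c := (ζ - 1) * π v with hc
  have hc0 : c ≠ 0 := mul_ne_zero (sub_ne_zero.2 hζ1) hπv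
  have hcZ : ι c ∈ Z := by
    have := Z.sub_mem (hZ v hv) hv
    rwa [hg, add_sub_cancel_left] at this
  have key : ∀ y ∈ Algebra.adjoin F {ζ}, ∀ k, ι k ∈ Z → ι (y * k) ∈ Z := by
    intro y hy
    induction hy using Algebra.adjoin_induction with
    | mem y hy =>
      rw [Set.mem_singleton_iff] at hy
      subst hy
      intro k hk
      have := hZ _ hk
      rw [hg, hπι, ← map_add] at this
      convert this using 2
      ring
    | algebraMap a =>
      intro k hk
      rw [← Algebra.smul_def, map_smul]
      exact Z.smul_mem a hk
    | add y y' _ _ h h' =>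
      intro k hk
      rw [add_mul, map_add]
      exact Z.add_mem (h k hk) (h' k hk)
    | mul y y' _ _ h h' =>
      intro k hk
      rw [mul_assoc]
      exact h _ (h' k hk)
  rintro _ ⟨k, rfl⟩
  have := key (k * c⁻¹) (hζ ▸ Algebra.mem_top) c hcZ
  rwa [inv_mul_cancel_right₀ hc0] at this

end Splitting

section Scalars

variable {F V : Type*} [Field F] [AddCommGroup V] [Module F V]

/-- The group generated by `H` and the scalars. -/
def Subgroup.scalarSup (H : Subgroup (V ≃ₗ[F] V)) : Subgroup (V ≃ₗ[F] V) where
  carrier := {h | ∃ g ∈ H, ∃ a : F, a ≠ 0 ∧ ∀ v, h v = a • g v}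
  mul_mem' := by
    rintro _ _ ⟨g, hg, a, ha, h⟩ ⟨g', hg', a', ha', h'⟩
    refine ⟨g * g', H.mul_mem hg hg', a * a', mul_ne_zero ha ha', fun v => ?_⟩
    rw [LinearEquiv.mul_apply, h, h', map_smul, smul_smul, LinearEquiv.mul_apply]
  one_mem' := ⟨1, H.one_mem, 1, one_ne_zero, fun v => by simp⟩
  inv_mem' := by
    rintro k ⟨g, hg, a, ha, h⟩
    refine ⟨g⁻¹, H.inv_mem hg, a⁻¹, inv_ne_zero ha, fun v => ?_⟩
    change k.symm v = a⁻¹ • g.symm v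
    rw [LinearEquiv.symm_apply_eq, h, map_smul, g.apply_symm_apply, smul_smul, mul_inv_cancel₀ ha,
      one_smul]

variable {H : Subgroup (V ≃ₗ[F] V)}

theorem Subgroup.mem_scalarSup {h : V ≃ₗ[F] V} :
    h ∈ H.scalarSup ↔ ∃ g ∈ H, ∃ a : F, a ≠ 0 ∧ ∀ v, h v = a • g v := Iff.rfl

theorem Subgroup.le_scalarSup (H : Subgroup (V ≃ₗ[F] V)) : H ≤ H.scalarSup :=
  fun h hh => ⟨h, hh, 1, one_ne_zero, fun v => by simp⟩

theorem Subgroup.commutator_mem_of_mem_scalarSup {h h' : V ≃ₗ[F] V} (hh : h ∈ H.scalarSup)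
    (hh' : h' ∈ H.scalarSup) : h * h' * h⁻¹ * h'⁻¹ ∈ H := by
  obtain ⟨g, hg, a, ha, hx⟩ := hh
  obtain ⟨g', hg', a', ha', hx'⟩ := hh'
  have : h * h' * h⁻¹ * h'⁻¹ = g * g' * g⁻¹ * g'⁻¹ := by
    rw [mul_assoc, ← mul_inv_rev, mul_assoc (g * g'), ← mul_inv_rev, mul_inv_eq_iff_eq_mul]
    refine LinearEquiv.ext fun v => ?_
    have h1 : (h' * h) v = (a' * a) • (g' * g) v := by
      rw [LinearEquiv.mul_apply, hx, hx', map_smul, smul_smul, LinearEquiv.mul_apply]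
    have h2 : (h * h') v = (a' * a) • (g * g') v := by
      rw [LinearEquiv.mul_apply, hx', hx, map_smul, smul_smul, mul_comm, LinearEquiv.mul_apply]
    change _ = (g * g') ((g' * g).symm ((h' * h) v))
    rw [h1, h2, map_smul, map_smul, LinearEquiv.symm_apply_apply]
  rw [this]
  exact H.mul_mem (H.mul_mem (H.mul_mem hg hg') (H.inv_mem hg)) (H.inv_mem hg')

theorem Subgroup.forall_mem_rootGroup_of_scalarSup [FiniteDimensional F V]
    (hV : 3 ≤ Module.finrank F V)
    (hH : ∀ (ψ : Module.Dual F V) (w : V), ψ w = 0 → ψ ∈ rootGroup H.scalarSup w)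
    (ψ : Module.Dual F V) (w : V) (hψ : ψ w = 0) : ψ ∈ rootGroup H w := by
  obtain ⟨v, hvψ, hvw⟩ : ∃ v ∈ ψ.ker, v ∉ F ∙ w := by
    by_contra! h
    have h1 := Submodule.finrank_mono (show ψ.ker ≤ F ∙ w from h)
    have h2 : Module.finrank F (F ∙ w) ≤ 1 := by
      simpa using finrank_span_le_card (R := F) ({w} : Set V)
    have h3 := ψ.finrank_range_add_finrank_ker
    have h4 : Module.finrank F ψ.range ≤ 1 :=
      (Submodule.finrank_le _).trans (Module.finrank_self F).le
    omega
  obtain ⟨φ, hφ, hφw⟩ := Submodule.exists_le_ker_of_notMem hvw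
  have hφw : φ w = 0 := hφw (Submodule.mem_span_singleton_self w)
  obtain ⟨t₁, ht₁, t₁x⟩ := (mem_rootGroup.1 (hH ((φ v)⁻¹ • φ) w (by simp [hφw]))).2
  obtain ⟨t₂, ht₂, t₂x⟩ := (mem_rootGroup.1 (hH ψ v hvψ)).2
  refine mem_rootGroup.2 ⟨hψ, _, Subgroup.commutator_mem_of_mem_scalarSup ht₁ ht₂, fun x => ?_⟩
  refine LinearEquiv.commutator_apply_eq (β := ψ) (b := w) (fun x => ?_) x
  have hvψ : ψ v = 0 := hvψ
  have h1 : ((φ v)⁻¹ • φ) v = 1 := by simp [hφ]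
  simp only [t₁x, t₂x, map_add, map_smul, smul_eq_mul, hψ, hvψ, h1]
  module

end Scalars

section BlockElements

variable {F W K E : Type*} [Field F] [AddCommGroup W] [Module F W] [Field K] [Algebra F K] [Field E]
  [Algebra F E]

theorem natCard_sub_one_dvd_natCard_sub_one (F E : Type*) [Field F] [Field E] [Algebra F E]
    [FiniteDimensional F E] : Nat.card F - 1 ∣ Nat.card E - 1 := by
  rw [Module.natCard_eq_pow_finrank (K := F) (V := E)]
  simpa using Nat.sub_dvd_pow_sub_pow (Nat.card F) 1 (Module.finrank F E)

/-- Multiplication by a unit of an extension field, as a linear automorphism. -/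
def unitsMulHom (F K : Type*) [Field F] [Field K] [Algebra F K] : Kˣ →* (K ≃ₗ[F] K) :=
  DistribMulAction.toModuleAut F K

@[simp] theorem unitsMulHom_apply (μ : Kˣ) (k : K) : unitsMulHom F K μ k = μ * k := rfl

/-- The block diagonal automorphisms of `(W × K) × E` acting on `K` and on `E` by
multiplications. -/
def blockHom (F W K E : Type*) [Field F] [AddCommGroup W] [Module F W] [Field K] [Algebra F K]
    [Field E] [Algebra F E] :
    (W ≃ₗ[F] W) × Kˣ × Eˣ →* (((W × K) × E) ≃ₗ[F] ((W × K) × E)) where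
  toFun p := (p.1.prodCongr (unitsMulHom F K p.2.1)).prodCongr (unitsMulHom F E p.2.2)
  map_one' := by
    refine LinearEquiv.ext fun v => ?_
    simp
  map_mul' p p' := by
    refine LinearEquiv.ext fun v => ?_
    simp [LinearEquiv.mul_apply]

@[simp] theorem blockHom_apply (p : (W ≃ₗ[F] W) × Kˣ × Eˣ) (v : (W × K) × E) :
    blockHom F W K E p v = ((p.1 v.1.1, p.2.1 * v.1.2), p.2.2 * v.2) := rfl

theorem mulBlock_eq_blockHom (γ : Eˣ) : mulBlock F (W × K) γ = blockHom F W K E (1, 1, γ) := by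
  refine LinearEquiv.ext fun v => ?_
  simp

theorem det_blockHom [FiniteDimensional F W] [FiniteDimensional F K] [FiniteDimensional F E]
    (p : (W ≃ₗ[F] W) × Kˣ × Eˣ) :
    LinearMap.det (blockHom F W K E p : ((W × K) × E) →ₗ[F] ((W × K) × E)) =
      LinearMap.det (p.1 : W →ₗ[F] W) * Algebra.norm F (p.2.1 : K) *
        Algebra.norm F (p.2.2 : E) := by
  have : (blockHom F W K E p : ((W × K) × E) →ₗ[F] ((W × K) × E)) =
      ((p.1 : W →ₗ[F] W).prodMap (Algebra.lmul F K p.2.1)).prodMap (Algebra.lmul F E p.2.2) := by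
    ext v <;> simp
  rw [this, LinearMap.det_prodMap, LinearMap.det_prodMap]
  rfl

theorem Submodule.finrank_prod_eq {M N : Type*} [AddCommGroup M] [Module F M] [AddCommGroup N]
    [Module F N] [FiniteDimensional F M] [FiniteDimensional F N] (p : Submodule F M)
    (q : Submodule F N) :
    Module.finrank F (p.prod q) = Module.finrank F p + Module.finrank F q := by
  have e : (p.prod q) ≃ₗ[F] (p × q) :=
    { toFun := fun v => (⟨v.1.1, v.2.1⟩, ⟨v.1.2, v.2.2⟩)
      invFun := fun v => ⟨(v.1, v.2), v.1.2, v.2.2⟩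
      map_add' := fun _ _ => rfl
      map_smul' := fun _ _ => rfl
      left_inv := fun _ => rfl
      right_inv := fun _ => rfl }
  rw [e.finrank_eq, Module.finrank_prod]

theorem Submodule.finrank_eq_zero_or {M : Type*} [AddCommGroup M] [Module F M] {p : Submodule F M}
    (hp : p = ⊥ ∨ p = ⊤) :
    Module.finrank F p = 0 ∨ Module.finrank F p = Module.finrank F M := by
  rcases hp with rfl | rfl
  · exact Or.inl (finrank_bot F M)
  · exact Or.inr (finrank_top F M)

/-- Multiplication of a unit of an extension by a scalar. -/
def Units.scale (χ : Fˣ) (ξ : Kˣ) : Kˣ := Units.map (algebraMap F K) χ * ξ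

theorem Units.scale_pow (χ : Fˣ) (ξ : Kˣ) (m : ℕ) :
    (Units.scale χ ξ) ^ m = Units.scale (χ ^ m) (ξ ^ m) := by
  simp [Units.scale, mul_pow]

theorem Units.scale_mul (χ : Fˣ) (ξ : Kˣ) (k : K) :
    (Units.scale χ ξ : K) * k = (χ : F) • ((ξ : K) * k) := by
  simp [Units.scale, Algebra.smul_def, mul_assoc]

@[simp] theorem Units.scale_one (ξ : Kˣ) : Units.scale (1 : Fˣ) ξ = ξ := by
  simp [Units.scale]

theorem Units.pow_card_sub_one_mul [Finite F] (χ : Fˣ) (m : ℕ) :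
    χ ^ ((Nat.card F - 1) * m) = 1 := by
  let _ : Fintype F := Fintype.ofFinite F
  rw [pow_mul]
  have : χ ^ (Nat.card F - 1) = 1 := by
    rw [Nat.card_eq_fintype_card]
    ext
    simpa using FiniteField.pow_card_sub_one_eq_one (χ : F) χ.ne_zero
  rw [this, one_pow]

theorem blockHom_pow_eq [Finite F] (σ : W ≃ₗ[F] W) (χ f : Fˣ) (ξ : Kˣ)
    (ω : Eˣ) (m : ℕ) :
    (blockHom F W K E (σ, Units.scale χ ξ, Units.scale f ω)) ^
      ((Nat.card F - 1) * m) = blockHom F W K E (σ ^ ((Nat.card F - 1) * m),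
        ξ ^ ((Nat.card F - 1) * m), ω ^ ((Nat.card F - 1) * m)) := by
  rw [← map_pow]
  simp only [Prod.pow_mk, Units.scale_pow, Units.pow_card_sub_one_mul, Units.scale_one]

/-- A block diagonal automorphism of `(W × K) × E`, given by `σ` on `W`, by `χ ξ` on `K` and by
`f ω` on `E`, where `ξ` has prime order `r`, `ω` generates the multiplicative group of `E`, and the
orders of `σ`, `ξ` and `ω` are almost coprime. -/
structure IsBlockDatum (σ : W ≃ₗ[F] W) (ρ r : ℕ) (ξ : Kˣ) (ω : Eˣ) : Prop where
  pow : σ ^ ρ = 1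
  coprime : ρ.Coprime (Nat.card E - 1)
  irr : ∀ M : Submodule F W, (∀ v ∈ M, σ v ∈ M) → M = ⊥ ∨ M = ⊤
  prime : r.Prime
  orderOf_left : orderOf ξ = r
  min : ∀ j, 0 < j → j < Module.finrank F K → ¬ r ∣ Nat.card F ^ j - 1
  not_dvd : ¬ r ∣ ρ
  not_dvd' : ¬ r ∣ Nat.card E - 1
  orderOf_right : orderOf ω = Nat.card E - 1
  finrank_coprime : (Module.finrank F K).Coprime (Module.finrank F E)
  dim : Module.finrank F W + Module.finrank F K + 4 ≤ Module.finrank F E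

namespace IsBlockDatum

variable {σ : W ≃ₗ[F] W} {ρ r : ℕ} {ξ : Kˣ} {ω : Eˣ}

variable (h : IsBlockDatum σ ρ r ξ ω) (χ f : Fˣ)
include h

theorem pow_eq_left [Finite F] [Finite E] :
    (blockHom F W K E (σ, Units.scale χ ξ, Units.scale f ω)) ^
      ((Nat.card F - 1) * (ρ * (Nat.card E - 1))) =
        blockHom F W K E (1, ξ ^ ((Nat.card F - 1) * (ρ * (Nat.card E - 1))), 1) := by
  rw [blockHom_pow_eq]
  congr 3
  · rw [mul_left_comm, pow_mul, h.pow, one_pow]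
  · rw [← mul_assoc, mul_comm, pow_mul, ← h.orderOf_right, pow_orderOf_eq_one, one_pow]

theorem pow_eq_right [Finite F] [Finite E] :
    (blockHom F W K E (σ, Units.scale χ ξ, Units.scale f ω)) ^
      ((Nat.card F - 1) * (ρ * r)) =
        blockHom F W K E (1, 1, ω ^ ((Nat.card F - 1) * (ρ * r))) := by
  rw [blockHom_pow_eq]
  congr 3
  · rw [mul_left_comm, pow_mul, h.pow, one_pow]
  · rw [← mul_assoc, mul_comm, pow_mul, ← h.orderOf_left, pow_orderOf_eq_one, one_pow]

theorem coprime_mul : (ρ * r).Coprime (Nat.card E - 1) :=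
  h.coprime.mul_left ((Nat.Prime.coprime_iff_not_dvd h.prime).2 h.not_dvd')

theorem not_dvd_mul [Finite F] [Finite E] [FiniteDimensional F E] :
    ¬ r ∣ (Nat.card F - 1) * (ρ * (Nat.card E - 1)) := by
  intro h'
  rcases h.prime.dvd_mul.1 h' with h' | h'
  · exact h.not_dvd' (h'.trans (natCard_sub_one_dvd_natCard_sub_one F E))
  · rcases h.prime.dvd_mul.1 h' with h' | h'
    · exact h.not_dvd h'
    · exact h.not_dvd' h'

theorem orderOf_pow_left [Finite F] [Finite E] [FiniteDimensional F E] :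
    orderOf (ξ ^ ((Nat.card F - 1) * (ρ * (Nat.card E - 1)))) = r := by
  rw [Nat.Coprime.orderOf_pow, h.orderOf_left]
  rw [h.orderOf_left]
  exact (Nat.Prime.coprime_iff_not_dvd h.prime).2 h.not_dvd_mul

theorem adjoin_left [Finite F] [Finite K] [Finite E] [FiniteDimensional F E] :
    Algebra.adjoin F {((ξ ^ ((Nat.card F - 1) * (ρ * (Nat.card E - 1))) : Kˣ) : K)} = ⊤ :=
  Algebra.adjoin_eq_top_of_prime_dvd_orderOf h.min _ h.orderOf_pow_left.symm.dvd

theorem ne_one_left [Finite F] [Finite E] [FiniteDimensional F E] :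
    ((ξ ^ ((Nat.card F - 1) * (ρ * (Nat.card E - 1))) : Kˣ) : K) ≠ 1 := by
  intro h'
  have h1 : ξ ^ ((Nat.card F - 1) * (ρ * (Nat.card E - 1))) = 1 := Units.ext h'
  have h2 := h.orderOf_pow_left
  rw [h1, orderOf_one] at h2
  exact h.prime.one_lt.ne h2

theorem mem_or_left [Finite F] [Finite K] [Finite E] [FiniteDimensional F E]
    {Z : Submodule F ((W × K) × E)}
    (hZ : ∀ v ∈ Z, blockHom F W K E (1, ξ ^ ((Nat.card F - 1) * (ρ * (Nat.card E - 1))), 1) v ∈ Z) :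
    (∀ v ∈ Z, v.1.2 = 0) ∨ ∀ k : K, ((0, k), 0) ∈ Z := by
  rcases Submodule.le_ker_or_range_le_of_mul
    (ι := LinearMap.inl F (W × K) E ∘ₗ LinearMap.inr F W K)
    (π := LinearMap.snd F W K ∘ₗ LinearMap.fst F (W × K) E) (fun k => rfl)
    h.ne_one_left h.adjoin_left (fun v => by ext <;> simp [sub_mul]) hZ with h1 | h1
  · exact Or.inl fun v hv => h1 hv
  · exact Or.inr fun k => h1 ⟨k, rfl⟩

theorem exists_prime_dvd [Finite F] [Finite E] [FiniteDimensional F E]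
    (hK : 3 ≤ Module.finrank F K) :
    ∃ r', r'.Prime ∧ r' ∣ Nat.card F ^ Module.finrank F E - 1 ∧
      ∀ j, 0 < j → j < Module.finrank F E → ¬ r' ∣ Nat.card F ^ j - 1 := by
  have := h.dim
  exact exists_prime_dvd_pow_sub_one Finite.one_lt_card (by omega) (by omega)

theorem mem_or_right [Finite F] [Finite E] [FiniteDimensional F E]
    (hK : 3 ≤ Module.finrank F K) {Z : Submodule F ((W × K) × E)}
    (hZ : ∀ v ∈ Z, blockHom F W K E (1, 1, ω ^ ((Nat.card F - 1) * (ρ * r))) v ∈ Z) :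
    (∀ v ∈ Z, v.2 = 0) ∨ ∀ e : E, ((0 : W × K), e) ∈ Z := by
  obtain ⟨r', hr', hdvd, hmin⟩ := h.exists_prime_dvd hK
  have hd := h.dim
  rw [← Module.natCard_eq_pow_finrank (K := F) (V := E), ← h.orderOf_right] at hdvd
  have hco : r'.Coprime ((Nat.card F - 1) * (ρ * r)) := by
    refine Nat.Coprime.mul_right ?_ ?_
    · refine (Nat.Prime.coprime_iff_not_dvd hr').2 ?_
      simpa using hmin 1 one_pos (by omega)
    · refine Nat.Coprime.coprime_dvd_left hdvd ?_
      rw [h.orderOf_right]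
      exact h.coprime_mul.symm
  have hord : r' ∣ orderOf (ω ^ ((Nat.card F - 1) * (ρ * r))) := by
    refine (hco.dvd_mul_left).1 (hdvd.trans ?_)
    rw [orderOf_dvd_iff_pow_eq_one, pow_mul, pow_orderOf_eq_one]
  have hne : ((ω ^ ((Nat.card F - 1) * (ρ * r)) : Eˣ) : E) ≠ 1 := by
    intro h'
    have h1 : ω ^ ((Nat.card F - 1) * (ρ * r)) = 1 := Units.ext h'
    rw [h1, orderOf_one] at hord
    exact hr'.one_lt.ne' (Nat.dvd_one.1 hord)
  rcases Submodule.le_ker_or_range_le_of_mul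
    (ι := LinearMap.inr F (W × K) E)
    (π := LinearMap.snd F (W × K) E) (fun k => rfl)
    hne (Algebra.adjoin_eq_top_of_prime_dvd_orderOf hmin _ hord)
    (fun v => by ext <;> simp [sub_mul]) hZ with h1 | h1
  · exact Or.inl fun v hv => h1 hv
  · exact Or.inr fun k => h1 ⟨k, rfl⟩

/-- The dimension of an invariant subspace. -/
theorem finrank_invariant [Finite F] [Finite K] [Finite E] [FiniteDimensional F W]
    [FiniteDimensional F K] [FiniteDimensional F E] (hK : 3 ≤ Module.finrank F K)
    {Z : Submodule F ((W × K) × E)}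
    (hZ : ∀ v ∈ Z, blockHom F W K E (σ, Units.scale χ ξ, Units.scale f ω) v ∈ Z) :
    ∃ i j k, (i = 0 ∨ i = Module.finrank F W) ∧ (j = 0 ∨ j = Module.finrank F K) ∧
      (k = 0 ∨ k = Module.finrank F E) ∧ Module.finrank F Z = i + j + k := by
  have hpow : ∀ m : ℕ, ∀ v ∈ Z,
      (blockHom F W K E (σ, Units.scale χ ξ, Units.scale f ω) ^ m) v ∈ Z := by
    intro m
    induction m with
    | zero => intro v hv; simpa using hv
    | succ m ih =>
      intro v hv
      rw [pow_succ', LinearEquiv.mul_apply]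
      exact hZ _ (ih v hv)
  obtain ⟨MK, hMK, hK1⟩ : ∃ M : Submodule F K, (M = ⊥ ∨ M = ⊤) ∧
      ∀ v ∈ Z, v.1.2 ∈ M ∧ ∀ k ∈ M, ((0, k), 0) ∈ Z := by
    rcases h.mem_or_left (Z := Z) (by rw [← h.pow_eq_left χ f]; exact hpow _) with h1 | h1
    · refine ⟨⊥, Or.inl rfl, fun v hv => ⟨h1 v hv, fun k hk => ?_⟩⟩
      rw [(Submodule.mem_bot F).1 hk]
      exact Z.zero_mem
    · exact ⟨⊤, Or.inr rfl, fun v hv => ⟨trivial, fun k _ => h1 k⟩⟩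
  obtain ⟨ME, hME, hE1⟩ : ∃ M : Submodule F E, (M = ⊥ ∨ M = ⊤) ∧
      ∀ v ∈ Z, v.2 ∈ M ∧ ∀ k ∈ M, ((0 : W × K), k) ∈ Z := by
    rcases h.mem_or_right hK (Z := Z) (by rw [← h.pow_eq_right χ f]; exact hpow _) with h1 | h1
    · refine ⟨⊥, Or.inl rfl, fun v hv => ⟨h1 v hv, fun k hk => ?_⟩⟩
      rw [(Submodule.mem_bot F).1 hk]
      exact Z.zero_mem
    · exact ⟨⊤, Or.inr rfl, fun v hv => ⟨trivial, fun k _ => h1 k⟩⟩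
  set MW : Submodule F W := Z.comap (LinearMap.inl F (W × K) E ∘ₗ LinearMap.inl F W K) with hMWd
  have hMWmem : ∀ w, w ∈ MW ↔ ((w, 0), 0) ∈ Z := fun w => Iff.rfl
  have hMW : MW = ⊥ ∨ MW = ⊤ := by
    refine h.irr _ fun w hw => ?_
    have := hZ _ ((hMWmem w).1 hw)
    simpa [hMWmem] using this
  have hZeq : Z = (MW.prod MK).prod ME := by
    ext ⟨⟨w, k⟩, e⟩
    simp only [Submodule.mem_prod, hMWmem]
    constructor
    · intro hv
      have hk := hK1 _ hv
      have he := hE1 _ hv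
      refine ⟨⟨?_, hk.1⟩, he.1⟩
      have := Z.sub_mem (Z.sub_mem hv (hk.2 _ hk.1)) (he.2 _ he.1)
      simpa using this
    · rintro ⟨⟨hw, hk⟩, he⟩
      have := Z.add_mem (Z.add_mem hw ((hK1 _ Z.zero_mem).2 _ hk)) ((hE1 _ Z.zero_mem).2 _ he)
      simpa using this
  refine ⟨_, _, _, Submodule.finrank_eq_zero_or hMW, Submodule.finrank_eq_zero_or hMK,
    Submodule.finrank_eq_zero_or hME, ?_⟩
  rw [hZeq, Submodule.finrank_prod_eq, Submodule.finrank_prod_eq]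

end IsBlockDatum

end BlockElements

section BlockElementGroups

variable {F W K E : Type*} [Field F] [AddCommGroup W] [Module F W] [Field K] [Algebra F K] [Field E]
  [Algebra F E]

namespace IsBlockDatum

variable {σ : W ≃ₗ[F] W} {ρ r : ℕ} {ξ : Kˣ} {ω : Eˣ} (h : IsBlockDatum σ ρ r ξ ω) (χ f : Fˣ)
  [Finite F] [Finite K] [Finite E] [FiniteDimensional F W] [FiniteDimensional F K]
  [FiniteDimensional F E] {H : Subgroup (((W × K) × E) ≃ₗ[F] ((W × K) × E))}
  (hx : blockHom F W K E (σ, Units.scale χ ξ, Units.scale f ω) ∈ H)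
  (hH : ∀ M : Submodule F ((W × K) × E), (∀ h ∈ H, ∀ v ∈ M, h v ∈ M) → M = ⊥ ∨ M = ⊤)
include h hx

omit [Finite F] [Finite K] [FiniteDimensional F W] [FiniteDimensional F K]
  [FiniteDimensional F E] in
theorem exists_twist (z : E) (hz : z ≠ 0) : ∃ g ∈ H.scalarSup,
    (∀ u ∈ (⊥ : Submodule F W).prod (⊤ : Submodule F K), g (u, 0) = (u, 0)) ∧
      ∃ a : F, a ≠ 0 ∧ ∀ w : E, g (0, w) = (0, (a • z) * w) := by
  obtain ⟨m, hm⟩ := exists_pow_eq_self_of_coprime (x := ω) (n := ρ * r)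
    (by rw [h.orderOf_right]; exact h.coprime_mul)
  have hgen : Units.mk0 z hz ∈ Subgroup.zpowers ω := by
    have : Subgroup.zpowers ω = ⊤ := by
      refine Subgroup.eq_top_of_card_eq _ ?_
      rw [Nat.card_zpowers, h.orderOf_right, Nat.card_units]
    rw [this]
    trivial
  obtain ⟨i, hi⟩ := (mem_powers_iff_mem_zpowers.2 hgen)
  have hωj : ω ^ (ρ * r * (m * i)) = Units.mk0 z hz := by
    rw [← mul_assoc, pow_mul, pow_mul, hm]
    exact hi
  set j := ρ * r * (m * i) with hj
  have hσj : σ ^ j = 1 := by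
    rw [hj, mul_assoc, pow_mul, h.pow, one_pow]
  have hξj : ξ ^ j = 1 := by
    rw [hj, mul_right_comm, mul_comm, pow_mul, ← h.orderOf_left, pow_orderOf_eq_one, one_pow]
  refine ⟨DistribMulAction.toModuleAut F ((W × K) × E) (χ ^ j)⁻¹ *
    blockHom F W K E (σ, Units.scale χ ξ, Units.scale f ω) ^ j, ?_, ?_, ?_⟩
  · refine Subgroup.mem_scalarSup.2 ⟨_, H.pow_mem hx j, ((χ ^ j)⁻¹ : Fˣ), Units.ne_zero _,
      fun v => rfl⟩
  · rintro ⟨w, k⟩ ⟨hw, -⟩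
    have hw : w = 0 := hw
    subst hw
    rw [LinearEquiv.mul_apply, ← map_pow]
    simp only [Prod.pow_mk, Units.scale_pow, hξj, blockHom_apply, map_zero, mul_zero,
      Units.scale_mul]
    refine Prod.ext (Prod.ext ?_ ?_) ?_
    · exact smul_zero _
    · change ((χ ^ j)⁻¹ : Fˣ) • ((χ ^ j : Fˣ) : F) • (((1 : Kˣ) : K) * k) = k
      rw [Units.smul_def, smul_smul, Units.inv_mul, one_smul, Units.val_one, one_mul]
    · exact smul_zero _
  · refine ⟨((χ ^ j)⁻¹ : Fˣ) * ((f ^ j : Fˣ) : F), mul_ne_zero (Units.ne_zero _) (Units.ne_zero _),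
      fun w => ?_⟩
    rw [LinearEquiv.mul_apply, ← map_pow]
    simp only [Prod.pow_mk, Units.scale_pow, blockHom_apply, Prod.fst_zero, Prod.snd_zero, map_zero,
      mul_zero, Units.scale_mul, hωj, Units.val_mk0]
    refine Prod.ext (Prod.ext ?_ ?_) ?_
    · exact smul_zero _
    · exact smul_zero _
    · change ((χ ^ j)⁻¹ : Fˣ) • ((f ^ j : Fˣ) : F) • (z * w) = _
      rw [Units.smul_def, smul_smul, smul_mul_assoc]

omit [FiniteDimensional F E] in
include hH in
theorem isBlockGroup : IsBlockGroup ((⊥ : Submodule F W).prod (⊤ : Submodule F K)) H.scalarSup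
    {γ | mulBlock F (W × K) γ ∈ H.scalarSup} where
  mem _ hγ := hγ
  card := by
    have hmem : ω ^ ((Nat.card F - 1) * (ρ * r)) ∈ H.scalarSup.comap (mulBlockHom F (W × K) E) := by
      change mulBlock F (W × K) _ ∈ H.scalarSup
      rw [mulBlock_eq_blockHom, ← h.pow_eq_right χ f]
      exact H.le_scalarSup (H.pow_mem hx _)
    have h1 : (Subgroup.zpowers (ω ^ ((Nat.card F - 1) * (ρ * r))) : Set Eˣ) ⊆
        {γ | mulBlock F (W × K) γ ∈ H.scalarSup} := by
      have := (Subgroup.zpowers_le (H := H.scalarSup.comap (mulBlockHom F (W × K) E))).2 hmem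
      exact this
    have h2 := Set.ncard_le_ncard h1 (Set.toFinite _)
    have h3 : (Subgroup.zpowers (ω ^ ((Nat.card F - 1) * (ρ * r))) : Set Eˣ).ncard =
        orderOf (ω ^ ((Nat.card F - 1) * (ρ * r))) := Nat.card_zpowers _
    have h4 : orderOf ω ∣ orderOf (ω ^ ((Nat.card F - 1) * (ρ * r))) * (Nat.card F - 1) := by
      have h5 : (ρ * r).Coprime (orderOf ω) := by rw [h.orderOf_right]; exact h.coprime_mul
      refine h5.symm.dvd_of_dvd_mul_right ?_
      rw [orderOf_dvd_iff_pow_eq_one, mul_assoc, mul_comm, pow_mul, pow_orderOf_eq_one]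
    have hF : 0 < Nat.card F - 1 := by have := Finite.one_lt_card (α := F); omega
    have h6 := Nat.le_of_dvd (Nat.mul_pos (orderOf_pos _) hF) h4
    rw [h.orderOf_right] at h6
    rw [h3] at h2
    exact h6.trans (Nat.mul_le_mul_right _ h2)
  twist := h.exists_twist χ f hx
  irr M hM := hH M fun g hg => hM g (H.le_scalarSup hg)
  dim := by
    rw [Module.finrank_prod]
    exact h.dim

theorem isSeparator (hK : 3 ≤ Module.finrank F K) : IsSeparator H.scalarSup
    (LinearMap.ker (LinearMap.snd F W K ∘ₗ LinearMap.fst F (W × K) E))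
    (inlSub E ((⊥ : Submodule F W).prod (⊤ : Submodule F K))) := by
  have hd := h.dim
  have hfin : Module.finrank F (inlSub E ((⊥ : Submodule F W).prod (⊤ : Submodule F K))) =
      Module.finrank F K := by
    rw [finrank_inlSub, Submodule.finrank_prod_eq, finrank_bot, finrank_top, zero_add]
  have hcompl : IsCompl (LinearMap.ker (LinearMap.snd F W K ∘ₗ LinearMap.fst F (W × K) E))
      (inlSub E ((⊥ : Submodule F W).prod (⊤ : Submodule F K))) := by
    constructor
    · rw [Submodule.disjoint_def]
      rintro ⟨⟨w, k⟩, e⟩ h1 h2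
      have h1 : k = 0 := h1
      obtain ⟨⟨h3, -⟩, h4⟩ := mem_inlSub.1 h2
      have h3 : w = 0 := h3
      have h4 : e = 0 := h4
      subst h1 h3 h4
      rfl
    · rw [codisjoint_iff, eq_top_iff]
      rintro ⟨⟨w, k⟩, e⟩ -
      refine Submodule.mem_sup.2 ⟨((w, 0), e), rfl, ((0, k), 0), mem_inlSub.2 ⟨⟨rfl, trivial⟩, rfl⟩,
        by simp⟩
  refine ⟨hcompl, ?_, ?_, ?_, ?_⟩
  · intro h0
    rw [h0, finrank_bot] at hfin
    omega
  · rw [hfin]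
    exact h.finrank_coprime
  · have := Submodule.finrank_add_eq_of_isCompl hcompl
    rw [hfin, Module.finrank_prod, Module.finrank_prod] at this
    rw [Module.finrank_prod]
    omega
  · refine ⟨_, H.le_scalarSup (H.pow_mem hx ((Nat.card F - 1) * (ρ * (Nat.card E - 1)))), ?_⟩
    rw [h.pow_eq_left χ f]
    refine ⟨?_, ?_, fun Z hZ => ?_⟩
    · rintro ⟨⟨w, k⟩, e⟩ hk
      have hk : k = 0 := hk
      simp [hk]
    · rintro ⟨⟨w, k⟩, e⟩ hv
      obtain ⟨⟨h3, -⟩, h4⟩ := mem_inlSub.1 hv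
      have h3 : w = 0 := h3
      have h4 : e = 0 := h4
      subst h3 h4
      exact mem_inlSub.2 ⟨⟨by simp, trivial⟩, by simp⟩
    · refine (h.mem_or_left hZ).imp (fun h1 v hv => h1 v hv) ?_
      rintro h1 ⟨⟨w, k⟩, e⟩ hv
      obtain ⟨⟨h3, -⟩, h4⟩ := mem_inlSub.1 hv
      have h3 : w = 0 := h3
      have h4 : e = 0 := h4
      subst h3 h4
      exact h1 k

include hH in
/-- An irreducible group containing a block element contains every map of determinant one. -/
theorem mem_of_det_eq_one (hK : 3 ≤ Module.finrank F K)
    (g : ((W × K) × E) ≃ₗ[F] ((W × K) × E))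
    (hg : LinearMap.det (g : ((W × K) × E) →ₗ[F] ((W × K) × E)) = 1) : g ∈ H := by
  have : Finite W := Module.finite_of_finite F
  have hd := h.dim
  have hG := h.isBlockGroup χ f hx hH
  have hz := h.isSeparator χ f hx hK
  have hU : Module.finrank F (W × K) = Module.finrank F W + Module.finrank F K :=
    Module.finrank_prod
  have hU₁ : Module.finrank F ((⊥ : Submodule F W).prod (⊤ : Submodule F K)) =
      Module.finrank F K := by
    rw [Submodule.finrank_prod_eq, finrank_bot, finrank_top, zero_add]
  have hproj : ∀ i, i ≤ Module.finrank F K → i < Module.finrank F (W × K) →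
      ProjTrans H.scalarSup i := fun i hi hi' => hG.projTrans hz i (by rw [hU₁]; exact hi) hi'
  have htr : ∃ t ∈ H.scalarSup, ∃ φ : Module.Dual F ((W × K) × E), φ ≠ 0 ∧ ∃ b, b ≠ 0 ∧ φ b = 0 ∧
      ∀ v, t v = v + φ v • b := by
    rcases Nat.eq_zero_or_pos (Module.finrank F W) with h0 | hpos
    · obtain ⟨r', hr', hdvd, hmin⟩ := h.exists_prime_dvd hK
      have htop : (⊥ : Submodule F W).prod (⊤ : Submodule F K) = ⊤ :=
        Submodule.eq_top_of_finrank_eq (by rw [hU₁, hU, h0, zero_add])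
      rw [htop] at hG
      exact hG.exists_transvection (by omega) (hproj _ (by omega) (by omega)) hr' hdvd hmin
    · obtain ⟨z, hzH, hzP, hzM, -⟩ := hz.exists_mem
      refine exists_transvection_of_fixed_compl hz.isCompl ?_ ?_ ?_
        (H.le_scalarSup (H.pow_mem hx ((Nat.card F - 1) * (ρ * (Nat.card E - 1))))) ?_ ?_ ?_
      · intro hP
        have := hz.le
        rw [hP, finrank_bot] at this
        omega
      · rw [finrank_inlSub, hU₁, Module.finrank_prod]
        omega
      · intro j hj
        rw [finrank_inlSub, hU₁] at hj
        exact hproj j hj (by omega)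
      · rw [h.pow_eq_left χ f]
        rintro ⟨⟨w, k⟩, e⟩ hk
        have hk : k = 0 := hk
        simp [hk]
      · rw [h.pow_eq_left χ f]
        rintro ⟨⟨w, k⟩, e⟩ hv
        obtain ⟨⟨h3, -⟩, h4⟩ := mem_inlSub.1 hv
        have h3 : w = 0 := h3
        have h4 : e = 0 := h4
        subst h3 h4
        exact mem_inlSub.2 ⟨⟨by simp, trivial⟩, by simp⟩
      · rw [h.pow_eq_left χ f]
        refine ⟨((0, 1), 0), mem_inlSub.2 ⟨⟨rfl, trivial⟩, rfl⟩, fun h1 => h.ne_one_left ?_⟩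
        simpa using h1
  have hroot := hG.forall_mem_rootGroup (by omega) (hproj 0 (by omega) (by omega))
    (hproj 1 (by omega) (by omega)) htr
  refine mem_of_det_eq_one_of_forall_mem_rootGroup
    (Subgroup.forall_mem_rootGroup_of_scalarSup ?_ hroot) g hg
  rw [Module.finrank_prod]
  omega

end IsBlockDatum

end BlockElementGroups

section GenElements

variable {F V V' : Type*} [Field F] [AddCommGroup V'] [Module F V'] [AddCommGroup V] [Module F V]

/-- An automorphism all of whose invariant subspaces have dimension or codimension in `D`, and such
that any irreducible group containing it contains the special linear group. -/
structure IsGenElement (D : Set ℕ) (x : V ≃ₗ[F] V) : Prop where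
  finrank_mem : ∀ Z : Submodule F V, (∀ v ∈ Z, x v ∈ Z) →
    ∃ d ∈ D, Module.finrank F Z = d ∨ Module.finrank F Z + d = Module.finrank F V
  mem_of_det : ∀ H : Subgroup (V ≃ₗ[F] V), x ∈ H →
    (∀ M : Submodule F V, (∀ h ∈ H, ∀ v ∈ M, h v ∈ M) → M = ⊥ ∨ M = ⊤) →
      ∀ g : V ≃ₗ[F] V, LinearMap.det (g : V →ₗ[F] V) = 1 → g ∈ H

theorem IsGenElement.mono {D D' : Set ℕ} {x : V ≃ₗ[F] V} (h : IsGenElement D x) (hD : D ⊆ D') :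
    IsGenElement D' x :=
  ⟨fun Z hZ => let ⟨d, hd, h'⟩ := h.finrank_mem Z hZ; ⟨d, hD hd, h'⟩, h.mem_of_det⟩

/-- Conjugation by a linear equivalence. -/
def LinearEquiv.conjGroupHom (e : V ≃ₗ[F] V') : (V ≃ₗ[F] V) ≃* (V' ≃ₗ[F] V') where
  toFun x := e.symm.trans (x.trans e)
  invFun y := e.trans (y.trans e.symm)
  left_inv x := LinearEquiv.ext fun v => by simp
  right_inv x := LinearEquiv.ext fun v => by simp
  map_mul' x y := LinearEquiv.ext fun v => by simp [LinearEquiv.mul_apply]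

@[simp] theorem LinearEquiv.conjGroupHom_apply (e : V ≃ₗ[F] V') (x : V ≃ₗ[F] V) (v : V') :
    e.conjGroupHom x v = e (x (e.symm v)) := rfl

theorem LinearEquiv.det_conjGroupHom (e : V ≃ₗ[F] V') (x : V ≃ₗ[F] V) :
    LinearMap.det (e.conjGroupHom x : V' →ₗ[F] V') = LinearMap.det (x : V →ₗ[F] V) := by
  rw [← LinearMap.det_conj (x : V →ₗ[F] V) e]
  congr 1

theorem IsGenElement.conj {D : Set ℕ} {x : V ≃ₗ[F] V} (h : IsGenElement D x) (e : V ≃ₗ[F] V') :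
    IsGenElement D (e.conjGroupHom x) where
  finrank_mem Z hZ := by
    obtain ⟨d, hd, h'⟩ := h.finrank_mem (Z.comap (e : V →ₗ[F] V')) fun v hv => by
      have := hZ _ hv
      simpa using this
    rw [Submodule.comap_equiv_eq_map_symm, LinearEquiv.finrank_map_eq, e.finrank_eq] at h'
    exact ⟨d, hd, h'⟩
  mem_of_det H hx hH g hg := by
    have h1 : e.conjGroupHom.symm g ∈ H.comap e.conjGroupHom.toMonoidHom := by
      refine h.mem_of_det _ hx (fun M hM => ?_) _ ?_
      · have hM' : ∀ h ∈ H, ∀ v ∈ M.map (e : V →ₗ[F] V'), h v ∈ M.map (e : V →ₗ[F] V') := by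
          rintro g hg _ ⟨v, hv, rfl⟩
          refine ⟨e.conjGroupHom.symm g v, hM _ ?_ v hv, ?_⟩
          · simpa using hg
          · change e (e.symm (g (e v))) = g (e v)
            simp
        refine (hH _ hM').imp (fun h => (Submodule.map_eq_bot_iff (e := e)).1 h) fun h => ?_
        refine Submodule.map_injective_of_injective e.injective ?_
        rw [h, Submodule.map_top, LinearEquiv.range]
      · rw [← hg, ← e.det_conjGroupHom, MulEquiv.apply_symm_apply]
    simpa using h1

theorem exists_finite_extension (F : Type*) [Field F] [Finite F] {n : ℕ} (hn : 0 < n) :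
    ∃ (E : Type) (_ : Field E) (_ : Algebra F E) (_ : Finite E), Module.finrank F E = n := by
  obtain ⟨p, hp⟩ := CharP.exists F
  have : Fact p.Prime := ⟨CharP.char_is_prime F p⟩
  have : NeZero n := ⟨hn.ne'⟩
  exact ⟨FiniteField.Extension F p n, inferInstance, inferInstance, inferInstance,
    FiniteField.finrank_extension F p n⟩

theorem exists_isGenElement_of_block [Finite F] {W : Type*} [AddCommGroup W] [Module F W]
    [FiniteDimensional F W] {σ : W ≃ₗ[F] W} {ρ b c r : ℕ} (hσ : σ ^ ρ = 1)
    (hirr : ∀ M : Submodule F W, (∀ v ∈ M, σ v ∈ M) → M = ⊥ ∨ M = ⊤)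
    (hρ : ρ.Coprime (Nat.card F ^ c - 1)) (hr : r.Prime) (hrb : r ∣ Nat.card F ^ b - 1)
    (hmin : ∀ j, 0 < j → j < b → ¬ r ∣ Nat.card F ^ j - 1) (hrρ : ¬ r ∣ ρ)
    (hb : 3 ≤ b) (hbc : b.Coprime c) (hd : Module.finrank F W + b + 4 ≤ c)
    (hV : Module.finrank F V = Module.finrank F W + b + c) (δ : Fˣ) :
    ∃ x : V ≃ₗ[F] V, LinearMap.det (x : V →ₗ[F] V) = δ ∧
      IsGenElement {0, Module.finrank F W, b, Module.finrank F W + b} x := by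
  obtain ⟨K, _, _, _, hK⟩ := exists_finite_extension F (show 0 < b by omega)
  obtain ⟨E, _, _, _, hE⟩ := exists_finite_extension F (show 0 < c by omega)
  have : FiniteDimensional F K := .of_finite
  have : FiniteDimensional F E := .of_finite
  have hcK : Nat.card K = Nat.card F ^ b := by rw [Module.natCard_eq_pow_finrank (K := F), hK]
  have hcE : Nat.card E = Nat.card F ^ c := by rw [Module.natCard_eq_pow_finrank (K := F), hE]
  have : Fact r.Prime := ⟨hr⟩
  obtain ⟨ξ, hξ⟩ : ∃ ξ : Kˣ, orderOf ξ = r := by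
    refine exists_prime_orderOf_dvd_card' r ?_
    rwa [Nat.card_units, hcK]
  obtain ⟨ω, hω⟩ := IsCyclic.exists_ofOrder_eq_natCard (α := Eˣ)
  rw [Nat.card_units] at hω
  have h : IsBlockDatum σ ρ r ξ ω :=
    { pow := hσ
      coprime := by rwa [hcE]
      irr := hirr
      prime := hr
      orderOf_left := hξ
      min := by rwa [hK]
      not_dvd := hrρ
      not_dvd' := by
        rw [hcE]
        intro h'
        have := Nat.dvd_of_prime_dvd_pow_sub_one (by omega) hrb hmin h'
        have := Nat.eq_one_of_dvd_coprimes hbc dvd_rfl this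
        omega
      orderOf_right := hω
      finrank_coprime := by rwa [hK, hE]
      dim := by rwa [hK, hE] }
  have : FiniteDimensional F V := Module.finite_of_finrank_pos (by omega)
  have hdim : Module.finrank F ((W × K) × E) = Module.finrank F V := by
    rw [Module.finrank_prod, Module.finrank_prod, hK, hE, hV]
  have e : ((W × K) × E) ≃ₗ[F] V := LinearEquiv.ofFinrankEq _ _ hdim
  obtain ⟨χ, f, hdet⟩ : ∃ χ f : Fˣ, LinearMap.det (blockHom F W K E
      (σ, Units.scale χ ξ, Units.scale f ω) : ((W × K) × E) →ₗ[F] ((W × K) × E)) = δ := by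
    set u : Fˣ := δ * (LinearEquiv.det σ * Units.map (Algebra.norm F) ξ *
      Units.map (Algebra.norm F) ω)⁻¹ with hu
    refine ⟨u ^ b.gcdA c, u ^ b.gcdB c, ?_⟩
    have h1 : (u ^ b.gcdA c) ^ b * (u ^ b.gcdB c) ^ c = u := by
      rw [← zpow_natCast, ← zpow_natCast, ← zpow_mul, ← zpow_mul, ← zpow_add, mul_comm,
        mul_comm (b.gcdB c), ← Nat.gcd_eq_gcd_ab, hbc.gcd_eq_one, Nat.cast_one, zpow_one]
    have h2 : δ = LinearEquiv.det σ * ((u ^ b.gcdA c) ^ b * Units.map (Algebra.norm F) ξ) *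
        ((u ^ b.gcdB c) ^ c * Units.map (Algebra.norm F) ω) := by
      calc δ = u * (LinearEquiv.det σ * Units.map (Algebra.norm F) ξ *
          Units.map (Algebra.norm F) ω) := by rw [hu, inv_mul_cancel_right]
        _ = _ := by
          nth_rewrite 1 [← h1]
          simp only [mul_assoc, mul_left_comm, mul_comm]
    rw [det_blockHom, h2]
    simp only [Units.scale, Units.val_mul, map_mul, Units.coe_map, MonoidHom.coe_coe,
      Algebra.norm_algebraMap, hK, hE, LinearEquiv.coe_det, Units.val_pow_eq_pow_val]
  refine ⟨e.conjGroupHom (blockHom F W K E (σ, Units.scale χ ξ, Units.scale f ω)), ?_,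
    IsGenElement.conj ⟨fun Z hZ => ?_, fun H hx hH g hg => ?_⟩ e⟩
  · rw [e.det_conjGroupHom, hdet]
  · obtain ⟨i, j, k, hi, hj, hk, hZ⟩ := h.finrank_invariant χ f (by omega) hZ
    rw [hZ, hdim, hV]
    rw [hK] at hj
    rw [hE] at hk
    rcases hi with rfl | rfl <;> rcases hj with rfl | rfl <;> rcases hk with rfl | rfl
    · exact ⟨0, by simp, Or.inl rfl⟩
    · exact ⟨_, Or.inr (Or.inr (Or.inr rfl)), Or.inr (by ring)⟩
    · exact ⟨_, Or.inr (Or.inr (Or.inl rfl)), Or.inl (by ring)⟩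
    · exact ⟨_, Or.inr (Or.inl rfl), Or.inr (by ring)⟩
    · exact ⟨_, Or.inr (Or.inl rfl), Or.inl (by ring)⟩
    · exact ⟨_, Or.inr (Or.inr (Or.inl rfl)), Or.inr (by ring)⟩
    · exact ⟨_, Or.inr (Or.inr (Or.inr rfl)), Or.inl (by ring)⟩
    · exact ⟨0, by simp, Or.inr (by ring)⟩
  · exact h.mem_of_det_eq_one χ f hx hH (by omega) g hg

/-- One block of dimension `b`. -/
theorem exists_isGenElement_single [Finite F] {b c : ℕ} (hb : 3 ≤ b) (hb6 : b ≠ 6)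
    (hbc : b.Coprime c) (hd : b + 4 ≤ c) (hV : Module.finrank F V = b + c) (δ : Fˣ) :
    ∃ x : V ≃ₗ[F] V, LinearMap.det (x : V →ₗ[F] V) = δ ∧ IsGenElement {0, b} x := by
  obtain ⟨r, hr, hrb, hmin⟩ := exists_prime_dvd_pow_sub_one (q := Nat.card F) Finite.one_lt_card hb
    hb6
  have h0 : Module.finrank F (Fin 0 → F) = 0 := by simp
  obtain ⟨x, hx, h⟩ := exists_isGenElement_of_block (W := Fin 0 → F) (σ := 1) (ρ := 1) (pow_one 1)
    (fun M _ => Or.inl (Subsingleton.elim _ _)) (Nat.coprime_one_left _) hr hrb hmin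
    hr.not_dvd_one hb hbc (by omega) (by omega) (V := V) δ
  rw [h0, zero_add] at h
  exact ⟨x, hx, h.mono fun d hd => by simpa using hd⟩

/-- A block of dimension `b` and a block of dimension one. -/
theorem exists_isGenElement_one [Finite F] {b c : ℕ} (hb : 3 ≤ b) (hb6 : b ≠ 6)
    (hbc : b.Coprime c) (hd : b + 5 ≤ c) (hV : Module.finrank F V = 1 + b + c) (δ : Fˣ) :
    ∃ x : V ≃ₗ[F] V, LinearMap.det (x : V →ₗ[F] V) = δ ∧ IsGenElement {0, 1, b, b + 1} x := by
  obtain ⟨r, hr, hrb, hmin⟩ := exists_prime_dvd_pow_sub_one (q := Nat.card F) Finite.one_lt_card hb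
    hb6
  have h1 : Module.finrank F F = 1 := Module.finrank_self F
  obtain ⟨x, hx, h⟩ := exists_isGenElement_of_block (W := F) (σ := 1) (ρ := 1) (pow_one 1)
    (fun M _ => eq_bot_or_eq_top M) (Nat.coprime_one_left _) hr hrb hmin
    hr.not_dvd_one hb hbc (by omega) (by omega) (V := V) δ
  rw [h1, add_comm] at h
  exact ⟨x, hx, h⟩

/-- Two blocks, of dimensions `a` and `b`. -/
theorem exists_isGenElement_pair [Finite F] {a b c : ℕ} (ha : 3 ≤ a) (ha6 : a ≠ 6) (hb : 3 ≤ b)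
    (hb6 : b ≠ 6) (hab : a ≠ b) (hac : ¬ a ∣ c)
    (hbc : b.Coprime c) (hd : a + b + 4 ≤ c) (hV : Module.finrank F V = a + b + c) (δ : Fˣ) :
    ∃ x : V ≃ₗ[F] V, LinearMap.det (x : V →ₗ[F] V) = δ ∧ IsGenElement {0, a, b, a + b} x := by
  obtain ⟨r, hr, hrb, hmin⟩ := exists_prime_dvd_pow_sub_one (q := Nat.card F) Finite.one_lt_card hb
    hb6
  obtain ⟨s, hs, hsa, hsmin⟩ :=
    exists_prime_dvd_pow_sub_one (q := Nat.card F) Finite.one_lt_card ha ha6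
  obtain ⟨K, _, _, _, hK⟩ := exists_finite_extension F (show 0 < a by omega)
  have : FiniteDimensional F K := .of_finite
  have hcK : Nat.card K = Nat.card F ^ a := by rw [Module.natCard_eq_pow_finrank (K := F), hK]
  have : Fact s.Prime := ⟨hs⟩
  obtain ⟨ξ, hξ⟩ : ∃ ξ : Kˣ, orderOf ξ = s := by
    refine exists_prime_orderOf_dvd_card' s ?_
    rwa [Nat.card_units, hcK]
  have hξ1 : (ξ : K) ≠ 1 := by
    intro h'
    have h1 : ξ = 1 := Units.ext h'
    rw [h1, orderOf_one] at hξ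
    exact hs.one_lt.ne hξ
  have hrs : r ≠ s := by
    rintro rfl
    exact hab (Nat.dvd_antisymm (Nat.dvd_of_prime_dvd_pow_sub_one (by omega) hrb hmin hsa |>
      fun h =>
      Nat.dvd_of_prime_dvd_pow_sub_one (by omega) hsa hsmin hrb)
      (Nat.dvd_of_prime_dvd_pow_sub_one (by omega) hrb hmin hsa))
  obtain ⟨x, hx, h⟩ := exists_isGenElement_of_block (W := K) (σ := unitsMulHom F K ξ) (ρ := s)
    (by rw [← map_pow, ← hξ, pow_orderOf_eq_one, map_one])
    (fun M hM => by
      rcases Submodule.le_ker_or_range_le_of_mul (g := unitsMulHom F K ξ) (ι := LinearMap.id)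
        (π := LinearMap.id) (fun k => rfl) hξ1
        (Algebra.adjoin_eq_top_of_prime_dvd_orderOf (by rwa [hK]) ξ hξ.symm.dvd)
        (fun v => by simp [sub_mul]) hM with h | h
      · rw [LinearMap.ker_id] at h
        exact Or.inl (le_bot_iff.1 h)
      · rw [LinearMap.range_id] at h
        exact Or.inr (top_le_iff.1 h))
    ((Nat.Prime.coprime_iff_not_dvd hs).2 fun h' =>
      hac (Nat.dvd_of_prime_dvd_pow_sub_one (by omega) hsa hsmin h')) hr hrb hmin
    (fun h' => hrs ((Nat.prime_dvd_prime_iff_eq hr hs).1 h')) hb hbc (by omega) (by omega)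
    (V := V) δ
  rw [hK] at h
  exact ⟨x, hx, h⟩

end GenElements

section BlockDimensions

/-- The block dimensions that occur, together with the dimensions of sums of blocks. -/
def IsBlockDims (n : ℕ) (D : Set ℕ) : Prop :=
  (∃ b, 3 ≤ b ∧ b ≠ 6 ∧ b.Coprime n ∧ 2 * b + 4 ≤ n ∧ D = {0, b}) ∨
  (∃ b, 3 ≤ b ∧ b ≠ 6 ∧ b.Coprime (n - 1) ∧ 2 * b + 6 ≤ n ∧ D = {0, 1, b, b + 1}) ∨
  ∃ a b c, 3 ≤ a ∧ a ≠ 6 ∧ 3 ≤ b ∧ b ≠ 6 ∧ a ≠ b ∧ ¬ a ∣ c ∧ b.Coprime c ∧ a + b + 4 ≤ c ∧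
    n = a + b + c ∧ D = {0, a, b, a + b}

theorem IsBlockDims.two_mul_lt {n : ℕ} {D : Set ℕ} (h : IsBlockDims n D) {d : ℕ} (hd : d ∈ D) :
    2 * d < n := by
  rcases h with ⟨b, h1, h2, h3, h4, rfl⟩ | ⟨b, h1, h2, h3, h4, rfl⟩ |
    ⟨a, b, c, h1, h2, h3, h4, h5, h6, h7, h8, h9, rfl⟩ <;>
  simp only [Set.mem_insert_iff, Set.mem_singleton_iff] at hd <;> omega

theorem exists_isBlockDims_of_middle {n b : ℕ} (hn : 24 ≤ n) (hb : n + 2 ≤ 4 * b)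
    (hb' : 3 * b + 4 ≤ n) : ∃ D : Set ℕ, IsBlockDims n D ∧
    ∀ d ∈ D, d = 0 ∨ d + 3 * b + 1 = n ∧ d ≠ 6 ∨
      d = b ∨ d + 2 * b + 1 = n ∨ 3 * b + 7 = n ∧ 3 * d + 1 = n := by
  obtain ⟨a, ha⟩ : ∃ a, a + 3 * b + 1 = n := ⟨n - 3 * b - 1, by omega⟩
  by_cases h6 : a = 6
  · obtain ⟨m, hm⟩ : ∃ m, 3 * m + 1 = n := ⟨b + 2, by omega⟩
    refine ⟨{0, m}, Or.inl ⟨m, by omega, by omega, ?_, by omega, rfl⟩, ?_⟩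
    · rw [← hm]
      simp
    · simp only [Set.mem_insert_iff, Set.mem_singleton_iff]
      rintro d (rfl | rfl) <;> omega
  by_cases hdvd : a ∣ 2 * b + 1
  · refine ⟨{0, a}, Or.inl ⟨a, by omega, h6, ?_, by omega, rfl⟩, ?_⟩
    · have h1 : a ∣ 2 * n + 1 := by
        have h2 : 2 * n + 1 = 3 * (2 * b + 1) + 2 * a := by omega
        rw [h2]
        exact dvd_add (hdvd.mul_left 3) (dvd_mul_left a 2)
      have h3 : (2 * n + 1).Coprime n := by
        rw [Nat.coprime_comm, mul_comm]
        simp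
      exact h3.coprime_dvd_left h1
    · simp only [Set.mem_insert_iff, Set.mem_singleton_iff]
      rintro d (rfl | rfl) <;> omega
  · refine ⟨{0, a, b, a + b}, Or.inr (Or.inr ⟨a, b, 2 * b + 1, by omega, h6, by omega, by omega,
      by omega, hdvd, ?_, by omega, by omega, rfl⟩), ?_⟩
    · rw [mul_comm]
      simp
    · simp only [Set.mem_insert_iff, Set.mem_singleton_iff]
      rintro d (rfl | rfl | rfl | rfl) <;> omega

theorem isBlockDims_single {n b : ℕ} (h1 : 3 ≤ b) (h2 : b ≠ 6) (h3 : b.Coprime n)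
    (h4 : 2 * b + 4 ≤ n) : IsBlockDims n {0, b} := Or.inl ⟨b, h1, h2, h3, h4, rfl⟩

theorem isBlockDims_one {n b : ℕ} (h1 : 3 ≤ b) (h2 : b ≠ 6) (h3 : b.Coprime (n - 1))
    (h4 : 2 * b + 6 ≤ n) : IsBlockDims n {0, 1, b, b + 1} :=
  Or.inr (Or.inl ⟨b, h1, h2, h3, h4, rfl⟩)

theorem Nat.three_coprime {n : ℕ} (h : n % 3 ≠ 0) : Nat.Coprime 3 n :=
  (Nat.Prime.coprime_iff_not_dvd Nat.prime_three).2 fun h' => h (Nat.mod_eq_zero_of_dvd h')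

theorem Nat.four_coprime {n : ℕ} (h : n % 2 ≠ 0) : Nat.Coprime 4 n :=
  Nat.Coprime.pow_left 2 ((Nat.Prime.coprime_iff_not_dvd Nat.prime_two).2
    fun h' => h (Nat.mod_eq_zero_of_dvd h'))

theorem exists_isBlockDims_small {n : ℕ} (hn : 12 ≤ n) : ∃ D : Set ℕ, IsBlockDims n D ∧
    ∀ d ∈ D, d = 0 ∨ d ≤ 5 ∧ (d + 1) % 3 ≠ n % 3 := by
  have h3 : n % 3 = 0 ∨ n % 3 = 1 ∨ n % 3 = 2 := by omega
  rcases h3 with h3 | h3 | h3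
  · refine ⟨_, isBlockDims_one (b := 3) (by omega) (by omega) (Nat.three_coprime (by omega))
      (by omega), ?_⟩
    simp only [Set.mem_insert_iff, Set.mem_singleton_iff]
    rintro d (rfl | rfl | rfl | rfl) <;> omega
  · rcases Nat.even_or_odd n with h2 | h2
    · rw [Nat.even_iff] at h2
      refine ⟨_, isBlockDims_one (b := 4) (by omega) (by omega) (Nat.four_coprime (by omega))
        (by omega), ?_⟩
      simp only [Set.mem_insert_iff, Set.mem_singleton_iff]
      rintro d (rfl | rfl | rfl | rfl) <;> omega
    · rw [Nat.odd_iff] at h2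
      refine ⟨_, isBlockDims_single (b := 4) (by omega) (by omega) (Nat.four_coprime (by omega))
        (by omega), ?_⟩
      simp only [Set.mem_insert_iff, Set.mem_singleton_iff]
      rintro d (rfl | rfl) <;> omega
  · refine ⟨_, isBlockDims_single (b := 3) (by omega) (by omega) (Nat.three_coprime (by omega))
      (by omega), ?_⟩
    simp only [Set.mem_insert_iff, Set.mem_singleton_iff]
    rintro d (rfl | rfl) <;> omega

theorem exists_isBlockDims_extra_of_mod_three {n : ℕ} (hn : 24 ≤ n) (h : n % 12 = 3) :
    ∃ D D' : Set ℕ, IsBlockDims n D ∧ IsBlockDims n D' ∧ (∀ d ∈ D, d = 0 ∨ d = 4) ∧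
      ∀ d ∈ D', d = 0 ∨ d = 1 ∨ d = 9 ∨ d = 10 := by
  refine ⟨_, _, isBlockDims_single (b := 4) (by omega) (by omega) (Nat.four_coprime (by omega))
    (by omega), isBlockDims_one (b := 9) (by omega) (by omega) ?_ (by omega), ?_, ?_⟩
  · exact Nat.Coprime.pow_left 2 (Nat.three_coprime (n := n - 1) (by omega))
  · simp
  · simp

theorem exists_isBlockDims_extra_of_mod_zero {n : ℕ} (hn : 24 ≤ n) (h : n % 12 = 0) :
    ∃ D : Set ℕ, IsBlockDims n D ∧ ∀ d ∈ D, d = 0 ∨ 3 * d = n + 3 ∨ 3 * d + 3 = n := by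
  obtain ⟨t, rfl⟩ : 12 ∣ n := Nat.dvd_of_mod_eq_zero h
  by_cases ht : t % 3 = 2
  · refine ⟨_, isBlockDims_single (b := 4 * t - 1) (by omega) (by omega) ?_ (by omega), ?_⟩
    · rw [show 12 * t = 3 * (4 * t) by ring, Nat.coprime_mul_iff_right]
      refine ⟨(Nat.three_coprime (by omega)).symm, ?_⟩
      exact (Nat.coprime_sub_self_left (m := 4 * t) (n := 4 * t - 1) |> fun _ => by
        have : 4 * t = (4 * t - 1) + 1 := by omega
        nth_rewrite 2 [this]
        simp)
    · simp only [Set.mem_insert_iff, Set.mem_singleton_iff]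
      rintro d (rfl | rfl) <;> omega
  · refine ⟨_, isBlockDims_single (b := 4 * t + 1) (by omega) (by omega) ?_ (by omega), ?_⟩
    · rw [show 12 * t = 3 * (4 * t) by ring, Nat.coprime_mul_iff_right]
      refine ⟨(Nat.three_coprime (by omega)).symm, by simp⟩
    · simp only [Set.mem_insert_iff, Set.mem_singleton_iff]
      rintro d (rfl | rfl) <;> omega

/-- There are many families of block dimensions without common nonzero entries. -/
theorem exists_isBlockDims_family {n : ℕ} (hn : 12 ≤ n) :
    ∃ (ι : Type) (_ : Fintype ι) (D : ι → Set ℕ), n / 12 ≤ Fintype.card ι ∧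
      (∀ i, IsBlockDims n (D i)) ∧ ∀ i j, i ≠ j → ∀ d ∈ D i, d ∈ D j → d = 0 := by
  obtain ⟨D₀, hD₀, hD₀'⟩ := exists_isBlockDims_small hn
  rcases lt_or_ge n 24 with h24 | h24
  · refine ⟨Unit, inferInstance, fun _ => D₀, ?_, fun _ => hD₀, fun i j hij => absurd rfl hij⟩
    rw [Fintype.card_unit]
    omega
  have hmid : ∀ k, ∃ D : Fin k → Set ℕ, ∀ i : Fin k, 3 * (((n + 5) / 4) + i) + 4 ≤ n →
      (IsBlockDims n (D i) ∧ ∀ d ∈ D i,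
      d = 0 ∨ d + 3 * (((n + 5) / 4) + i) + 1 = n ∧ d ≠ 6 ∨
      d = (((n + 5) / 4) + i) ∨ d + 2 * (((n + 5) / 4) + i) + 1 = n ∨
        3 * (((n + 5) / 4) + i) + 7 = n ∧ 3 * d + 1 = n) := by
    intro k
    have : ∀ i : Fin k, ∃ D : Set ℕ, 3 * (((n + 5) / 4) + i) + 4 ≤ n →
        (IsBlockDims n D ∧ ∀ d ∈ D,
        d = 0 ∨ d + 3 * (((n + 5) / 4) + i) + 1 = n ∧ d ≠ 6 ∨
        d = (((n + 5) / 4) + i) ∨ d + 2 * (((n + 5) / 4) + i) + 1 = n ∨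
          3 * (((n + 5) / 4) + i) + 7 = n ∧ 3 * d + 1 = n) := by
      intro i
      by_cases h : 3 * (((n + 5) / 4) + i) + 4 ≤ n
      · obtain ⟨D, hD⟩ := exists_isBlockDims_of_middle h24
          (show n + 2 ≤ 4 * (((n + 5) / 4) + i) by omega) h
        exact ⟨D, fun _ => hD⟩
      · exact ⟨∅, fun h' => absurd h' h⟩
    choose D hD using this
    exact ⟨D, hD⟩
  by_cases hs : n % 12 = 0 ∨ n % 12 = 3
  · obtain ⟨D, hD⟩ := hmid (n / 12 - 2)
    have hD1 := fun i : Fin (n / 12 - 2) => (hD i (by have := i.2; omega)).1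
    have hD2 := fun i : Fin (n / 12 - 2) => (hD i (by have := i.2; omega)).2
    obtain ⟨D₁, D₂, h1, h2, h1', h2'⟩ : ∃ D D' : Set ℕ, IsBlockDims n D ∧ IsBlockDims n D' ∧
        (∀ d ∈ D, d = 0 ∨ d ≤ 5 ∧ (d + 1) % 3 ≠ n % 3 ∧ (n % 12 = 3 → d = 4)) ∧
        ∀ d ∈ D', d = 0 ∨ (n % 12 = 0 ∧ (3 * d = n + 3 ∨ 3 * d + 3 = n)) ∨
          (n % 12 = 3 ∧ (d = 1 ∨ d = 9 ∨ d = 10)) := by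
      rcases hs with hs | hs
      · obtain ⟨D', hD', h⟩ := exists_isBlockDims_extra_of_mod_zero h24 hs
        refine ⟨D₀, D', hD₀, hD', fun d hd => ?_, fun d hd => ?_⟩
        · have := hD₀' d hd
          omega
        · have := h d hd
          omega
      · obtain ⟨D, D', hD, hD', h, h'⟩ := exists_isBlockDims_extra_of_mod_three h24 hs
        refine ⟨D, D', hD, hD', fun d hd => ?_, fun d hd => ?_⟩
        · have := h d hd
          omega
        · have := h' d hd
          omega
    refine ⟨Option (Option (Fin (n / 12 - 2))), inferInstance,
      fun i => i.elim D₁ fun i => i.elim D₂ D, ?_, ?_, ?_⟩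
    · simp only [Fintype.card_option, Fintype.card_fin]
      omega
    · rintro (_ | _ | i)
      · exact h1
      · exact h2
      · exact hD1 i
    · have h12 : ∀ d ∈ D₁, d ∈ D₂ → d = 0 := fun d hd hd' => by
        have := h1' d hd
        have := h2' d hd'
        omega
      have h1D : ∀ i, ∀ d ∈ D₁, d ∈ D i → d = 0 := fun i d hd hd' => by
        have := h1' d hd
        have := hD2 i d hd'
        have := i.2
        omega
      have h2D : ∀ i, ∀ d ∈ D₂, d ∈ D i → d = 0 := fun i d hd hd' => by
        have := h2' d hd
        have := hD2 i d hd'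
        have := i.2
        omega
      rintro (_ | _ | i) (_ | _ | j) hij d hd hd'
      · exact absurd rfl hij
      · exact h12 d hd hd'
      · exact h1D j d hd hd'
      · exact h12 d hd' hd
      · exact absurd rfl hij
      · exact h2D j d hd hd'
      · exact h1D i d hd' hd
      · exact h2D i d hd' hd
      · have hij : (i : ℕ) ≠ j := fun h => hij (by rw [Fin.ext h])
        have := hD2 i d hd
        have := hD2 j d hd'
        have := i.2
        have := j.2
        omega
  · obtain ⟨D, hD⟩ := hmid (n / 12 - 1)
    have hD1 := fun i : Fin (n / 12 - 1) => (hD i (by have := i.2; omega)).1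
    have hD2 := fun i : Fin (n / 12 - 1) => (hD i (by have := i.2; omega)).2
    refine ⟨Option (Fin (n / 12 - 1)), inferInstance, fun i => i.elim D₀ D, ?_, ?_, ?_⟩
    · simp only [Fintype.card_option, Fintype.card_fin]
      omega
    · rintro (_ | i)
      · exact hD₀
      · exact hD1 i
    · have h0D : ∀ i, ∀ d ∈ D₀, d ∈ D i → d = 0 := fun i d hd hd' => by
        have := hD₀' d hd
        have := hD2 i d hd'
        have := i.2
        omega
      rintro (_ | i) (_ | j) hij d hd hd'
      · exact absurd rfl hij
      · exact h0D j d hd hd'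
      · exact h0D i d hd' hd
      · have hij : (i : ℕ) ≠ j := fun h => hij (by rw [Fin.ext h])
        have := hD2 i d hd
        have := hD2 j d hd'
        have := i.2
        have := j.2
        omega

end BlockDimensions

theorem card_le_kappaIndep {G : Type*} [Group G] [Finite G] {ι : Type*} [Fintype ι] (x : ι → G)
    (hnc : ∃ a b : G, a * b ≠ b * a)
    (h : ∀ i j, i ≠ j → ∀ g g', Subgroup.closure {g * x i * g⁻¹, g' * x j * g'⁻¹} = ⊤) :
    Fintype.card ι ≤ kappaIndep G := by
  classical
  let _ : Fintype (ConjClasses G) := Fintype.ofFinite _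
  have hinj : Function.Injective fun i => ConjClasses.mk (x i) := by
    intro i j hij
    by_contra hne
    obtain ⟨g, hg⟩ := isConj_iff.1 (ConjClasses.mk_eq_mk_iff_isConj.1 hij)
    have h1 := h i j hne g 1
    rw [hg, one_mul, inv_one, mul_one, Set.pair_eq_singleton] at h1
    obtain ⟨a, b, hab⟩ := hnc
    obtain ⟨k, rfl⟩ := Subgroup.mem_closure_singleton.1 (h1 ▸ Subgroup.mem_top a)
    obtain ⟨l, rfl⟩ := Subgroup.mem_closure_singleton.1 (h1 ▸ Subgroup.mem_top b)
    exact hab (by rw [← zpow_add, ← zpow_add, add_comm])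
  refine le_csSup ⟨Fintype.card (ConjClasses G), ?_⟩
    ⟨Finset.univ.image fun i => ConjClasses.mk (x i), ?_, ?_⟩
  · rintro _ ⟨S, rfl, -⟩
    exact Finset.card_le_univ S
  · rw [Finset.card_image_of_injective _ hinj, Finset.card_univ]
  · intro c hc d hd hcd a ha b hb
    obtain ⟨i, -, rfl⟩ := Finset.mem_image.1 hc
    obtain ⟨j, -, rfl⟩ := Finset.mem_image.1 hd
    rw [ConjClasses.mem_carrier_iff_mk_eq, ConjClasses.mk_eq_mk_iff_isConj] at ha hb
    obtain ⟨g, rfl⟩ := isConj_iff.1 ha.symm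
    obtain ⟨g', rfl⟩ := isConj_iff.1 hb.symm
    exact h i j (fun hij => hcd (by rw [hij])) g g'

section Representation

variable {F V G : Type*} [Field F] [AddCommGroup V] [Module F V] [Group G]
  {φ : G →* (V ≃ₗ[F] V)} (hφ : Function.Injective φ)
  (hdet : ∀ g : V ≃ₗ[F] V, LinearMap.det (g : V →ₗ[F] V) = 1 → g ∈ φ.range)

include hdet in
theorem mem_range_of_det_eq {g : V ≃ₗ[F] V} {a : G}
    (h : LinearEquiv.det g = LinearEquiv.det (φ a)) :
    g ∈ φ.range := by
  have h1 : g * (φ a)⁻¹ ∈ φ.range := by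
    refine hdet _ ?_
    rw [← LinearEquiv.coe_det, map_mul, map_inv, h, mul_inv_cancel, Units.val_one]
  simpa using φ.range.mul_mem h1 ⟨a, rfl⟩

include hφ in
theorem closure_pair_eq_top_of_irreducible {x y : G} {δ : Fˣ}
    (hδ : ∀ g, LinearEquiv.det (φ g) ∈ Subgroup.zpowers δ) (hxδ : LinearEquiv.det (φ x) = δ)
    (hx : ∀ H : Subgroup (V ≃ₗ[F] V), φ x ∈ H →
      (∀ M : Submodule F V, (∀ h ∈ H, ∀ v ∈ M, h v ∈ M) → M = ⊥ ∨ M = ⊤) →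
        ∀ g : V ≃ₗ[F] V, LinearMap.det (g : V →ₗ[F] V) = 1 → g ∈ H)
    (hirr : ∀ M : Submodule F V, (∀ v ∈ M, φ x v ∈ M) → (∀ v ∈ M, φ y v ∈ M) → M = ⊥ ∨ M = ⊤) :
    Subgroup.closure {x, y} = ⊤ := by
  have hxm : x ∈ Subgroup.closure {x, y} := Subgroup.subset_closure (by simp)
  have hym : y ∈ Subgroup.closure {x, y} := Subgroup.subset_closure (by simp)
  rw [eq_top_iff]
  intro g _
  obtain ⟨k, hk⟩ := hδ g
  have h1 : φ (g * (x ^ k)⁻¹) ∈ (Subgroup.closure {x, y}).map φ := by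
    refine hx _ (Subgroup.mem_map_of_mem φ hxm) (fun M hM =>
      hirr M (hM _ (Subgroup.mem_map_of_mem φ hxm)) (hM _ (Subgroup.mem_map_of_mem φ hym))) _ ?_
    rw [← LinearEquiv.coe_det, map_mul, map_mul, map_inv, map_inv, map_zpow, map_zpow, hxδ]
    change ((LinearEquiv.det (φ g) * (δ ^ k)⁻¹ : Fˣ) : F) = 1
    have hk : δ ^ k = LinearEquiv.det (φ g) := hk
    rw [hk, mul_inv_cancel, Units.val_one]
  obtain ⟨a, ha, hag⟩ := h1
  rw [hφ hag] at ha
  simpa using Subgroup.mul_mem _ ha (Subgroup.zpow_mem _ hxm k)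

end Representation

section Singer

variable {F V : Type*} [Field F] [Finite F] [AddCommGroup V] [Module F V]

/-- Irreducible automorphisms with a prescribed determinant. -/
theorem exists_irreducible_det_eq (hn : 3 ≤ Module.finrank F V) (hn6 : Module.finrank F V ≠ 6)
    (δ : Fˣ) : ∃ x : V ≃ₗ[F] V, LinearMap.det (x : V →ₗ[F] V) = δ ∧
      ∀ Z : Submodule F V, (∀ v ∈ Z, x v ∈ Z) → Z = ⊥ ∨ Z = ⊤ := by
  obtain ⟨E, _, _, _, hE⟩ := exists_finite_extension F (show 0 < Module.finrank F V by omega)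
  have : FiniteDimensional F E := .of_finite
  have : FiniteDimensional F V := Module.finite_of_finrank_pos (by omega)
  have hcE : Nat.card E = Nat.card F ^ Module.finrank F V := by
    rw [Module.natCard_eq_pow_finrank (K := F), hE]
  obtain ⟨r, hr, hrn, hmin⟩ :=
    exists_prime_dvd_pow_sub_one (q := Nat.card F) Finite.one_lt_card hn hn6
  have : Fact r.Prime := ⟨hr⟩
  obtain ⟨ξ, hξ⟩ : ∃ ξ : Eˣ, orderOf ξ = r := by
    refine exists_prime_orderOf_dvd_card' r ?_
    rwa [Nat.card_units, hcE]
  have hξN : Units.map (Algebra.norm F) ξ = 1 := by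
    rw [← orderOf_eq_one_iff]
    have h1 : orderOf (Units.map (Algebra.norm F) ξ) ∣ r := hξ ▸ orderOf_map_dvd _ ξ
    rcases (Nat.dvd_prime hr).1 h1 with h | h
    · exact h
    · have h2 := orderOf_dvd_natCard (Units.map (Algebra.norm F) ξ)
      rw [h, Nat.card_units] at h2
      exact absurd (by simpa using h2) (hmin 1 one_pos (by omega))
  obtain ⟨ω, hω⟩ := FiniteField.unitsMap_norm_surjective F E δ
  obtain ⟨y, hy, hyr⟩ : ∃ y : Eˣ, Units.map (Algebra.norm F) y = δ ∧ r ∣ orderOf y := by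
    by_cases h : r ∣ orderOf ω
    · exact ⟨ω, hω, h⟩
    refine ⟨ω * ξ, by rw [map_mul, hω, hξN, mul_one], ?_⟩
    rw [(Commute.all ω ξ).orderOf_mul_eq_mul_orderOf_of_coprime
      (by rw [hξ]; exact ((Nat.Prime.coprime_iff_not_dvd hr).2 h).symm), hξ]
    exact dvd_mul_left r _
  have e : E ≃ₗ[F] V := LinearEquiv.ofFinrankEq _ _ hE
  have hy1 : (y : E) ≠ 1 := by
    intro h'
    have h1 : y = 1 := Units.ext h'
    rw [h1, orderOf_one] at hyr
    exact hr.one_lt.ne' (Nat.dvd_one.1 hyr)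
  refine ⟨e.conjGroupHom (unitsMulHom F E y), ?_, fun Z hZ => ?_⟩
  · rw [e.det_conjGroupHom, ← hy]
    rfl
  · have hZ' : ∀ k ∈ Z.comap (e : E →ₗ[F] V), unitsMulHom F E y k ∈ Z.comap (e : E →ₗ[F] V) := by
      intro k hk
      have := hZ _ hk
      simpa using this
    have : Z.comap (e : E →ₗ[F] V) = ⊥ ∨ Z.comap (e : E →ₗ[F] V) = ⊤ := by
      rcases Submodule.le_ker_or_range_le_of_mul (g := unitsMulHom F E y) (ι := LinearMap.id)
        (π := LinearMap.id) (fun k => rfl) hy1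
        (Algebra.adjoin_eq_top_of_prime_dvd_orderOf (by rwa [hE]) y hyr)
        (fun v => by simp [sub_mul]) hZ' with h | h
      · rw [LinearMap.ker_id] at h
        exact Or.inl (le_bot_iff.1 h)
      · rw [LinearMap.range_id] at h
        exact Or.inr (top_le_iff.1 h)
    refine this.imp (fun h => ?_) fun h => ?_
    · rw [Submodule.comap_equiv_eq_map_symm] at h
      exact (Submodule.map_eq_bot_iff (e := e.symm)).1 h
    · refine Submodule.comap_injective_of_surjective (f := (e : E →ₗ[F] V)) e.surjective ?_
      rw [h, Submodule.comap_top]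

end Singer

section LowerBound

variable {F V G : Type*} [Field F] [Finite F] [AddCommGroup V] [Module F V] [Group G] [Finite G]
  {φ : G →* (V ≃ₗ[F] V)}

theorem exists_isGenElement_of_isBlockDims {D : Set ℕ} (hD : IsBlockDims (Module.finrank F V) D)
    (δ : Fˣ) : ∃ x : V ≃ₗ[F] V, LinearMap.det (x : V →ₗ[F] V) = δ ∧ IsGenElement D x := by
  rcases hD with ⟨b, h1, h2, h3, h4, rfl⟩ | ⟨b, h1, h2, h3, h4, rfl⟩ |
    ⟨a, b, c, h1, h2, h3, h4, h5, h6, h7, h8, h9, rfl⟩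
  · obtain ⟨c, hc⟩ : ∃ c, Module.finrank F V = b + c := ⟨_, (Nat.add_sub_of_le (by omega)).symm⟩
    refine exists_isGenElement_single h1 h2 (c := c) ?_ (by omega) hc δ
    rw [hc] at h3
    simpa using h3
  · obtain ⟨c, hc⟩ : ∃ c, Module.finrank F V = 1 + b + c :=
      ⟨_, (Nat.add_sub_of_le (by omega)).symm⟩
    refine exists_isGenElement_one h1 h2 (c := c) ?_ (by omega) hc δ
    rw [hc, show 1 + b + c - 1 = b + c by omega] at h3
    simpa using h3
  · exact exists_isGenElement_pair h1 h2 h3 h4 h5 h6 h7 h8 h9 δ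

theorem card_lt_kappaIndep_of_isBlockDims (hφ : Function.Injective φ)
    (hdet : ∀ g : V ≃ₗ[F] V, LinearMap.det (g : V →ₗ[F] V) = 1 → g ∈ φ.range)
    (hnc : ∃ a b : G, a * b ≠ b * a) (hn : 12 ≤ Module.finrank F V) {ι : Type*} [Fintype ι]
    {D : ι → Set ℕ} (hD : ∀ i, IsBlockDims (Module.finrank F V) (D i))
    (hdisj : ∀ i j, i ≠ j → ∀ d ∈ D i, d ∈ D j → d = 0) : Fintype.card ι < kappaIndep G := by
  have : FiniteDimensional F V := Module.finite_of_finrank_pos (by omega)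
  obtain ⟨⟨δ, g₀, hg₀⟩, hgen⟩ :=
    IsCyclic.exists_generator (α := (LinearEquiv.det.comp φ : G →* Fˣ).range)
  have hδ : ∀ g, LinearEquiv.det (φ g) ∈ Subgroup.zpowers δ := by
    intro g
    obtain ⟨k, hk⟩ := hgen ⟨_, g, rfl⟩
    exact ⟨k, congrArg Subtype.val hk⟩
  have hlift : ∀ X : V ≃ₗ[F] V, LinearMap.det (X : V →ₗ[F] V) = δ → ∃ x, φ x = X := by
    intro X hX
    refine mem_range_of_det_eq hdet (a := g₀) (Units.ext ?_)
    rw [LinearEquiv.coe_det, hX, ← hg₀]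
    rfl
  have hsing : ∃ s : G, ∀ Z : Submodule F V, (∀ v ∈ Z, φ s v ∈ Z) → Z = ⊥ ∨ Z = ⊤ := by
    obtain ⟨S, hS, hZ⟩ := exists_irreducible_det_eq (V := V) (by omega) (by omega) δ
    obtain ⟨s, rfl⟩ := hlift S hS
    exact ⟨s, hZ⟩
  obtain ⟨s, hs⟩ := hsing
  have hex : ∀ i, ∃ x : G, LinearEquiv.det (φ x) = δ ∧ IsGenElement (D i) (φ x) := by
    intro i
    obtain ⟨X, hX, h⟩ := exists_isGenElement_of_isBlockDims (hD i) δ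
    obtain ⟨x, rfl⟩ := hlift X hX
    exact ⟨x, Units.ext (by rw [LinearEquiv.coe_det, hX]), h⟩
  choose x hxδ hx using hex
  have hconj : ∀ (g y : G), φ (g * y * g⁻¹) = (φ g).conjGroupHom (φ y) := by
    intro g y
    rw [map_mul, map_mul, map_inv]
    rfl
  have hxδ' : ∀ i g, LinearEquiv.det (φ (g * x i * g⁻¹)) = δ := by
    intro i g
    rw [map_mul, map_mul, map_inv, map_mul, map_mul, map_inv, hxδ, mul_inv_cancel_comm]
  have hx' : ∀ i g, IsGenElement (D i) (φ (g * x i * g⁻¹)) := fun i g => by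
    rw [hconj]
    exact (hx i).conj _
  have hs' : ∀ g, ∀ Z : Submodule F V, (∀ v ∈ Z, φ (g * s * g⁻¹) v ∈ Z) → Z = ⊥ ∨ Z = ⊤ := by
    intro g Z hZ
    have h1 : ∀ v ∈ Z.comap (φ g : V →ₗ[F] V), φ s v ∈ Z.comap (φ g : V →ₗ[F] V) := by
      intro v hv
      have := hZ _ hv
      rw [hconj] at this
      simpa using this
    refine (hs _ h1).imp (fun h => ?_) fun h => ?_
    · rw [Submodule.comap_equiv_eq_map_symm] at h
      exact (Submodule.map_eq_bot_iff (e := (φ g).symm)).1 h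
    · refine Submodule.comap_injective_of_surjective (f := (φ g : V →ₗ[F] V)) (φ g).surjective ?_
      rw [h, Submodule.comap_top]
  have hsx : ∀ i g g', Subgroup.closure {g * x i * g⁻¹, g' * s * g'⁻¹} = ⊤ := fun i g g' =>
    closure_pair_eq_top_of_irreducible hφ hδ (hxδ' i g) (hx' i g).mem_of_det
      fun M _ hM => hs' g' M hM
  have hfin : ∀ {M : Submodule F V}, Module.finrank F M = 0 ∨
      Module.finrank F M = Module.finrank F V → M = ⊥ ∨ M = ⊤ := fun {M} h =>
    h.imp Submodule.finrank_eq_zero.1 Submodule.eq_top_of_finrank_eq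
  have hxx : ∀ i j, i ≠ j → ∀ g g', Subgroup.closure {g * x i * g⁻¹, g' * x j * g'⁻¹} = ⊤ := by
    intro i j hij g g'
    refine closure_pair_eq_top_of_irreducible hφ hδ (hxδ' i g) (hx' i g).mem_of_det
      fun M h1 h2 => hfin ?_
    obtain ⟨d, hd, h3⟩ := (hx' i g).finrank_mem M h1
    obtain ⟨d', hd', h4⟩ := (hx' j g').finrank_mem M h2
    have h5 := (hD i).two_mul_lt hd
    have h6 := (hD j).two_mul_lt hd'
    have h7 : d = d' → d = 0 := by
      rintro rfl
      exact hdisj i j hij d hd hd'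
    omega
  have := card_le_kappaIndep (ι := Option ι) (fun i => i.elim s x) hnc ?_
  · rw [Fintype.card_option] at this
    omega
  · rintro (_ | i) (_ | j) hij g g'
    · exact absurd rfl hij
    · rw [Set.pair_comm]
      exact hsx j g' g
    · exact hsx i g g'
    · exact hxx i j (fun h => hij (by rw [h])) g g'

end LowerBound

section Matrices

variable {F : Type*} [Field F] {n : ℕ}

/-- The action of a matrix group on column vectors. -/
noncomputable def Subgroup.columnHom (G : Subgroup (GL (Fin n) F)) :
    G →* ((Fin n → F) ≃ₗ[F] (Fin n → F)) :=
  ((LinearMap.GeneralLinearGroup.generalLinearEquiv F (Fin n → F)).toMonoidHom.comp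
    Matrix.GeneralLinearGroup.toLin.toMonoidHom).comp G.subtype

theorem Subgroup.columnHom_injective (G : Subgroup (GL (Fin n) F)) :
    Function.Injective G.columnHom :=
  ((LinearMap.GeneralLinearGroup.generalLinearEquiv F (Fin n → F)).injective.comp
    Matrix.GeneralLinearGroup.toLin.injective).comp Subtype.val_injective

theorem SLinGL.mem_of_det_eq_one {A : GL (Fin n) F} (h : (A : Matrix (Fin n) (Fin n) F).det = 1) :
    A ∈ SLinGL n F :=
  ⟨⟨A, h⟩, Units.ext rfl⟩

theorem Subgroup.mem_range_columnHom {G : Subgroup (GL (Fin n) F)} (hG : SLinGL n F ≤ G)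
    (g : (Fin n → F) ≃ₗ[F] (Fin n → F))
    (hg : LinearMap.det (g : (Fin n → F) →ₗ[F] (Fin n → F)) = 1) : g ∈ G.columnHom.range := by
  obtain ⟨A, rfl⟩ := ((LinearMap.GeneralLinearGroup.generalLinearEquiv F
    (Fin n → F)).surjective.comp
    Matrix.GeneralLinearGroup.toLin.surjective) g
  refine ⟨⟨A, hG (SLinGL.mem_of_det_eq_one ?_)⟩, rfl⟩
  rw [← hg, ← LinearMap.det_toLin']
  rfl

theorem exists_not_commute_of_SLinGL_le {G : Subgroup (GL (Fin n) F)} (hG : SLinGL n F ≤ G)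
    (hn : 2 < n) : ∃ a b : G, a * b ≠ b * a := by
  obtain ⟨i, j, hij⟩ : ∃ i j : Fin n, i ≠ j := ⟨⟨0, by omega⟩, ⟨1, by omega⟩, by simp⟩
  let a : Matrix.SpecialLinearGroup (Fin n) F :=
    ⟨Matrix.transvection i j 1, Matrix.det_transvection_of_ne i j hij 1⟩
  let b : Matrix.SpecialLinearGroup (Fin n) F :=
    ⟨Matrix.transvection j i 1, Matrix.det_transvection_of_ne j i hij.symm 1⟩
  refine ⟨⟨_, hG ⟨a, rfl⟩⟩, ⟨_, hG ⟨b, rfl⟩⟩, fun h => ?_⟩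
  have h1 : Matrix.transvection i j (1 : F) * Matrix.transvection j i 1 =
      Matrix.transvection j i 1 * Matrix.transvection i j 1 :=
    congrArg (fun g : G => ((g : GL (Fin n) F) : Matrix (Fin n) (Fin n) F)) h
  have h2 := congrFun (congrFun h1 i) i
  simp [Matrix.transvection, add_mul, mul_add, hij.symm] at h2

theorem one_le_kappaIndep (G : Type*) [Group G] [Finite G] (hnc : ∃ a b : G, a * b ≠ b * a) :
    1 ≤ kappaIndep G := by
  simpa using card_le_kappaIndep (ι := Unit) (fun _ => (1 : G)) hnc fun i j h => absurd rfl h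

theorem div_lt_kappaIndep [Finite F] {G : Subgroup (GL (Fin n) F)} (hG : SLinGL n F ≤ G)
    (hn : 2 < n) : n / 12 < kappaIndep G := by
  have hnc := exists_not_commute_of_SLinGL_le hG hn
  rcases lt_or_ge n 12 with h | h
  · have := one_le_kappaIndep G hnc
    omega
  · obtain ⟨ι, _, D, hι, hD, hdisj⟩ := exists_isBlockDims_family h
    have hf : Module.finrank F (Fin n → F) = n := by simp
    exact hι.trans_lt (card_lt_kappaIndep_of_isBlockDims G.columnHom_injective
      (Subgroup.mem_range_columnHom hG) hnc (by omega) (by simpa [hf] using hD) hdisj)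

end Matrices

theorem IsNormalCover.of_fintype {G : Type*} [Group G] {ι : Type*} [Fintype ι] (H : ι → Subgroup G)
    (hH : ∀ i, H i ≠ ⊤) (hcov : ∀ g : G, ∃ i, ∃ x : G, x * g * x⁻¹ ∈ H i) :
    IsNormalCover G (Fintype.card ι) := by
  refine ⟨fun i => H ((Fintype.equivFin ι).symm i), fun i => hH _, fun g => ?_⟩
  obtain ⟨i, hi⟩ := hcov g
  exact ⟨Fintype.equivFin ι i, by simpa using hi⟩

theorem IsIndependentClasses.card_le {G : Type*} [Group G] {S : Finset (ConjClasses G)} {k : ℕ}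
    (hS : IsIndependentClasses G S) (hk : IsNormalCover G k) : S.card ≤ k := by
  obtain ⟨H, hH, hcov⟩ := hk
  have h1 : ∀ c : ConjClasses G, ∃ i, ∃ y ∈ c.carrier, y ∈ H i := by
    intro c
    obtain ⟨g, rfl⟩ := ConjClasses.exists_rep c
    obtain ⟨i, x, hx⟩ := hcov g
    refine ⟨i, _, ?_, hx⟩
    rw [ConjClasses.mem_carrier_iff_mk_eq, ConjClasses.mk_eq_mk_iff_isConj]
    exact (isConj_iff.2 ⟨x, rfl⟩).symm
  choose i y hy hyi using h1
  have h2 : Set.InjOn i S := by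
    intro c hc d hd hcd
    by_contra hne
    refine hH (i c) (top_le_iff.1 ?_)
    rw [← hS c hc d hd hne _ (hy c) _ (hy d), Subgroup.closure_le]
    rintro z (rfl | rfl)
    · exact hyi c
    · rw [hcd]
      exact hyi d
  calc S.card ≤ (Finset.univ : Finset (Fin k)).card :=
        Finset.card_le_card_of_injOn i (fun _ _ => Finset.mem_coe.2 (Finset.mem_univ _)) h2
    _ = k := by simp

theorem kappaIndep_le_gammaCover {G : Type*} [Group G] {k : ℕ} (hk : IsNormalCover G k) :
    kappaIndep G ≤ gammaCover G := by
  refine csSup_le ⟨0, ∅, rfl, fun c hc => absurd hc (Finset.notMem_empty c)⟩ ?_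
  rintro _ ⟨S, rfl, hS⟩
  exact hS.card_le (Nat.sInf_mem (s := {k | IsNormalCover G k}) ⟨k, hk⟩)

section Cyclic

open Polynomial

variable {F V : Type*} [Field F] [AddCommGroup V] [Module F V]

theorem Module.End.aeval_apply_mem {g : Module.End F V} {C : Submodule F V} (hC : ∀ v ∈ C, g v ∈ C)
    (f : F[X]) {v : V} (hv : v ∈ C) : aeval g f v ∈ C := by
  have hpow : ∀ k : ℕ, (g ^ k) v ∈ C := by
    intro k
    induction k with
    | zero => simpa using hv
    | succ k ih =>
      rw [pow_succ']
      exact hC _ ih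
  rw [aeval_eq_sum_range, LinearMap.sum_apply]
  exact C.sum_mem fun i _ => C.smul_mem _ (hpow i)

/-- The cyclic subspace generated by a vector killed by an irreducible polynomial in `g`. -/
theorem Module.End.exists_cyclic_of_irreducible {g : Module.End F V} {p : F[X]}
    (hp : Irreducible p) {v : V} (hv : v ≠ 0) (hpv : aeval g p v = 0) :
    ∃ C : Submodule F V, (∀ w ∈ C, g w ∈ C) ∧ v ∈ C ∧ Module.finrank F C = p.natDegree ∧
      ∀ C' : Submodule F V, (∀ w ∈ C', g w ∈ C') → v ∈ C' → C ≤ C' := by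
  let L : F[X] →ₗ[F] V := (LinearMap.applyₗ v).comp (aeval g).toLinearMap
  have hL : ∀ f, L f = aeval g f v := fun f => rfl
  have hker : LinearMap.ker L = (Ideal.span {p}).restrictScalars F := by
    ext f
    rw [LinearMap.mem_ker, Submodule.restrictScalars_mem, Ideal.mem_span_singleton, hL]
    refine ⟨fun hf => ?_, ?_⟩
    · by_contra hpf
      obtain ⟨a, b, hab⟩ := (hp.coprime_iff_not_dvd).2 hpf
      apply hv
      have h1 : aeval g (a * p + b * f) v = v := by rw [hab, map_one]; rfl
      rw [← h1, map_add, map_mul, map_mul, LinearMap.add_apply, Module.End.mul_apply,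
        Module.End.mul_apply, hpv, hf, map_zero, map_zero, add_zero]
    · rintro ⟨c, rfl⟩
      rw [mul_comm, map_mul, Module.End.mul_apply, hpv, map_zero]
  refine ⟨LinearMap.range L, ?_, ⟨1, by rw [hL, map_one]; rfl⟩, ?_, ?_⟩
  · rintro _ ⟨f, rfl⟩
    exact ⟨X * f, by rw [hL, map_mul, aeval_X]; rfl⟩
  · rw [← L.quotKerEquivRange.finrank_eq, hker,
      (Submodule.Quotient.restrictScalarsEquiv F (Ideal.span {p})).finrank_eq,
      finrank_quotient_span_eq_natDegree]
  · rintro C' hC' hv' _ ⟨f, rfl⟩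
    exact aeval_apply_mem hC' f hv'

variable [FiniteDimensional F V] {g : Module.End F V} {p : F[X]}

theorem Module.End.exists_aeval_apply_eq_zero (hp : Irreducible p) (hpg : p ∣ minpoly F g) :
    ∃ v, v ≠ 0 ∧ aeval g p v = 0 := by
  by_contra! h
  have hinj : Function.Injective (aeval g p) :=
    (injective_iff_map_eq_zero _).2 fun v hv => by_contra fun hne => h v hne hv
  obtain ⟨c, hc⟩ := hpg
  have h0 : minpoly F g ≠ 0 := minpoly.ne_zero (Algebra.IsIntegral.isIntegral g)
  have hc0 : c ≠ 0 := by
    rintro rfl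
    exact h0 (by rw [hc, mul_zero])
  have h1 : aeval g c = 0 := by
    ext v
    apply hinj
    have h2 := minpoly.aeval F g
    rw [hc, map_mul] at h2
    rw [← Module.End.mul_apply, h2]
    simp
  have h3 := natDegree_le_of_dvd (minpoly.dvd F g h1) hc0
  rw [hc, natDegree_mul hp.ne_zero hc0] at h3
  have := hp.natDegree_pos
  omega

theorem Module.End.natDegree_le_of_dvd_minpoly (hp : Irreducible p) (hpg : p ∣ minpoly F g) :
    p.natDegree ≤ Module.finrank F V := by
  obtain ⟨v, hv, hpv⟩ := exists_aeval_apply_eq_zero hp hpg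
  obtain ⟨C, -, -, hC, -⟩ := exists_cyclic_of_irreducible hp hv hpv
  exact hC ▸ C.finrank_le

theorem Module.End.exists_invariant_finrank_eq (hp : Irreducible p) (hpg : p ∣ minpoly F g) :
    ∃ C : Submodule F V, (∀ w ∈ C, g w ∈ C) ∧ Module.finrank F C = p.natDegree := by
  obtain ⟨v, hv, hpv⟩ := exists_aeval_apply_eq_zero hp hpg
  obtain ⟨C, h1, -, h2, -⟩ := exists_cyclic_of_irreducible hp hv hpv
  exact ⟨C, h1, h2⟩

theorem Module.End.exists_invariant_finrank_add_eq (hp : Irreducible p) (hpg : p ∣ minpoly F g)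
    (hlt : Module.finrank F V < 2 * p.natDegree) :
    ∃ C : Submodule F V, (∀ w ∈ C, g w ∈ C) ∧
      Module.finrank F C + p.natDegree = Module.finrank F V := by
  obtain ⟨v, hv, hpv⟩ := exists_aeval_apply_eq_zero hp hpg
  obtain ⟨C, hC, hvC, hCp, hmin⟩ := exists_cyclic_of_irreducible hp hv hpv
  have hcomm : ∀ w, aeval g p (g w) = g (aeval g p w) := by
    intro w
    have h1 : aeval g (p * X) = aeval g (X * p) := by rw [mul_comm]
    rw [map_mul, map_mul, aeval_X] at h1
    exact LinearMap.congr_fun h1 w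
  have hker : LinearMap.ker (aeval g p) = C := by
    refine le_antisymm (fun w hw => ?_) (hmin _ (fun w hw => ?_) hpv)
    · by_contra hwC
      have hw0 : w ≠ 0 := fun h => hwC (h ▸ C.zero_mem)
      obtain ⟨C', hC', hwC', hCp', hmin'⟩ := exists_cyclic_of_irreducible hp hw0 hw
      have h1 : C ⊓ C' ≠ ⊥ := by
        intro h
        have h2 := Submodule.finrank_sup_add_finrank_inf_eq C C'
        have h3 := (C ⊔ C').finrank_le
        rw [h, finrank_bot] at h2
        omega
      obtain ⟨u, hu, hu0⟩ := Submodule.exists_mem_ne_zero_of_ne_bot h1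
      have hpu : aeval g p u = 0 := hmin (LinearMap.ker (aeval g p))
        (fun w hw => by rw [LinearMap.mem_ker, hcomm, LinearMap.mem_ker.1 hw, map_zero]) hpv hu.1
      obtain ⟨D, hD, -, hDp, hminD⟩ := exists_cyclic_of_irreducible hp hu0 hpu
      have h2 : D = C := Submodule.eq_of_le_of_finrank_eq (hminD C hC hu.1) (by rw [hDp, hCp])
      have h3 : D = C' := Submodule.eq_of_le_of_finrank_eq (hminD C' hC' hu.2) (by rw [hDp, hCp'])
      exact hwC (h2 ▸ h3 ▸ hwC')
    · rw [LinearMap.mem_ker, hcomm, LinearMap.mem_ker.1 hw, map_zero]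
  refine ⟨LinearMap.range (aeval g p), ?_, ?_⟩
  · rintro _ ⟨w, rfl⟩
    exact ⟨g w, hcomm w⟩
  · rw [← hCp, ← hker, LinearMap.finrank_range_add_finrank_ker]

end Cyclic

section FieldAction

open Polynomial

variable {F E : Type*} [Field F] [Finite F] [Field E] [Algebra F E]

theorem Polynomial.exists_dvd_comp_pow {f : F[X]} {α : E} (hf : aeval α f = 0) {μ : F[X]}
    (hμ : μ ≠ 0) (h : ∀ p, Irreducible p → p ∣ μ → Module.finrank F E ∣ p.natDegree) :
    ∃ (a : F[X]) (N : ℕ), μ ∣ (f.comp a) ^ N := by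
  induction μ using UniqueFactorizationMonoid.induction_on_coprime with
  | h0 => exact absurd rfl hμ
  | h1 hx => exact ⟨0, 0, hx.dvd⟩
  | hpr i hp =>
    rename_i p
    rcases Nat.eq_zero_or_pos i with rfl | hi
    · exact ⟨0, 0, by simp⟩
    have hp' := hp.irreducible
    have := Fact.mk hp'
    have hfin : Module.finrank F (AdjoinRoot p) = p.natDegree :=
      finrank_quotient_span_eq_natDegree
    have : FiniteDimensional F (AdjoinRoot p) :=
      Module.finite_of_finrank_pos (hfin ▸ hp'.natDegree_pos)
    have : Finite (AdjoinRoot p) := Module.finite_of_finite F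
    obtain ⟨θ⟩ := FiniteField.nonempty_algHom_of_finrank_dvd (F := F) (K := E) (L := AdjoinRoot p)
      (hfin ▸ h p hp' (dvd_pow_self p hi.ne'))
    obtain ⟨a, ha⟩ := AdjoinRoot.mk_surjective (θ α)
    refine ⟨a, i, pow_dvd_pow_of_dvd ?_ i⟩
    rw [← AdjoinRoot.mk_eq_zero, ← AdjoinRoot.aeval_eq, aeval_comp, AdjoinRoot.aeval_eq, ha,
      aeval_algHom_apply, hf, map_zero]
  | hcp hxy hx hy =>
    rename_i x y
    obtain ⟨a, N, ha⟩ := hx (left_ne_zero_of_mul hμ) fun p hp h1 => h p hp (h1.mul_right y)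
    obtain ⟨b, M, hb⟩ := hy (right_ne_zero_of_mul hμ) fun p hp h1 => h p hp (h1.mul_left x)
    obtain ⟨u, v, huv⟩ := hxy.isCoprime
    have hcomp : ∀ c d z : F[X], z ∣ c - d → ∀ K, z ∣ (f.comp d) ^ K → z ∣ (f.comp c) ^ K := by
      intro c d z hz K hd
      have h1 : c - d ∣ f.comp c ^ K - f.comp d ^ K := by
        rw [comp_eq_aeval, comp_eq_aeval, aeval_def, aeval_def, eval₂_eq_eval_map,
          eval₂_eq_eval_map]
        exact (sub_dvd_eval_sub c d _).trans (sub_dvd_pow_sub_pow _ _ K)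
      simpa using dvd_add (hz.trans h1) hd
    refine ⟨a * (v * y) + b * (u * x), max N M, hxy.isCoprime.mul_dvd ?_ ?_⟩
    · refine hcomp _ a _ ⟨u * (b - a), ?_⟩ _ (ha.trans (pow_dvd_pow _ (le_max_left N M)))
      linear_combination a * huv
    · refine hcomp _ b _ ⟨v * (a - b), ?_⟩ _ (hb.trans (pow_dvd_pow _ (le_max_right N M)))
      linear_combination b * huv

/-- If the degree of `E` over `F` divides the degrees of all irreducible factors of the minimal
polynomial of `g`, then `E` acts on `V` commuting with `g`. -/
theorem Module.End.exists_algHom_commute [FiniteDimensional F E] {V : Type*} [AddCommGroup V]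
    [Module F V]
    [FiniteDimensional F V]
    (g : Module.End F V)
    (h : ∀ p, Irreducible p → p ∣ minpoly F g → Module.finrank F E ∣ p.natDegree) :
    ∃ ψ : E →ₐ[F] Module.End F V, ∀ x, ψ x * g = g * ψ x := by
  let _ : Fintype F := Fintype.ofFinite F
  let pb := Field.powerBasisOfFiniteOfSeparable F E
  obtain ⟨a, N, haN⟩ := Polynomial.exists_dvd_comp_pow (minpoly.aeval F pb.gen)
    (minpoly.ne_zero (Algebra.IsIntegral.isIntegral g)) h
  have hpow : ∀ M : ℕ, (minpoly F pb.gen).comp (a ^ Fintype.card F ^ M) =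
      ((minpoly F pb.gen).comp a) ^ Fintype.card F ^ M := by
    intro M
    induction M with
    | zero => simp
    | succ M ih =>
      rw [pow_succ, pow_mul, pow_mul, ← ih, ← X_pow_comp, ← comp_assoc, ← expand_eq_comp_X_pow,
        FiniteField.expand_card, pow_comp]
  have hy : aeval (aeval g (a ^ Fintype.card F ^ N)) (minpoly F pb.gen) = 0 := by
    rw [← aeval_comp, hpow]
    obtain ⟨c, hc⟩ := haN.trans (pow_dvd_pow _ (Nat.lt_pow_self (Fintype.one_lt_card (α := F))).le)
    rw [hc, map_mul, minpoly.aeval, zero_mul]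
  refine ⟨pb.lift _ hy, fun x => ?_⟩
  obtain ⟨b, rfl⟩ := pb.exists_eq_aeval' x
  rw [pb.lift_aeval, ← aeval_comp]
  have h1 := congrArg (aeval g) (mul_comm (b.comp (a ^ Fintype.card F ^ N)) X)
  rwa [map_mul, map_mul, aeval_X] at h1

end FieldAction

section Subgroups

variable {F V : Type*} [Field F] [AddCommGroup V] [Module F V]

/-- The stabilizer of a subspace. -/
def Submodule.linearStabilizer (U : Submodule F V) : Subgroup (V ≃ₗ[F] V) where
  carrier := {g | ∀ v, g v ∈ U ↔ v ∈ U}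
  one_mem' _ := Iff.rfl
  mul_mem' {g h} hg hh v := (hg (h v)).trans (hh v)
  inv_mem' {g} hg v := by
    rw [← hg (g⁻¹ v), ← LinearEquiv.mul_apply, mul_inv_cancel]
    rfl

theorem Submodule.mem_linearStabilizer [FiniteDimensional F V] {U : Submodule F V} {g : V ≃ₗ[F] V}
    (h : ∀ v ∈ U, g v ∈ U) : g ∈ U.linearStabilizer := by
  intro v
  refine ⟨fun hv => ?_, h v⟩
  have h1 : U.map (g : V →ₗ[F] V) = U :=
    Submodule.eq_of_le_of_finrank_eq (Submodule.map_le_iff_le_comap.2 h)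
      (LinearEquiv.finrank_map_eq g U)
  rw [← h1] at hv
  obtain ⟨w, hw, hwv⟩ := hv
  rwa [← g.injective hwv]

/-- The automorphisms of an `E`-space that are linear over `E`. -/
def semilinearCentralizer (F E V : Type*) [Field F] [Field E] [AddCommGroup V] [Module F V]
    [Module E V] : Subgroup (V ≃ₗ[F] V) where
  carrier := {g | ∀ (x : E) v, g (x • v) = x • g v}
  one_mem' _ _ := rfl
  mul_mem' {g h} hg hh x v := by rw [LinearEquiv.mul_apply, hh, hg, LinearEquiv.mul_apply]
  inv_mem' {g} hg x v := by
    apply g.injective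
    rw [hg, ← LinearEquiv.mul_apply, ← LinearEquiv.mul_apply, mul_inv_cancel]
    rfl

theorem exists_dual_ne_zero_of_notMem_span {u w : V} (h : w ∉ Submodule.span F {u}) :
    ∃ f : Module.Dual F V, f w ≠ 0 ∧ f u = 0 := by
  obtain ⟨f, hf, hfu⟩ := Submodule.exists_dual_map_eq_bot_of_notMem h inferInstance
  refine ⟨f, hf, ?_⟩
  have : f u ∈ (Submodule.span F {u}).map f := ⟨u, Submodule.mem_span_singleton_self u, rfl⟩
  rwa [hfu, Submodule.mem_bot] at this

variable {G : Type*} [Group G] {φ : G →* (V ≃ₗ[F] V)}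

theorem comap_ne_top_of_transvection
    (hdet : ∀ g : V ≃ₗ[F] V, LinearMap.det (g : V →ₗ[F] V) = 1 → g ∈ φ.range)
    {H : Subgroup (V ≃ₗ[F] V)} {f : Module.Dual F V} {u : V} (hf : f u = 0)
    (h : LinearEquiv.transvection hf ∉ H) : H.comap φ ≠ ⊤ := by
  intro htop
  obtain ⟨x, hx⟩ := hdet (LinearEquiv.transvection hf) (by
    rw [← LinearEquiv.coe_det, LinearEquiv.transvection.det_eq_one, Units.val_one])
  exact h (hx ▸ Subgroup.mem_comap.1 (htop ▸ Subgroup.mem_top x))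

theorem Submodule.comap_linearStabilizer_ne_top
    (hdet : ∀ g : V ≃ₗ[F] V, LinearMap.det (g : V →ₗ[F] V) = 1 → g ∈ φ.range)
    {U : Submodule F V} (h0 : U ≠ ⊥) (h1 : U ≠ ⊤) : U.linearStabilizer.comap φ ≠ ⊤ := by
  obtain ⟨w, hw, hw0⟩ := Submodule.exists_mem_ne_zero_of_ne_bot h0
  obtain ⟨u, hu⟩ : ∃ u, u ∉ U := by
    by_contra! h
    exact h1 (eq_top_iff.2 fun v _ => h v)
  obtain ⟨f, hfw, hfu⟩ : ∃ f : Module.Dual F V, f w ≠ 0 ∧ f u = 0 := by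
    refine exists_dual_ne_zero_of_notMem_span fun h => ?_
    obtain ⟨c, rfl⟩ := Submodule.mem_span_singleton.1 h
    have hc : c ≠ 0 := fun h => hw0 (by rw [h, zero_smul])
    exact hu ((U.smul_mem_iff hc).1 hw)
  refine comap_ne_top_of_transvection hdet hfu fun h => hu ?_
  have h2 : w + f w • u ∈ U := (h w).2 hw
  exact (U.smul_mem_iff hfw).1 ((U.add_mem_iff_right hw).1 h2)

theorem comap_semilinearCentralizer_ne_top {E : Type*} [Field E] [Algebra F E] [Module E V]
    [IsScalarTower F E V] [Nontrivial V]
    (hdet : ∀ g : V ≃ₗ[F] V, LinearMap.det (g : V →ₗ[F] V) = 1 → g ∈ φ.range)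
    (hE : 1 < Module.finrank F E) : (semilinearCentralizer F E V).comap φ ≠ ⊤ := by
  obtain ⟨t, ht⟩ : ∃ t : E, ∀ c : F, algebraMap F E c ≠ t := by
    by_contra! h
    have : (⊤ : Subalgebra F E) = ⊥ :=
      (eq_bot_iff.2 fun x _ => Algebra.mem_bot.2 (h x))
    have h2 := Subalgebra.bot_eq_top_iff_finrank_eq_one.1 this.symm
    omega
  obtain ⟨u, hu⟩ := exists_ne (0 : V)
  obtain ⟨f, hfw, hfu⟩ : ∃ f : Module.Dual F V, f (t • u) ≠ 0 ∧ f u = 0 := by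
    refine exists_dual_ne_zero_of_notMem_span fun h => ?_
    obtain ⟨c, hc⟩ := Submodule.mem_span_singleton.1 h
    rw [← algebraMap_smul E c u] at hc
    exact ht c (smul_left_injective E hu hc)
  refine comap_ne_top_of_transvection hdet hfu fun h => ?_
  have h2 : t • u + f (t • u) • u = t • (u + f u • u) := h t u
  rw [hfu, zero_smul, add_zero, add_eq_left, smul_eq_zero] at h2
  exact h2.elim hfw hu

end Subgroups

section Conjugacy

theorem Submodule.exists_det_eq_of_ne_bot {K W : Type*} [Field K] [AddCommGroup W] [Module K W]
    [FiniteDimensional K W] {U : Submodule K W} (hU : U ≠ ⊥) (δ : Kˣ) :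
    ∃ c : W ≃ₗ[K] W, LinearMap.det (c : W →ₗ[K] W) = δ ∧ ∀ v ∈ U, c v ∈ U := by
  obtain ⟨u, hu, hu0⟩ := Submodule.exists_mem_ne_zero_of_ne_bot hU
  obtain ⟨f, hf, -⟩ := exists_dual_ne_zero_of_notMem_span (F := K) (u := 0) (w := u)
    (by simpa using hu0)
  have hval : 1 + (((δ : K) - 1) / f u) • f u = δ := by
    rw [smul_eq_mul, div_mul_cancel₀ _ hf, add_sub_cancel]
  have hunit : IsUnit (1 + ((((δ : K) - 1) / f u) • f) u) := by
    rw [LinearMap.smul_apply, hval]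
    exact δ.isUnit
  refine ⟨LinearEquiv.dilatransvection hunit, ?_, fun v hv => ?_⟩
  · rw [LinearEquiv.dilatransvection.coe_toLinearMap, LinearMap.transvection.det,
      LinearMap.smul_apply, hval]
  · exact U.add_mem hv (U.smul_mem _ hu)

variable {F V G : Type*} [Field F] [AddCommGroup V] [Module F V] [FiniteDimensional F V] [Group G]
  {φ : G →* (V ≃ₗ[F] V)}
  (hdet : ∀ g : V ≃ₗ[F] V, LinearMap.det (g : V →ₗ[F] V) = 1 → g ∈ φ.range)

include hdet

theorem exists_conj_mem_comap_linearStabilizer {U W : Submodule F V} (hU : U ≠ ⊥)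
    (hUW : Module.finrank F W = Module.finrank F U) {g : G} (hg : ∀ v ∈ W, φ g v ∈ W) :
    ∃ x : G, x * g * x⁻¹ ∈ U.linearStabilizer.comap φ := by
  obtain ⟨e, he⟩ := Submodule.exists_linearEquiv_restrict_eq (LinearEquiv.ofFinrankEq W U hUW)
  obtain ⟨c, hc, hcU⟩ := Submodule.exists_det_eq_of_ne_bot hU (LinearEquiv.det e)⁻¹
  obtain ⟨x, hx⟩ := hdet (c * e) (by
    rw [← LinearEquiv.coe_det, map_mul, Units.val_mul, LinearEquiv.coe_det c, hc, Units.inv_mul])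
  refine ⟨x, Submodule.mem_linearStabilizer fun v hv => ?_⟩
  have h1 : ∀ w ∈ W, φ x w ∈ U := by
    intro w hw
    rw [hx, LinearEquiv.mul_apply]
    exact hcU _ (he ⟨w, hw⟩ ▸ Subtype.prop _)
  have h2 : (φ x)⁻¹ v ∈ W := by
    have h3 : W.map (φ x : V →ₗ[F] V) = U :=
      Submodule.eq_of_le_of_finrank_eq (Submodule.map_le_iff_le_comap.2 h1)
        ((LinearEquiv.finrank_map_eq (φ x) W).trans hUW)
    rw [← h3] at hv
    obtain ⟨w, hw, rfl⟩ := hv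
    change ((φ x)⁻¹ * φ x) w ∈ W
    rwa [inv_mul_cancel]
  rw [map_mul, map_mul, map_inv]
  exact h1 _ (hg _ h2)

end Conjugacy

section Conjugacy

variable {F E V : Type*} [Field F] [Finite F] [Field E] [Algebra F E] [FiniteDimensional F E]
  [AddCommGroup V] [Module F V] [FiniteDimensional F V]

theorem exists_linearEquiv_smul_of_algHom {W : Type*} [AddCommGroup W] [Module F W]
    [Module E W] [IsScalarTower F E W] [FiniteDimensional F W]
    (hVW : Module.finrank F V = Module.finrank F W) (ψ : E →ₐ[F] Module.End F V) :
    ∃ e : V ≃ₗ[F] W, ∀ x v, e (ψ x v) = x • e v := by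
  let _ : Module E V := Module.compHom V ψ.toRingHom
  have hs : ∀ (x : E) (v : V), x • v = ψ x v := fun _ _ => rfl
  have : IsScalarTower F E V := ⟨fun c x v => by
    rw [hs, hs, map_smul, LinearMap.smul_apply]⟩
  have h1 := Module.finrank_mul_finrank F E V
  have h2 := Module.finrank_mul_finrank F E W
  have : FiniteDimensional E V := Module.Finite.of_restrictScalars_finite F E V
  have : FiniteDimensional E W := Module.Finite.of_restrictScalars_finite F E W
  have h3 : Module.finrank E V = Module.finrank E W :=
    Nat.eq_of_mul_eq_mul_left (Module.finrank_pos (R := F) (M := E)) (by rw [h1, h2, hVW])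
  let e := LinearEquiv.ofFinrankEq V W h3
  exact ⟨e.restrictScalars F, fun x v => e.map_smul x v⟩

theorem exists_mem_semilinearCentralizer_det_eq [Module E V] [IsScalarTower F E V] [Nontrivial V]
    (δ : Fˣ) : ∃ c ∈ semilinearCentralizer F E V, LinearMap.det (c : V →ₗ[F] V) = δ := by
  have : FiniteDimensional E V := Module.Finite.of_restrictScalars_finite F E V
  have : Finite E := Module.finite_of_finite F
  obtain ⟨ω, hω⟩ := FiniteField.unitsMap_norm_surjective F E δ
  obtain ⟨c, hc, -⟩ := Submodule.exists_det_eq_of_ne_bot (top_ne_bot (α := Submodule E V)) ω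
  refine ⟨c.restrictScalars F, fun x v => c.map_smul x v, ?_⟩
  have h1 : ((c.restrictScalars F : V ≃ₗ[F] V) : V →ₗ[F] V) =
    (c : V →ₗ[E] V).restrictScalars F := rfl
  rw [h1, LinearMap.det_restrictScalars, hc, ← hω]
  rfl

theorem exists_conj_mem_comap_semilinearCentralizer [Module E V] [IsScalarTower F E V]
    [Nontrivial V] {G : Type*} [Group G] {φ : G →* (V ≃ₗ[F] V)}
    (hdet : ∀ g : V ≃ₗ[F] V, LinearMap.det (g : V →ₗ[F] V) = 1 → g ∈ φ.range) {g : G}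
    (hg : ∀ p, Irreducible p → p ∣ minpoly F (φ g : V →ₗ[F] V) →
      Module.finrank F E ∣ p.natDegree) :
    ∃ x : G, x * g * x⁻¹ ∈ (semilinearCentralizer F E V).comap φ := by
  obtain ⟨ψ, hψ⟩ := Module.End.exists_algHom_commute (E := E) (φ g : V →ₗ[F] V) hg
  obtain ⟨e, he⟩ := exists_linearEquiv_smul_of_algHom (W := V) rfl ψ
  obtain ⟨c, hcE, hc⟩ := exists_mem_semilinearCentralizer_det_eq (E := E) (V := V)
    (LinearEquiv.det e)⁻¹
  obtain ⟨x, hx⟩ := hdet (c * e) (by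
    rw [← LinearEquiv.coe_det, map_mul, Units.val_mul, LinearEquiv.coe_det c, hc, Units.inv_mul])
  have h1 : ∀ t v, φ x (ψ t v) = t • φ x v := by
    intro t v
    rw [hx, LinearEquiv.mul_apply, LinearEquiv.mul_apply, he, hcE]
  refine ⟨x, fun t w => ?_⟩
  obtain ⟨u, rfl⟩ := (φ x).surjective w
  have h2 : ∀ v, φ (x * g * x⁻¹) (φ x v) = φ x (φ g v) := by
    intro v
    rw [← LinearEquiv.mul_apply, ← LinearEquiv.mul_apply, ← map_mul, ← map_mul,
      inv_mul_cancel_right]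
  have h3 : φ g (ψ t u) = ψ t (φ g u) := (LinearMap.congr_fun (hψ t) u).symm
  rw [← h1, h2, h2, h3, h1]

end Conjugacy

theorem isNormalCover_of_dims {F E V G : Type*} [Field F] [Finite F] [Field E] [Algebra F E]
    [FiniteDimensional F E] [AddCommGroup V] [Module F V] [FiniteDimensional F V] [Module E V]
    [IsScalarTower F E V] [Nontrivial V] [Group G] {φ : G →* (V ≃ₗ[F] V)}
    (hdet : ∀ g : V ≃ₗ[F] V, LinearMap.det (g : V →ₗ[F] V) = 1 → g ∈ φ.range)
    (hE : 1 < Module.finrank F E) (K : Finset ℕ)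
    (hK : ∀ k ∈ K, 0 < k ∧ k < Module.finrank F V)
    (hcov : ∀ d, d ≤ Module.finrank F V → ¬ Module.finrank F E ∣ d →
      d ∈ K ∨ Module.finrank F V < 2 * d ∧ Module.finrank F V - d ∈ K) :
    IsNormalCover G (K.card + 1) := by
  have hU : ∀ k : K, ∃ U : Submodule F V, Module.finrank F U = k := fun k => by
    obtain ⟨U, -, hU⟩ := Submodule.exists_le_finrank_eq (⊤ : Submodule F V) (j := k)
      (by rw [finrank_top]; exact (hK k k.2).2.le)
    exact ⟨U, hU⟩
  choose U hU using hU
  have hbot : ∀ k, U k ≠ ⊥ := fun k h => by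
    have h1 := hU k
    rw [h, finrank_bot] at h1
    exact (hK k k.2).1.ne h1
  have htop : ∀ k, U k ≠ ⊤ := fun k h => by
    have h1 := hU k
    rw [h, finrank_top] at h1
    exact (hK k k.2).2.ne' h1
  have hkey := IsNormalCover.of_fintype (ι := Option K) (fun i =>
      i.elim ((semilinearCentralizer F E V).comap φ) fun k => (U k).linearStabilizer.comap φ)
    (by
      rintro (_ | k)
      · exact comap_semilinearCentralizer_ne_top hdet hE
      · exact Submodule.comap_linearStabilizer_ne_top hdet (hbot k) (htop k))
    (fun g => by
      by_cases hg : ∀ p, Irreducible p → p ∣ minpoly F (φ g : V →ₗ[F] V) →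
        Module.finrank F E ∣ p.natDegree
      · exact ⟨none, exists_conj_mem_comap_semilinearCentralizer hdet hg⟩
      push Not at hg
      obtain ⟨p, hp, hpg, hpE⟩ := hg
      have hW : ∃ k ∈ K, ∃ W : Submodule F V, (∀ w ∈ W, φ g w ∈ W) ∧ Module.finrank F W = k := by
        rcases hcov _ (Module.End.natDegree_le_of_dvd_minpoly hp hpg) hpE with h | ⟨h, h'⟩
        · exact ⟨_, h, Module.End.exists_invariant_finrank_eq hp hpg⟩
        · obtain ⟨W, hW, hWp⟩ := Module.End.exists_invariant_finrank_add_eq hp hpg h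
          exact ⟨_, h', W, hW, by omega⟩
      obtain ⟨k, hk, W, hW, hWk⟩ := hW
      exact ⟨some ⟨k, hk⟩, exists_conj_mem_comap_linearStabilizer hdet (hbot ⟨k, hk⟩)
        (hWk.trans (hU ⟨k, hk⟩).symm) hW⟩)
  rwa [Fintype.card_option, Fintype.card_coe] at hkey

section Matrices

variable {F : Type*} [Field F] [Finite F] {n : ℕ}

theorem isNormalCover_of_SLinGL_le {G : Subgroup (GL (Fin n) F)} (hG : SLinGL n F ≤ G) {e : ℕ}
    (hn : 0 < n) (he : 1 < e) (hen : e ∣ n) (K : Finset ℕ) (hK : ∀ k ∈ K, 0 < k ∧ k < n)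
    (hcov : ∀ d, d ≤ n → ¬ e ∣ d → d ∈ K ∨ n < 2 * d ∧ n - d ∈ K) :
    IsNormalCover G (K.card + 1) := by
  obtain ⟨E, _, _, _, hE⟩ := exists_finite_extension F (show 0 < e by omega)
  obtain ⟨m, rfl⟩ := hen
  have : FiniteDimensional F E := .of_finite
  have : Nonempty (Fin m) := ⟨⟨0, Nat.pos_of_mul_pos_left hn⟩⟩
  have hV : Module.finrank F (Fin m → E) = e * m := by
    rw [Module.finrank_pi_fintype, Finset.sum_const, Finset.card_univ, Fintype.card_fin, hE,
      smul_eq_mul, mul_comm]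
  have e₀ : (Fin (e * m) → F) ≃ₗ[F] (Fin m → E) := LinearEquiv.ofFinrankEq _ _ (by simp [hV])
  refine isNormalCover_of_dims (E := E) (φ := e₀.conjGroupHom.toMonoidHom.comp G.columnHom)
    (fun g hg => ?_) (hE ▸ he) K (hV ▸ hK) (hV ▸ hE ▸ hcov)
  obtain ⟨g, rfl⟩ := e₀.conjGroupHom.surjective g
  rw [e₀.det_conjGroupHom] at hg
  obtain ⟨x, rfl⟩ := Subgroup.mem_range_columnHom hG g hg
  exact ⟨x, rfl⟩

theorem exists_isNormalCover {G : Subgroup (GL (Fin n) F)} (hG : SLinGL n F ≤ G) (hn : 2 < n) :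
    ∃ k, IsNormalCover G k ∧ 2 * k ≤ n + 1 := by
  rcases Nat.even_or_odd n with h | h
  · obtain ⟨m, rfl⟩ := h
    refine ⟨_, isNormalCover_of_SLinGL_le (e := 2) hG (by omega) (by omega) ⟨m, by ring⟩
      ((Finset.range ((m + 1) / 2)).image fun i => 2 * i + 1) ?_ ?_, ?_⟩
    · simp only [Finset.mem_image, Finset.mem_range]
      omega
    · intro d hd hd2
      have hodd : ∀ c, c % 2 = 1 → c ≤ m →
          c ∈ (Finset.range ((m + 1) / 2)).image fun i => 2 * i + 1 := fun c hc hcm =>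
        Finset.mem_image.2 ⟨c / 2, Finset.mem_range.2 (by omega), by omega⟩
      rcases le_or_gt d m with h | h
      · exact Or.inl (hodd d (by omega) h)
      · exact Or.inr ⟨by omega, hodd _ (by omega) (by omega)⟩
    · have := (Finset.card_image_le (s := Finset.range ((m + 1) / 2)) (f := fun i => 2 * i + 1))
      rw [Finset.card_range] at this
      omega
  · obtain ⟨m, rfl⟩ := h
    refine ⟨_, isNormalCover_of_SLinGL_le hG (by omega) (by omega) dvd_rfl (Finset.Icc 1 m) ?_ ?_,
      ?_⟩
    · simp only [Finset.mem_Icc]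
      omega
    · intro d hd hdn
      have h0 : d ≠ 0 := fun h => hdn (h ▸ dvd_zero _)
      have h1 : d ≠ 2 * m + 1 := fun h => hdn (h ▸ dvd_rfl)
      simp only [Finset.mem_Icc]
      omega
    · rw [Nat.card_Icc]
      omega

end Matrices

theorem linear_bounds
    (n q : ℕ) (hn : 2 < n) (hq : IsPrimePow q)
    (F : Type*) [Field F] [Fintype F] (hF : Fintype.card F = q)
    (G : Subgroup (GL (Fin n) F)) (hG : SLinGL n F ≤ G) :
    (n : ℚ) / 12 < (kappaIndep G : ℚ) ∧ kappaIndep G ≤ gammaCover G ∧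
      (gammaCover G : ℚ) ≤ ((n : ℚ) + 1) / 2 := by
  obtain ⟨k, hk, hkn⟩ := exists_isNormalCover hG hn
  refine ⟨?_, kappaIndep_le_gammaCover hk, ?_⟩
  · have h1 : n < kappaIndep G * 12 := (Nat.div_lt_iff_lt_mul (by norm_num)).1
      (div_lt_kappaIndep hG hn)
    rw [div_lt_iff₀ (by norm_num)]
    exact_mod_cast h1
  · have h1 : gammaCover G ≤ k := Nat.sInf_le hk
    rw [le_div_iff₀ (by norm_num)]
    exact_mod_cast show gammaCover G * 2 ≤ n + 1 by omega
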